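/- For every n ≥ 4, there exists a subgroup H of the automorphism group MulAut B_n of the braid group B_n such that H has exactly 2 elements and H is a complement to the inner automorphism group: the range of MulAut.conj : B_n →* MulAut B_n and H intersect trivially and together generate MulAut B_n (they form an IsComplement' pair). In particular Aut(B_n) is the (internal) semidirect product of Inn(B_n) ≅ B_n/Z by a group of order 2, recovering the theorem of Dyer–Grossman that Aut B_n ≅ (B_n/Z) ⋊ ℤ/2ℤ. -/

import Mathlib

/-- The braid relations on `n` strands, as elements of the free group on `Fin (n-1)`. -/
def braidRels (n : ℕ) : Set (FreeGroup (Fin (n - 1))) :=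
  {r | ∃ i j : Fin (n - 1), 2 ≤ |(i : ℤ) - (j : ℤ)| ∧
      r = FreeGroup.of i * FreeGroup.of j * (FreeGroup.of j * FreeGroup.of i)⁻¹} ∪
  {r | ∃ i j : Fin (n - 1), |(i : ℤ) - (j : ℤ)| = 1 ∧
      r = FreeGroup.of i * FreeGroup.of j * FreeGroup.of i *
        (FreeGroup.of j * FreeGroup.of i * FreeGroup.of j)⁻¹}

/-- The braid group on `n` strands. -/
abbrev B (n : ℕ) : Type := PresentedGroup (braidRels n)

/-- The standard generators of the braid group. -/
def σ {n : ℕ} (i : Fin (n - 1)) : B n := PresentedGroup.of i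

namespace BraidAut

/-! ### Generators and homomorphisms -/

section Basic

variable {n : ℕ} {G : Type*} [Group G]

/-- The standard generators of the braid group, indexed by all natural numbers. -/
def s {n : ℕ} (i : ℕ) : B n := if h : i < n - 1 then σ ⟨i, h⟩ else 1

lemma s_comm {i j : ℕ} (h : i + 2 ≤ j) : (s i : B n) * s j = s j * s i := by
  unfold s
  split_ifs with h1 h2
  · apply PresentedGroup.mk_eq_mk_of_mul_inv_mem
    refine Or.inl ⟨⟨i, h1⟩, ⟨j, h2⟩, ?_, rfl⟩
    rw [abs_sub_comm, abs_of_nonneg] <;> simp <;> omega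
  all_goals simp

lemma s_braid {i : ℕ} (h : i + 2 < n) :
    (s i : B n) * s (i + 1) * s i = s (i + 1) * s i * s (i + 1) := by
  unfold s
  rw [dif_pos (by omega), dif_pos (by omega)]
  apply PresentedGroup.mk_eq_mk_of_mul_inv_mem
  refine Or.inr ⟨⟨i, _⟩, ⟨i + 1, _⟩, ?_, rfl⟩
  simp

/-- A sequence in a group satisfying the braid relations on `n` strands. -/
structure IsBraid (n : ℕ) (f : ℕ → G) : Prop where
  comm : ∀ i j, i + 2 ≤ j → j + 1 < n → f i * f j = f j * f i
  braid : ∀ i, i + 2 < n → f i * f (i + 1) * f i = f (i + 1) * f i * f (i + 1)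

/-- The homomorphism out of the braid group given by a sequence satisfying the relations. -/
def lift (f : ℕ → G) (h : IsBraid n f) : B n →* G :=
  PresentedGroup.toGroup (rels := braidRels n) (f := fun i : Fin (n - 1) => f i) (by
    rintro r (⟨i, j, hij, rfl⟩ | ⟨i, j, hij, rfl⟩)
    · simp only [map_mul, map_inv, FreeGroup.lift_apply_of]
      rw [mul_inv_eq_one]
      rcases le_abs.1 hij with h1 | h1
      · exact (h.comm j i (by omega) (by omega)).symm
      · exact h.comm i j (by omega) (by omega)
    · simp only [map_mul, map_inv, FreeGroup.lift_apply_of]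
      rw [mul_inv_eq_one]
      rcases (abs_eq zero_le_one).1 hij with h1 | h1
      · have h2 : (i : ℕ) = j + 1 := by omega
        rw [h2]
        exact (h.braid j (by omega)).symm
      · have h2 : (j : ℕ) = i + 1 := by omega
        rw [h2]
        exact h.braid i (by omega))

@[simp] lemma lift_s (f : ℕ → G) (h : IsBraid n f) {i : ℕ} (hi : i + 1 < n) :
    lift f h (s i) = f i := by
  unfold s
  rw [dif_pos (by omega)]
  exact PresentedGroup.toGroup.of _

lemma s_eq_one {i : ℕ} (hi : n ≤ i + 1) : (s i : B n) = 1 := dif_neg (by omega)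

lemma hom_ext {f g : B n →* G} (h : ∀ i, i + 1 < n → f (s i) = g (s i)) : f = g := by
  apply PresentedGroup.ext
  intro i
  have := h i (by omega)
  unfold s at this
  rw [dif_pos i.2] at this
  exact this

lemma closure_s : Subgroup.closure {b : B n | ∃ i, i + 1 < n ∧ b = s i} = ⊤ := by
  rw [eq_top_iff, ← PresentedGroup.closure_range_of, Subgroup.closure_le]
  rintro _ ⟨i, rfl⟩
  refine Subgroup.subset_closure ⟨i, by omega, ?_⟩
  unfold s
  rw [dif_pos i.2]
  rfl

lemma mem_of_s {H : Subgroup (B n)} (h : ∀ i, i + 1 < n → s i ∈ H) (b : B n) : b ∈ H := by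
  have : (⊤ : Subgroup (B n)) ≤ H := by
    rw [← closure_s, Subgroup.closure_le]
    rintro _ ⟨i, hi, rfl⟩
    exact h i hi
  exact this trivial

/-- The exponent sum. -/
def e : B n →* Multiplicative ℤ := lift (fun _ => .ofAdd 1) ⟨fun _ _ _ _ => rfl, fun _ _ => rfl⟩

/-- The exponent sum as an integer. -/
def ex (b : B n) : ℤ := (e b).toAdd

@[simp] lemma ex_mul (a b : B n) : ex (a * b) = ex a + ex b := by
  simp only [ex, map_mul, toAdd_mul]
@[simp] lemma ex_one : ex (1 : B n) = 0 := by simp only [ex, map_one, toAdd_one]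
@[simp] lemma ex_inv (a : B n) : ex a⁻¹ = -ex a := by simp [ex]
@[simp] lemma ex_pow (a : B n) (k : ℕ) : ex (a ^ k) = k * ex a := by simp [ex]
@[simp] lemma ex_zpow (a : B n) (k : ℤ) : ex (a ^ k) = k * ex a := by simp [ex]
lemma ex_s {i : ℕ} (hi : i + 1 < n) : ex (s i : B n) = 1 := by simp [ex, e, hi]

end Basic

/-! ### Permutations and crossing numbers -/

section Crossing

variable {n : ℕ}

/-- Action of permutations on functions of two variables. -/
def permAct : Equiv.Perm ℕ →* MulAut (Multiplicative (ℕ → ℕ → ℤ)) where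
  toFun p :=
    { toFun := fun f => .ofAdd (fun q r => f.toAdd (p⁻¹ q) (p⁻¹ r))
      invFun := fun f => .ofAdd (fun q r => f.toAdd (p q) (p r))
      left_inv := fun f => by simp
      right_inv := fun f => by simp
      map_mul' := fun f g => rfl }
  map_one' := by ext; rfl
  map_mul' p p' := by ext; rfl

/-- The crossing function of one generator. -/
def eps (i q r : ℕ) : ℤ := if (q = i ∧ r = i + 1) ∨ (q = i + 1 ∧ r = i) then 1 else 0

/-- The generator of the crossing group. -/
def cs (i : ℕ) : Multiplicative (ℕ → ℕ → ℤ) ⋊[permAct] Equiv.Perm ℕ :=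
  ⟨.ofAdd (eps i), Equiv.swap i (i + 1)⟩

lemma permAct_apply (p : Equiv.Perm ℕ) (f) (q r : ℕ) :
    (permAct p f).toAdd q r = f.toAdd (p⁻¹ q) (p⁻¹ r) := rfl

lemma swap_braid {i : ℕ} : Equiv.swap i (i + 1) * Equiv.swap (i + 1) (i + 1 + 1) *
    Equiv.swap i (i + 1) = Equiv.swap (i + 1) (i + 1 + 1) * Equiv.swap i (i + 1) *
    Equiv.swap (i + 1) (i + 1 + 1) := by
  ext q
  simp only [Equiv.Perm.mul_apply, Equiv.swap_apply_def]
  split_ifs <;> omega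

lemma swap_comm' {i j : ℕ} (h : i + 2 ≤ j) : Equiv.swap i (i + 1) * Equiv.swap j (j + 1) =
    Equiv.swap j (j + 1) * Equiv.swap i (i + 1) := by
  ext q
  simp only [Equiv.Perm.mul_apply, Equiv.swap_apply_def]
  split_ifs <;> omega

lemma toAdd_ext {f g : Multiplicative (ℕ → ℕ → ℤ)} (h : ∀ q r, f.toAdd q r = g.toAdd q r) :
    f = g := by
  apply Multiplicative.toAdd.injective
  ext q r
  exact h q r

lemma eps_swap_self (i q r : ℕ) :
    eps i (Equiv.swap i (i + 1) q) (Equiv.swap i (i + 1) r) = eps i q r := by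
  simp only [eps, Equiv.swap_apply_eq_iff, Equiv.swap_apply_left, Equiv.swap_apply_right]
  congr 1
  exact propext or_comm

lemma eps_swap_far {i j : ℕ} (h : i + 2 ≤ j ∨ j + 2 ≤ i) (q r : ℕ) :
    eps i (Equiv.swap j (j + 1) q) (Equiv.swap j (j + 1) r) = eps i q r := by
  have h1 : Equiv.swap j (j + 1) i = i := Equiv.swap_apply_of_ne_of_ne (by omega) (by omega)
  have h2 : Equiv.swap j (j + 1) (i + 1) = i + 1 :=
    Equiv.swap_apply_of_ne_of_ne (by omega) (by omega)
  simp only [eps, Equiv.swap_apply_eq_iff, h1, h2]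

lemma eps_swap_swap (i q r : ℕ) :
    eps (i + 1) (Equiv.swap i (i + 1) q) (Equiv.swap i (i + 1) r) =
      eps i (Equiv.swap (i + 1) (i + 2) q) (Equiv.swap (i + 1) (i + 2) r) := by
  have h1 : Equiv.swap i (i + 1) (i + 2) = i + 2 :=
    Equiv.swap_apply_of_ne_of_ne (by omega) (by omega)
  have h2 : Equiv.swap (i + 1) (i + 2) i = i := Equiv.swap_apply_of_ne_of_ne (by omega) (by omega)
  simp only [eps, Equiv.swap_apply_eq_iff, h1, h2, add_assoc, Equiv.swap_apply_left,
    Equiv.swap_apply_right, one_add_one_eq_two]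

lemma cs_isBraid : IsBraid n cs where
  comm i j h _ := by
    apply SemidirectProduct.ext
    · apply toAdd_ext
      intro q r
      simp only [cs, SemidirectProduct.mul_left, toAdd_mul, Pi.add_apply, permAct_apply,
        toAdd_ofAdd, Equiv.swap_inv]
      rw [eps_swap_far (by omega), eps_swap_far (by omega), add_comm]
    · exact swap_comm' h
  braid i h := by
    apply SemidirectProduct.ext
    · apply toAdd_ext
      intro q r
      simp only [cs, SemidirectProduct.mul_left, SemidirectProduct.mul_right, toAdd_mul,
        Pi.add_apply, permAct_apply,
        toAdd_ofAdd, Equiv.swap_inv, mul_inv_rev, Equiv.Perm.mul_apply]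
      rw [show i + 1 + 1 = i + 2 from rfl, eps_swap_swap i q r,
        ← eps_swap_swap i (Equiv.swap i (i + 1) q),
        eps_swap_swap i (Equiv.swap (i + 1) (i + 2) q)]
      simp only [Equiv.swap_apply_self]
      ring
    · exact swap_braid

/-- The permutation and the crossing numbers of a braid. -/
def cr : B n →* Multiplicative (ℕ → ℕ → ℤ) ⋊[permAct] Equiv.Perm ℕ := lift cs cs_isBraid

/-- The permutation of a braid. -/
def π : B n →* Equiv.Perm ℕ := SemidirectProduct.rightHom.comp cr

/-- The crossing numbers of a braid. -/
def c (b : B n) (q r : ℕ) : ℤ := (cr b).left.toAdd q r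

lemma π_s {i : ℕ} (hi : i + 1 < n) : π (s i : B n) = Equiv.swap i (i + 1) := by
  simp [π, cr, hi, cs]

lemma c_s {i : ℕ} (hi : i + 1 < n) : c (s i : B n) = eps i := by
  funext q r
  simp only [c, cr, lift_s _ _ hi, cs]; rfl

@[simp] lemma c_one : c (1 : B n) = 0 := by
  funext q r
  simp only [c, map_one]; rfl

lemma c_mul (a b : B n) (q r : ℕ) : c (a * b) q r = c a q r + c b ((π a)⁻¹ q) ((π a)⁻¹ r) := by
  simp only [c, map_mul, SemidirectProduct.mul_left]
  rfl

lemma c_inv (a : B n) (q r : ℕ) : c a⁻¹ q r = - c a (π a q) (π a r) := by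
  have := c_mul a⁻¹ a q r
  simp at this
  linarith

lemma c_mul_of_pure {a : B n} (b : B n) (ha : π a = 1) (q r : ℕ) :
    c (a * b) q r = c a q r + c b q r := by
  simp [c_mul, ha]

lemma c_conj {p : B n} (b : B n) (hp : π p = 1) (q r : ℕ) :
    c (b * p * b⁻¹) q r = c p ((π b)⁻¹ q) ((π b)⁻¹ r) := by
  simp [c_mul, c_inv, hp]

lemma c_sq {i : ℕ} (hi : i + 1 < n) (q r : ℕ) : c (s i ^ 2 : B n) q r = 2 * eps i q r := by
  rw [pow_two, c_mul, c_s hi, π_s hi]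
  simp [Equiv.swap_apply_def, eps]
  split_ifs <;> omega

lemma π_sq {i : ℕ} (hi : i + 1 < n) : π (s i ^ 2 : B n) = 1 := by
  simp [π_s hi, pow_two]

lemma π_lt {b : B n} {q : ℕ} (hq : n ≤ q) : π b q = q := by
  have := mem_of_s (n := n) (H := (MulAction.stabilizer (Equiv.Perm ℕ) q).comap π) ?_ b
  · exact this
  · intro i hi
    show π (s i) q = q
    rw [π_s hi]
    exact Equiv.swap_apply_of_ne_of_ne (by omega) (by omega)

lemma π_lt_iff {b : B n} {q : ℕ} : π b q < n ↔ q < n := by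
  constructor
  · intro h
    by_contra h1
    rw [π_lt (by omega)] at h
    exact h1 h
  · intro h
    by_contra h1
    have h2 : π b (π b q) = π b q := π_lt (by omega)
    have := (π b).injective h2
    omega

/-- Induction on words in the generators. -/
lemma word_induction {p : B n → Prop} (b : B n) (one : p 1)
    (mul : ∀ i b, i + 1 < n → p b → p (s i * b))
    (inv : ∀ i b, i + 1 < n → p b → p ((s i)⁻¹ * b)) : p b := by
  have hb : b ∈ Subgroup.closure {b : B n | ∃ i, i + 1 < n ∧ b = s i} := by
    rw [closure_s]; trivial
  induction hb using Subgroup.closure_induction_left with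
  | one => exact one
  | mul_left x hx y hy h =>
    obtain ⟨i, hi, rfl⟩ := hx
    exact mul i y hi h
  | inv_mul_cancel x hx y hy h =>
    obtain ⟨i, hi, rfl⟩ := hx
    exact inv i y hi h

lemma c_symm (b : B n) (q r : ℕ) : c b q r = c b r q := by
  induction b using word_induction generalizing q r with
  | one => simp
  | mul i b hi h =>
    rw [c_mul, c_mul, h, c_s hi]
    congr 1
    simp only [eps]; split_ifs <;> omega
  | inv i b hi h =>
    rw [c_mul, c_mul, h, c_inv, c_inv, c_s hi]
    congr 2
    simp only [eps]; split_ifs <;> omega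

lemma c_eq_zero (b : B n) {q r : ℕ} (h : n ≤ q ∨ n ≤ r) : c b q r = 0 := by
  have key : ∀ (b : B n) (q r : ℕ), n ≤ q → c b q r = 0 := by
    intro b
    induction b using word_induction with
    | one => intros; simp
    | mul i b hi h =>
      intro q r hq
      rw [c_mul, c_s hi, ← map_inv, π_lt hq, h _ _ hq]
      simp only [eps]; split_ifs <;> omega
    | inv i b hi h =>
      intro q r hq
      rw [c_mul, c_inv, c_s hi, ← map_inv, π_lt hq, π_lt hq, h _ _ hq]
      simp only [eps]; split_ifs <;> omega
  rcases h with h | h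
  · exact key b q r h
  · rw [c_symm]
    exact key b r q h

lemma c_self (b : B n) (q : ℕ) : c b q q = 0 := by
  induction b using word_induction generalizing q with
  | one => simp
  | mul i b hi h =>
    rw [c_mul, c_s hi, h]
    simp only [eps]; split_ifs <;> omega
  | inv i b hi h =>
    rw [c_mul, c_inv, c_s hi, h]
    simp only [eps]; split_ifs <;> omega

lemma sum_perm (b : B n) (f : ℕ → ℕ → ℤ) :
    ∑ q ∈ Finset.range n, ∑ r ∈ Finset.range n, f ((π b)⁻¹ q) ((π b)⁻¹ r) =
      ∑ q ∈ Finset.range n, ∑ r ∈ Finset.range n, f q r := by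
  rw [← map_inv]
  refine Finset.sum_equiv (π b⁻¹) (fun q => ?_) (fun q _ => ?_)
  · simp only [Finset.mem_range, π_lt_iff]
  · refine Finset.sum_equiv (π b⁻¹) (fun q => ?_) (fun q _ => rfl)
    simp only [Finset.mem_range, π_lt_iff]

lemma sum_eps {i : ℕ} (hi : i + 1 < n) :
    ∑ q ∈ Finset.range n, ∑ r ∈ Finset.range n, eps i q r = 2 := by
  have : ∀ q r, eps i q r = (if q = i then if r = i + 1 then 1 else 0 else 0) +
      (if q = i + 1 then if r = i then 1 else 0 else 0) := by
    intro q r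
    simp only [eps]
    split_ifs <;> omega
  simp only [this, Finset.sum_add_distrib]
  simp [Finset.sum_ite_irrel, Finset.sum_ite_eq', hi, show i < n by omega]

lemma sum_c_mul (a b : B n) : ∑ q ∈ Finset.range n, ∑ r ∈ Finset.range n, c (a * b) q r =
    ∑ q ∈ Finset.range n, ∑ r ∈ Finset.range n, c a q r +
    ∑ q ∈ Finset.range n, ∑ r ∈ Finset.range n, c b q r := by
  rw [← sum_perm a (c b)]
  simp only [c_mul, Finset.sum_add_distrib]

/-- The sum of all crossing numbers counts every crossing twice. -/
lemma sum_c (b : B n) : ∑ q ∈ Finset.range n, ∑ r ∈ Finset.range n, c b q r = 2 * ex b := by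
  have hs : ∀ i, i + 1 < n →
      ∑ q ∈ Finset.range n, ∑ r ∈ Finset.range n, c (s i : B n) q r = 2 := fun i hi => by
    rw [c_s hi, sum_eps hi]
  induction b using word_induction with
  | one => simp
  | mul i b hi h =>
    rw [sum_c_mul, h, hs i hi, ex_mul, ex_s hi]
    ring
  | inv i b hi h =>
    have := sum_c_mul (n := n) (s i)⁻¹ (s i)
    rw [hs i hi] at this
    simp only [inv_mul_cancel, c_one, Pi.zero_apply, Finset.sum_const_zero] at this
    rw [sum_c_mul, h, ex_mul, ex_inv, ex_s hi]
    linarith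

lemma eps_eq (i q r : ℕ) :
    eps i q r = if (q < r ↔ Equiv.swap i (i + 1) q < Equiv.swap i (i + 1) r) then 0 else 1 := by
  simp only [eps, Equiv.swap_apply_def]
  by_cases h1 : q = i <;> by_cases h2 : q = i + 1 <;> by_cases h3 : r = i <;>
    by_cases h4 : r = i + 1 <;> simp [*] <;> omega

/-- Parity of crossing numbers. -/
lemma c_parity (b : B n) {q r : ℕ} (hqr : q ≠ r) :
    Odd (c b q r) ↔ ¬ (q < r ↔ (π b)⁻¹ q < (π b)⁻¹ r) := by
  induction b using word_induction generalizing q r with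
  | one => simp
  | mul i b hi h =>
    have := h (q := Equiv.swap i (i + 1) q) (r := Equiv.swap i (i + 1) r)
      (fun h => hqr ((Equiv.swap i (i + 1)).injective h))
    rw [c_mul, map_mul, c_s hi, π_s hi, Int.odd_add', mul_inv_rev]
    simp only [Equiv.Perm.mul_apply, Equiv.swap_inv]
    rw [this, eps_eq i]
    split_ifs with h1
    · simp [h1]
    · simp; tauto
  | inv i b hi h =>
    have := h (q := Equiv.swap i (i + 1) q) (r := Equiv.swap i (i + 1) r)
      (fun h => hqr ((Equiv.swap i (i + 1)).injective h))
    rw [c_mul, c_inv, map_mul, map_inv, c_s hi, π_s hi, Int.odd_add', mul_inv_rev]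
    simp only [Equiv.Perm.mul_apply, Equiv.swap_inv]
    rw [this, eps_swap_self, eps_eq i]
    split_ifs with h1
    · simp [h1]
    · simp; tauto

lemma even_c {b : B n} (hb : π b = 1) (q r : ℕ) : Even (c b q r) := by
  rcases eq_or_ne q r with rfl | h
  · simp [c_self]
  · rw [← Int.not_odd_iff_even, c_parity b h]
    simp [hb]

end Crossing

end BraidAut

namespace BraidAut

/-! ### The Artin action on the free group -/

section Artin

variable {n : ℕ} {G : Type*} [Group G]

/-- The free group on `n` generators. -/
abbrev F (n : ℕ) : Type := FreeGroup (Fin n)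

/-- The generators of the free group, indexed by all natural numbers. -/
def x {n : ℕ} (j : ℕ) : F n := if h : j < n then FreeGroup.of ⟨j, h⟩ else 1

/-- The homomorphism out of the free group given by a sequence. -/
def flift (f : ℕ → G) : F n →* G := FreeGroup.lift (fun j => f j)

@[simp] lemma flift_x (f : ℕ → G) {j : ℕ} (hj : j < n) : flift f (x j : F n) = f j := by
  simp [flift, x, hj]

lemma x_of (j : Fin n) : FreeGroup.of j = (x j : F n) := by simp [x]

lemma fhom_ext {f g : F n →* G} (h : ∀ j, j < n → f (x j) = g (x j)) : f = g := by
  apply FreeGroup.ext_hom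
  intro j
  rw [x_of]
  exact h j j.2

lemma closure_x : Subgroup.closure {v : F n | ∃ j, j < n ∧ v = x j} = ⊤ := by
  rw [eq_top_iff, ← FreeGroup.closure_range_of, Subgroup.closure_le]
  rintro _ ⟨j, rfl⟩
  exact Subgroup.subset_closure ⟨j, j.2, x_of j⟩

lemma mem_of_x {H : Subgroup (F n)} (h : ∀ j, j < n → x j ∈ H) (v : F n) : v ∈ H := by
  have : (⊤ : Subgroup (F n)) ≤ H := by
    rw [← closure_x, Subgroup.closure_le]
    rintro _ ⟨j, hj, rfl⟩
    exact h j hj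
  exact this trivial

/-- The Artin endomorphism of the `i`-th generator. -/
def artinFun (i : ℕ) : F n →* F n :=
  flift (fun j => if j = i then x (i + 1) else
    if j = i + 1 then (x (i + 1))⁻¹ * x i * x (i + 1) else x j)

/-- The inverse of the Artin endomorphism. -/
def artinInv (i : ℕ) : F n →* F n :=
  flift (fun j => if j = i then x i * x (i + 1) * (x i)⁻¹ else if j = i + 1 then x i else x j)

/-- The Artin automorphism of the `i`-th generator. -/
def artinAut (i : ℕ) : MulAut (F n) :=
  if hi : i + 1 < n then
    MonoidHom.toMulEquiv (artinFun i) (artinInv i)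
      (fhom_ext fun j hj => by
        have : i < n := by omega
        rcases eq_or_ne j i with rfl | h1
        · simp [artinFun, artinInv, *]
        · rcases eq_or_ne j (i + 1) with rfl | h2
          · simp [artinFun, artinInv, *]; group
          · simp [artinFun, artinInv, *])
      (fhom_ext fun j hj => by
        have : i < n := by omega
        rcases eq_or_ne j i with rfl | h1
        · simp [artinFun, artinInv, *]; group
        · rcases eq_or_ne j (i + 1) with rfl | h2
          · simp [artinFun, artinInv, *]
          · simp [artinFun, artinInv, *])
  else 1

lemma artinAut_left {i : ℕ} (hi : i + 1 < n) : artinAut i (x i : F n) = x (i + 1) := by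
  simp only [artinAut, dif_pos hi]
  simp [artinFun, show i < n by omega]

lemma artinAut_right {i : ℕ} (hi : i + 1 < n) :
    artinAut i (x (i + 1) : F n) = (x (i + 1))⁻¹ * x i * x (i + 1) := by
  simp only [artinAut, dif_pos hi]
  simp [artinFun, hi]

lemma artinAut_far {i j : ℕ} (hi : j ≠ i) (hi' : j ≠ i + 1) :
    artinAut i (x j : F n) = x j := by
  by_cases hj : j < n
  · by_cases h : i + 1 < n
    · simp only [artinAut, dif_pos h]
      simp [artinFun, *]
    · simp [artinAut, h]
  · simp [x, hj]

lemma aut_ext {f g : MulAut (F n)} (h : ∀ j, j < n → f (x j) = g (x j)) : f = g := by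
  have : f.toMonoidHom = g.toMonoidHom := fhom_ext h
  ext1 v
  exact DFunLike.congr_fun this v

lemma artin_isBraid : IsBraid n (artinAut (n := n)) where
  comm i j h hj := by
    apply aut_ext
    intro k hk
    simp only [MulAut.mul_apply]
    have hi : i + 1 < n := by omega
    rcases eq_or_ne k i with rfl | h1
    · rw [artinAut_far (i := j) (by omega) (by omega), artinAut_left hi,
        artinAut_far (by omega) (by omega)]
    rcases eq_or_ne k (i + 1) with rfl | h2
    · rw [artinAut_right hi, artinAut_far (by omega) (by omega), artinAut_right hi]
      simp only [map_mul, map_inv]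
      rw [artinAut_far (i := j) (by omega) (by omega), artinAut_far (i := j) (by omega) (by omega)]
    rcases eq_or_ne k j with rfl | h3
    · rw [artinAut_left hj, artinAut_far h1 h2, artinAut_far (by omega) (by omega),
        artinAut_left hj]
    rcases eq_or_ne k (j + 1) with rfl | h4
    · rw [artinAut_right hj, artinAut_far h1 h2, artinAut_right hj]
      simp only [map_mul, map_inv]
      rw [artinAut_far (i := i) (by omega) (by omega), artinAut_far (i := i) (by omega) (by omega)]
    rw [artinAut_far h1 h2, artinAut_far h3 h4, artinAut_far h1 h2]
  braid i h := by
    apply aut_ext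
    intro k hk
    simp only [MulAut.mul_apply]
    have hi : i + 1 < n := by omega
    have e1 : artinAut i (x (i + 2) : F n) = x (i + 2) := artinAut_far (by omega) (by omega)
    have e2 : artinAut (i + 1) (x i : F n) = x i := artinAut_far (by omega) (by omega)
    have e3 : artinAut (i + 1) (x (i + 1) : F n) = x (i + 2) := artinAut_left h
    have e4 : artinAut (i + 1) (x (i + 2) : F n) = (x (i + 2))⁻¹ * x (i + 1) * x (i + 2) :=
      artinAut_right h
    have e5 := artinAut_left hi
    have e6 := artinAut_right hi
    rcases eq_or_ne k i with rfl | h1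
    · simp only [e1, e2, e3, e5]
    rcases eq_or_ne k (i + 1) with rfl | h2
    · simp only [map_mul, map_inv, e1, e2, e3, e4, e5, e6]
    rcases eq_or_ne k (i + 2) with rfl | h3
    · simp only [map_mul, map_inv, e1, e2, e3, e4, e6]; group
    rw [artinAut_far h1 h2, artinAut_far h2 h3, artinAut_far h1 h2, artinAut_far h2 h3]

/-- The Artin action of the braid group on the free group. -/
def act : B n →* MulAut (F n) := lift artinAut artin_isBraid

lemma act_left {i : ℕ} (hi : i + 1 < n) : act (s i) (x i : F n) = x (i + 1) := by
  rw [act, lift_s _ _ hi, artinAut_left hi]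

lemma act_right {i : ℕ} (hi : i + 1 < n) :
    act (s i) (x (i + 1) : F n) = (x (i + 1))⁻¹ * x i * x (i + 1) := by
  rw [act, lift_s _ _ hi, artinAut_right hi]

lemma act_far {i j : ℕ} (h : j ≠ i) (h' : j ≠ i + 1) : act (s i) (x j : F n) = x j := by
  by_cases hi : i + 1 < n
  · rw [act, lift_s _ _ hi, artinAut_far h h']
  · rw [s_eq_one (by omega)]; simp

end Artin

/-! ### The standard generators of the pure braid group -/

section PureGens

variable {m : ℕ}

/-- The braid in which the strands `i` and `j` link once. -/
def A (i : ℕ) : ℕ → B m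
  | 0 => 1
  | j + 1 => if j < i then 1 else if j = i then s i ^ 2 else s j * A i j * (s j)⁻¹

lemma A_self (i : ℕ) : (A i (i + 1) : B m) = s i ^ 2 := by simp [A]

lemma A_succ {i j : ℕ} (h : i < j) : (A i (j + 1) : B m) = s j * A i j * (s j)⁻¹ := by
  rw [A, if_neg (by omega), if_neg (by omega)]

lemma A_induction {i : ℕ} {p : (j : ℕ) → B m → Prop} (base : p (i + 1) (s i ^ 2))
    (step : ∀ j, i < j → p j (A i j) → p (j + 1) (s j * A i j * (s j)⁻¹)) {j : ℕ} (h : i < j) :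
    p j (A i j) := by
  induction j, h using Nat.le_induction with
  | base => rw [A_self]; exact base
  | succ j h ih => rw [A_succ h]; exact step j h ih

lemma commute_s {i j : ℕ} (h : i + 2 ≤ j ∨ j + 2 ≤ i) : Commute (s i : B m) (s j) := by
  rcases h with h | h
  · exact s_comm h
  · exact (s_comm h).symm

lemma A_comm_of_gt {i j k : ℕ} (h : i < j) (hk : j < k) : Commute (s k) (A i j : B m) := by
  refine A_induction (p := fun j a => j < k → Commute (s k) a) ?_ ?_ h hk
  · intro h
    exact (commute_s (by omega)).pow_right _
  · intro j h1 h2 h3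
    have := commute_s (m := m) (i := k) (j := j) (by omega)
    exact (this.mul_right (h2 (by omega))).mul_right this.inv_right

lemma A_comm_of_lt {i j k : ℕ} (h : i < j) (hk : k + 1 < i) : Commute (s k) (A i j : B m) := by
  refine A_induction (p := fun j a => Commute (s k) a) ?_ ?_ h
  · exact (commute_s (by omega)).pow_right _
  · intro j h1 h2
    have := commute_s (m := m) (i := k) (j := j) (by omega)
    exact (this.mul_right h2).mul_right this.inv_right

lemma conj_step {G : Type*} [Group G] {a b u w : G} (h : Commute a u) (h1 : a * b * a⁻¹ = w) :
    a * (u * b * u⁻¹) * a⁻¹ = u * w * u⁻¹ := by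
  rw [← h1]
  have h2 := h.eq
  have h3 := h.inv_inv.eq
  calc a * (u * b * u⁻¹) * a⁻¹ = (a * u) * b * (u⁻¹ * a⁻¹) := by group
    _ = _ := by rw [h2, ← h3]; group

lemma commute_conj {G : Type*} [Group G] {a b u w : G} (h : a * u = u * b) (h1 : Commute b w) :
    Commute a (u * w * u⁻¹) := by
  have h2 : a = u * b * u⁻¹ := by rw [← h]; group
  rw [h2]
  exact (Commute.conj_iff u).2 h1

lemma braid_conj {G : Type*} [Group G] {a b : G} (h : a * b * a = b * a * b) :
    a * b * a⁻¹ = b⁻¹ * a * b := by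
  rw [mul_inv_eq_iff_eq_mul, mul_assoc, mul_assoc, eq_inv_mul_iff_mul_eq, ← mul_assoc, ← h]
  group

lemma A_comm_of_mem {i j k : ℕ} (hj : j < m) (hk : i < k) (hk' : k + 1 < j) :
    Commute (s k) (A i j : B m) := by
  induction j, hk' using Nat.le_induction with
  | base =>
    rw [A_succ (by omega), A_succ (by omega)]
    have h1 : Commute (s (k + 1)) (A i k : B m) := A_comm_of_gt hk (by omega)
    have h2 := s_braid (n := m) (i := k) (by omega)
    have := commute_conj (a := s k) (u := s (k + 1) * s k) (by rw [← mul_assoc, h2]) h1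
    simpa [mul_assoc] using this
  | succ j h ih =>
    rw [A_succ (by omega)]
    have := commute_s (m := m) (i := k) (j := j) (by omega)
    exact (this.mul_right (ih (by omega))).mul_right this.inv_right

lemma conj_A_left {i j : ℕ} (hj : j < m) (h : i + 1 < j) :
    s i * A i j * (s i)⁻¹ = (A (i + 1) j : B m) := by
  induction j, h using Nat.le_induction with
  | base =>
    rw [A_succ (by omega), A_self, A_self]
    have h2 := braid_conj (s_braid (n := m) (i := i) (by omega)).symm
    calc _ = s i * (s (i + 1) * s i * (s (i + 1))⁻¹) ^ 2 * (s i)⁻¹ := by simp only [conj_pow]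
      _ = _ := by rw [h2, pow_two, pow_two]; group
  | succ j h ih =>
    rw [A_succ (by omega), A_succ (by omega)]
    exact conj_step (commute_s (by omega)) (ih (by omega))

lemma conj_A_right {i j : ℕ} (hj : j < m) (h : i + 1 < j) :
    s i * A (i + 1) j * (s i)⁻¹ = (A (i + 1) j)⁻¹ * A i j * (A (i + 1) j : B m) := by
  induction j, h using Nat.le_induction with
  | base =>
    rw [A_succ (i := i) (by omega), A_self, A_self]
    have h2 := braid_conj (s_braid (n := m) (i := i) (by omega))
    rw [← conj_pow, h2]
    simp only [pow_two]
    group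
  | succ j h ih =>
    rw [A_succ (i := i + 1) h, A_succ (i := i) (by omega),
      conj_step (commute_s (by omega)) (ih (by omega))]
    group

end PureGens

end BraidAut

namespace BraidAut

/-! ### The stabiliser of the last strand -/

section Stabiliser

variable {n : ℕ}

/-- The semidirect product of the free group by the braid group. -/
abbrev SD (n : ℕ) : Type := F n ⋊[act] B n

/-- A free generator in the semidirect product. -/
def gx (j : ℕ) : SD n := SemidirectProduct.inl (x j)

/-- A braid generator in the semidirect product. -/
def gs (i : ℕ) : SD n := SemidirectProduct.inr (s i)

lemma succ_isBraid : IsBraid n (fun i => (s i : B (n + 1))) where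
  comm _ _ h _ := s_comm h
  braid _ h := s_braid (by omega)

/-- Adding a strand. -/
def up : B n →* B (n + 1) := lift (fun i => s i) succ_isBraid

lemma up_s {i : ℕ} (hi : i + 1 < n) : up (s i : B n) = s i := by rw [up, lift_s _ _ hi]

/-- The free group as a subgroup of the braid group. -/
def fr : F n →* B (n + 1) := flift (fun j => A j n)

lemma fr_x {j : ℕ} (hj : j < n) : fr (x j : F n) = A j n := by rw [fr, flift_x _ hj]

lemma fr_act (b : B n) (v : F n) : fr (act b v) = up b * fr v * (up b)⁻¹ := by
  let H : Subgroup (B n) :=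
    { carrier := {b | ∀ v : F n, fr (act b v) = up b * fr v * (up b)⁻¹}
      one_mem' := by simp
      mul_mem' := by
        intro a b ha hb v
        simp only [map_mul, MulAut.mul_apply]
        rw [ha, hb]
        group
      inv_mem' := by
        intro a ha v
        have := ha (act a⁻¹ v)
        rw [← MulAut.mul_apply, ← map_mul] at this
        simp only [mul_inv_cancel, map_one, MulAut.one_apply] at this
        rw [this, map_inv up]
        group }
  suffices h : b ∈ H from h v
  refine mem_of_s (H := H) (fun i hi => ?_) b
  intro v
  suffices h : fr.comp (act (s i)).toMonoidHom =
      (MulAut.conj (up (s i))).toMonoidHom.comp fr from DFunLike.congr_fun h v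
  refine fhom_ext fun j hj => ?_
  simp only [MonoidHom.comp_apply, MulEquiv.coe_toMonoidHom, MulAut.conj_apply]
  rw [up_s hi, fr_x hj]
  rcases eq_or_ne j i with rfl | h1
  · rw [act_left hi, conj_A_left (by omega) hi, fr_x hi]
  rcases eq_or_ne j (i + 1) with rfl | h2
  · rw [act_right hi, conj_A_right (by omega) hi]
    simp only [map_mul, map_inv, fr_x hi]
    rw [fr_x (by omega)]
  rw [act_far h1 h2, fr_x hj, eq_mul_inv_iff_mul_eq]
  rcases lt_or_gt_of_ne h1 with h | h
  · exact (A_comm_of_mem (by omega) h hi).eq.symm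
  · exact (A_comm_of_lt hj (by omega)).eq.symm

/-- The embedding of the semidirect product as the stabiliser of the last strand. -/
def ι : SD n →* B (n + 1) :=
  SemidirectProduct.lift fr up (fun b => MonoidHom.ext fun v => fr_act b v)

lemma ι_inl (v : F n) : ι (SemidirectProduct.inl v : SD n) = fr v := SemidirectProduct.lift_inl ..
lemma ι_inr (b : B n) : ι (SemidirectProduct.inr b : SD n) = up b := SemidirectProduct.lift_inr ..
lemma ι_gs {i : ℕ} (hi : i + 1 < n) : ι (gs i : SD n) = s i := by rw [gs, ι_inr, up_s hi]
lemma ι_gx {j : ℕ} (hj : j < n) : ι (gx j : SD n) = A j n := by rw [gx, ι_inl, fr_x hj]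

lemma gs_comm {i j : ℕ} (h : i + 2 ≤ j) : (gs i : SD n) * gs j = gs j * gs i := by
  simp only [gs, ← map_mul, s_comm h]

lemma gs_braid {i : ℕ} (h : i + 2 < n) :
    (gs i : SD n) * gs (i + 1) * gs i = gs (i + 1) * gs i * gs (i + 1) := by
  simp only [gs, ← map_mul, s_braid h]

lemma gs_gx (i j : ℕ) :
    (gs i : SD n) * gx j = SemidirectProduct.inl (act (s i) (x j)) * gs i := by
  rw [gs, gx, SemidirectProduct.inl_aut, mul_assoc, ← map_mul, inv_mul_cancel, map_one, mul_one]

lemma gs_gx_left {i : ℕ} (hi : i + 1 < n) : (gs i : SD n) * gx i = gx (i + 1) * gs i := by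
  rw [gs_gx, act_left hi, gx]

lemma gs_gx_far {i j : ℕ} (h : j ≠ i) (h' : j ≠ i + 1) :
    (gs i : SD n) * gx j = gx j * gs i := by
  rw [gs_gx, act_far h h', gx]

lemma gs_gx_gx {i : ℕ} (hi : i + 1 < n) :
    (gs i : SD n) * gx i * gx (i + 1) = gx i * gx (i + 1) * gs i := by
  rw [gs_gx_left hi, mul_assoc, gs_gx, act_right hi]
  simp only [map_mul, map_inv, gx]
  group

/-- Right multiplication by a generator on cosets of the stabiliser. -/
def stepFun (i : ℕ) (p : SD n × ℕ) : SD n × ℕ :=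
  if n < p.2 then p else if i + 1 < p.2 then (p.1 * gs i, p.2) else
  if i + 1 = p.2 then (p.1, i) else if i = p.2 then (p.1 * gx i, i + 1) else
  (p.1 * gs (i - 1), p.2)

/-- Right multiplication by the inverse of a generator on cosets of the stabiliser. -/
def stepInv (i : ℕ) (p : SD n × ℕ) : SD n × ℕ :=
  if n < p.2 then p else if i + 1 < p.2 then (p.1 * (gs i)⁻¹, p.2) else
  if i + 1 = p.2 then (p.1 * (gx i)⁻¹, i) else if i = p.2 then (p.1, i + 1) else
  (p.1 * (gs (i - 1))⁻¹, p.2)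

/-- Right multiplication by a generator, as a permutation. -/
def step (i : ℕ) : Equiv.Perm (SD n × ℕ) :=
  if hi : i < n then
  { toFun := stepFun i
    invFun := stepInv i
    left_inv := by
      rintro ⟨g, j⟩
      have : n < j ∨ i + 1 < j ∧ j ≤ n ∨ i + 1 = j ∨ i = j ∨ j < i := by omega
      rcases this with h | ⟨h, h'⟩ | rfl | rfl | h <;> simp only [stepFun, stepInv] <;>
        simp (disch := omega) only [if_pos, if_neg, ↓reduceIte, mul_inv_cancel_right]
    right_inv := by
      rintro ⟨g, j⟩
      have : n < j ∨ i + 1 < j ∧ j ≤ n ∨ i + 1 = j ∨ i = j ∨ j < i := by omega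
      rcases this with h | ⟨h, h'⟩ | rfl | rfl | h <;> simp only [stepFun, stepInv] <;>
        simp (disch := omega) only [if_pos, if_neg, ↓reduceIte, inv_mul_cancel_right] }
  else 1

lemma step_apply {i : ℕ} (hi : i < n) (p : SD n × ℕ) : step i p = stepFun i p := by
  simp only [step, dif_pos hi]; rfl

lemma step_big {i j : ℕ} (g : SD n) (hj : n < j) : step i (g, j) = (g, j) := by
  by_cases hi : i < n
  · rw [step_apply hi, stepFun]; exact if_pos hj
  · simp [step, hi]

lemma step_gt {i j : ℕ} (g : SD n) (hj : j ≤ n) (h : i + 1 < j) :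
    step i (g, j) = (g * gs i, j) := by
  rw [step_apply (by omega), stepFun, if_neg (not_lt.2 hj), if_pos h]

lemma step_succ {i : ℕ} (g : SD n) (hj : i + 1 ≤ n) : step i (g, i + 1) = (g, i) := by
  rw [step_apply (by omega), stepFun, if_neg (not_lt.2 hj), if_neg (lt_irrefl _), if_pos rfl]

lemma step_self {i : ℕ} (g : SD n) (hj : i + 1 ≤ n) : step i (g, i) = (g * gx i, i + 1) := by
  rw [step_apply (by omega), stepFun, if_neg (by simp; omega), if_neg (by simp),
    if_neg (by simp), if_pos rfl]

lemma step_lt {i j : ℕ} (g : SD n) (hi : i + 1 ≤ n) (h : j < i) :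
    step i (g, j) = (g * gs (i - 1), j) := by
  rw [step_apply (by omega), stepFun, if_neg (by simp; omega), if_neg (by simp; omega),
    if_neg (by simp; omega), if_neg (by simp; omega)]

lemma step_isBraid : IsBraid (n + 1) (fun i => MulOpposite.op (step (n := n) i)) where
  comm i k h hk := by
    apply MulOpposite.unop_injective
    ext1 ⟨g, j⟩
    simp only [MulOpposite.unop_mul, MulOpposite.unop_op, Equiv.Perm.mul_apply]
    by_cases hj : n < j
    · simp only [step_big _ hj]
    rw [not_lt] at hj
    have hG := gs_comm (n := n) h
    rcases lt_trichotomy (k + 1) j with h1 | rfl | h1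
    · simp (disch := omega) only [step_gt, mul_assoc, hG]
    · simp (disch := omega) only [step_gt, step_succ]
    rcases eq_or_ne j k with rfl | h2
    · simp (disch := omega) only [step_gt, step_self, mul_assoc, gs_gx_far]
    have h3 : j < k := by omega
    rcases lt_trichotomy (i + 1) j with h4 | rfl | h4
    · simp (disch := omega) only [step_gt, step_lt, mul_assoc]
      rw [gs_comm (i := i) (j := k - 1) (by omega)]
    · simp (disch := omega) only [step_succ, step_lt]
    rcases eq_or_ne j i with rfl | h5
    · simp (disch := omega) only [step_self, step_lt, mul_assoc, gs_gx_far]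
    · simp (disch := omega) only [step_lt, mul_assoc]
      rw [gs_comm (i := i - 1) (j := k - 1) (by omega)]
  braid i h := by
    apply MulOpposite.unop_injective
    ext1 ⟨g, j⟩
    simp only [MulOpposite.unop_mul, MulOpposite.unop_op, Equiv.Perm.mul_apply]
    by_cases hj : n < j
    · simp only [step_big _ hj]
    rw [not_lt] at hj
    rcases lt_trichotomy (i + 1 + 1) j with h1 | rfl | h1
    · have := gs_braid (n := n) (i := i) (by omega)
      simp only [mul_assoc] at this
      simp (disch := omega) only [step_gt, mul_assoc, this]
    · simp (disch := omega) only [step_gt, step_succ, step_lt, add_tsub_cancel_right]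
    rcases eq_or_ne j (i + 1) with rfl | h2
    · simp (disch := omega) only [step_gt, step_succ, step_self, step_lt, add_tsub_cancel_right,
        mul_assoc, gs_gx_left]
    rcases eq_or_ne j i with rfl | h3
    · have := gs_gx_gx (n := n) (i := j) (by omega)
      simp only [mul_assoc] at this
      simp (disch := omega) only [step_gt, step_self, step_lt, add_tsub_cancel_right,
        mul_assoc, this]
    · obtain ⟨i, rfl⟩ : ∃ k, i = k + 1 := ⟨i - 1, by omega⟩
      have := gs_braid (n := n) (i := i) (by omega)
      simp only [mul_assoc] at this
      simp (disch := omega) only [step_lt, add_tsub_cancel_right, mul_assoc, this]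

/-- The right action of the braid group on cosets of the stabiliser of the last strand. -/
def rep : B (n + 1) →* (Equiv.Perm (SD n × ℕ))ᵐᵒᵖ := lift _ step_isBraid

/-- The right action of the braid group on cosets of the stabiliser of the last strand. -/
def ra (b : B (n + 1)) (p : SD n × ℕ) : SD n × ℕ := (rep b).unop p

@[simp] lemma ra_one (p : SD n × ℕ) : ra 1 p = p := by simp [ra]
lemma ra_mul (a b : B (n + 1)) (p : SD n × ℕ) : ra (a * b) p = ra b (ra a p) := by
  simp only [ra, map_mul]; rfl
lemma ra_s {i : ℕ} (hi : i < n) (p : SD n × ℕ) : ra (s i) p = step i p := by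
  rw [ra, rep, lift_s _ _ (by omega)]; rfl
lemma ra_inv (a : B (n + 1)) (p q : SD n × ℕ) (h : ra a q = p) : ra a⁻¹ p = q := by
  rw [← h, ← ra_mul]; simp

lemma ra_A {j k : ℕ} (h : j < k) (hk : k ≤ n) (g : SD n) :
    ra (A j k) (g, k) = (g * gx j, k) := by
  induction k, h using Nat.le_induction generalizing g with
  | base =>
    rw [A_self, pow_two, ra_mul, ra_s (by omega), ra_s (by omega), step_succ _ hk, step_self _ hk]
  | succ k h ih =>
    rw [A_succ h, ra_mul, ra_mul, ra_s (by omega), step_succ _ hk, ih (by omega)]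
    apply ra_inv
    rw [ra_s (by omega), step_succ _ hk]

lemma ra_ι (h g : SD n) : ra (ι h) (g, n) = (g * h, n) := by
  let H : Subgroup (SD n) :=
    { carrier := {h | ∀ g, ra (ι h) (g, n) = (g * h, n)}
      one_mem' := by simp
      mul_mem' := by
        intro a b ha hb g
        rw [map_mul, ra_mul, ha, hb, mul_assoc]
      inv_mem' := by
        intro a ha g
        rw [map_inv]
        apply ra_inv
        rw [ha]
        group }
  suffices hh : h ∈ H from hh g
  rw [← SemidirectProduct.inl_left_mul_inr_right h]
  apply H.mul_mem
  · refine mem_of_x (H := H.comap SemidirectProduct.inl) (fun j hj g => ?_) h.left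
    show ra (ι (gx j)) (g, n) = (g * gx j, n)
    rw [ι_gx hj, ra_A hj le_rfl]
  · refine mem_of_s (H := H.comap SemidirectProduct.inr) (fun i hi g => ?_) h.right
    show ra (ι (gs i)) (g, n) = (g * gs i, n)
    rw [ι_gs hi, ra_s (by omega), step_gt _ le_rfl hi]

lemma ι_injective : Function.Injective (ι (n := n)) := by
  intro a b h
  have h1 := ra_ι a 1
  rw [h, ra_ι] at h1
  simpa using (Prod.ext_iff.1 h1).1.symm

/-- Coset representatives: `tr k` moves strand `n - k` to the last position. -/
def tr : ℕ → B (n + 1)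
  | 0 => 1
  | k + 1 => tr k * s (n - (k + 1))

lemma tr_eq {j : ℕ} (hj : j + 1 ≤ n) : (tr (n - j) : B (n + 1)) = tr (n - (j + 1)) * s j := by
  obtain ⟨k, rfl⟩ : ∃ k, n = j + 1 + k := ⟨n - (j + 1), by omega⟩
  rw [show j + 1 + k - j = k + 1 by omega, show j + 1 + k - (j + 1) = k by omega, tr,
    show j + 1 + k - (k + 1) = j by omega]

lemma tr_induction {p : ℕ → B (n + 1) → Prop} (m : ℕ) (hm : m ≤ n)
    (base : p m (tr (n - m)))
    (step : ∀ j, j < m → p (j + 1) (tr (n - (j + 1))) → p j (tr (n - (j + 1)) * s j)) {j : ℕ}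
    (hj : j ≤ m) : p j (tr (n - j)) := by
  obtain ⟨k, rfl⟩ : ∃ k, m = j + k := ⟨m - j, by omega⟩
  clear hj
  induction k generalizing j with
  | zero => exact base
  | succ k ih =>
    rw [tr_eq (by omega)]
    refine step j (by omega) (ih (j := j + 1) ?_ ?_ ?_)
    · omega
    · rw [show j + 1 + k = j + (k + 1) by omega]; exact base
    · intro j' h
      exact step j' (by omega)

lemma tr_comm {i j : ℕ} (hj : j ≤ n) (h : i + 1 < j) :
    Commute (tr (n - j)) (s i : B (n + 1)) := by
  refine tr_induction (p := fun j a => i + 1 < j → Commute a (s i)) n le_rfl ?_ ?_ hj h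
  · simp [tr]
  · intro j h1 h2 h3
    exact (h2 (by omega)).mul_left (commute_s (by omega))

lemma tr_shift {i j : ℕ} (hi : i < n) (h : j < i) :
    (tr (n - j) * s i : B (n + 1)) = s (i - 1) * tr (n - j) := by
  obtain ⟨i, rfl⟩ : ∃ k, i = k + 1 := ⟨i - 1, by omega⟩
  refine tr_induction (p := fun j a => a * s (i + 1) = s i * a) i (by omega) ?_ ?_ (by omega)
  · rw [tr_eq (by omega), tr_eq (by omega), mul_assoc, mul_assoc, ← mul_assoc (s (i + 1)),
      ← s_braid (by omega), ← mul_assoc, ← mul_assoc,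
      (tr_comm (n := n) (i := i) (j := i + 1 + 1) (by omega) (by omega)).eq]
    simp only [mul_assoc]
  · intro j h1 h2
    rw [mul_assoc, s_comm (by omega), ← mul_assoc, h2, mul_assoc]

lemma tr_A {j : ℕ} (h : j < n) :
    (tr (n - j) * s j : B (n + 1)) = A j n * tr (n - (j + 1)) := by
  suffices ∀ k, j + 1 ≤ k → k ≤ n → tr (n - k) * A j k = A j n * tr (n - k) by
    have := this (j + 1) le_rfl h
    rw [A_self] at this
    rw [tr_eq h, ← this, pow_two, mul_assoc]
  intro k hk hk'
  refine tr_induction (p := fun k a => j + 1 ≤ k → a * A j k = A j n * a) n le_rfl ?_ ?_ hk' hk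
  · simp [tr]
  · intro k h1 h2 h3
    have := h2 (by omega)
    rw [A_succ (by omega)] at this
    rw [← mul_assoc, ← this]
    group

lemma ra_snd (b : B (n + 1)) (p : SD n × ℕ) : (ra b p).2 = (π b)⁻¹ p.2 := by
  let H : Subgroup (B (n + 1)) :=
    { carrier := {b | ∀ p : SD n × ℕ, (ra b p).2 = (π b)⁻¹ p.2}
      one_mem' := fun p => by rw [ra_one, map_one, inv_one, Equiv.Perm.one_apply]
      mul_mem' := by
        intro a b ha hb p
        rw [ra_mul, hb, ha]
        simp
      inv_mem' := by
        intro a ha p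
        have := ha (ra a⁻¹ p)
        rw [← ra_mul, inv_mul_cancel, ra_one] at this
        rw [this]
        simp }
  refine mem_of_s (H := H) (fun i hi p => ?_) b p
  obtain ⟨g, j⟩ := p
  rw [π_s hi, Equiv.swap_inv, ra_s (by omega)]
  have : n < j ∨ i + 1 < j ∧ j ≤ n ∨ i + 1 = j ∨ i = j ∨ j < i := by omega
  rcases this with h | ⟨h, h'⟩ | rfl | rfl | h
  · rw [step_big _ h, Equiv.swap_apply_of_ne_of_ne (by simp; omega) (by simp; omega)]
  · rw [step_gt _ h' h, Equiv.swap_apply_of_ne_of_ne (by simp; omega) (by simp; omega)]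
  · rw [step_succ _ (by omega), Equiv.swap_apply_right]
  · rw [step_self _ (by omega), Equiv.swap_apply_left]
  · rw [step_lt _ (by omega) h, Equiv.swap_apply_of_ne_of_ne (by simp; omega) (by simp; omega)]

lemma ra_spec (b : B (n + 1)) (p : SD n × ℕ) (hp : p.2 ≤ n) :
    ι p.1 * tr (n - p.2) * b = ι (ra b p).1 * tr (n - (ra b p).2) := by
  have hle : ∀ (b : B (n + 1)) (j : ℕ), j ≤ n → (π b)⁻¹ j ≤ n := fun b j hj => by
    rw [← map_inv, ← Nat.lt_succ_iff, π_lt_iff]; omega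
  let H : Subgroup (B (n + 1)) :=
    { carrier := {b | ∀ p : SD n × ℕ, p.2 ≤ n →
        ι p.1 * tr (n - p.2) * b = ι (ra b p).1 * tr (n - (ra b p).2)}
      one_mem' := by simp
      mul_mem' := by
        intro a b ha hb p hp
        rw [ra_mul, ← hb, ← ha p hp, mul_assoc _ a b]
        rw [ra_snd]
        exact hle _ _ hp
      inv_mem' := by
        intro a ha p hp
        have := ha (ra a⁻¹ p) (by rw [ra_snd]; exact hle _ _ hp)
        rw [← ra_mul, inv_mul_cancel, ra_one] at this
        rw [← this]
        group }
  refine mem_of_s (H := H) (fun i hi p hp => ?_) b p hp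
  obtain ⟨g, j⟩ := p
  replace hi : i < n := by omega
  simp only at hp
  rw [ra_s hi]
  rcases lt_trichotomy (i + 1) j with h | rfl | h
  · rw [step_gt _ hp h, map_mul, ι_gs (by omega), mul_assoc, (tr_comm hp h).eq, mul_assoc]
  · rw [step_succ _ hp, mul_assoc, ← tr_eq hp]
  rcases eq_or_ne j i with rfl | h1
  · rw [step_self _ hi, map_mul, ι_gx hi, mul_assoc, tr_A hi, mul_assoc]
  · rw [step_lt _ hi (by omega), map_mul, ι_gs (by omega), mul_assoc, tr_shift hi (by omega),
      mul_assoc]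

/-- Left inverse of `ι`. -/
def un (b : B (n + 1)) : SD n := (ra b (1, n)).1

lemma un_ι (g : SD n) : un (ι g) = g := by simp [un, ra_ι]

lemma ι_un {b : B (n + 1)} (hb : π b n = n) : ι (un b) = b := by
  have h1 := ra_spec b (1, n) le_rfl
  have h2 := ra_snd b (1, n)
  rw [Equiv.Perm.inv_eq_iff_eq.2 hb.symm] at h2
  rw [h2] at h1
  simpa [tr, un] using h1.symm

lemma π_up (b : B n) : π (up b) = π b := by
  refine DFunLike.congr_fun (f := π.comp up) (g := π) (hom_ext fun i hi => ?_) b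
  rw [MonoidHom.comp_apply, up_s hi, π_s (by omega), π_s hi]

lemma c_up (b : B n) : c (up b) = c b := by
  have : cr.comp up = cr (n := n) := hom_ext fun i hi => by
    rw [MonoidHom.comp_apply, up_s hi, cr, cr, lift_s _ _ (by omega), lift_s _ _ hi]
  funext q r
  simp only [c, ← DFunLike.congr_fun this b]
  rfl

lemma π_A {m i j : ℕ} (h : i < j) (hj : j < m) : π (A i j : B m) = 1 := by
  refine A_induction (p := fun j a => j < m → π a = 1) ?_ ?_ h hj
  · exact fun h => π_sq (by omega)
  · intro j h1 h2 h3
    simp [h2 (by omega)]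

/-- The crossing function of a pair. -/
def pr (i j q r : ℕ) : ℤ := if (q = i ∧ r = j) ∨ (q = j ∧ r = i) then 1 else 0

lemma c_A {m i j : ℕ} (h : i < j) (hj : j < m) (q r : ℕ) :
    c (A i j : B m) q r = 2 * pr i j q r := by
  induction j, h using Nat.le_induction generalizing q r with
  | base => rw [A_self, c_sq hj]; rfl
  | succ j h ih =>
    rw [A_succ h, c_conj _ (π_A h (by omega)), ih (by omega), π_s hj, Equiv.swap_inv]
    have h1 : Equiv.swap j (j + 1) i = i := Equiv.swap_apply_of_ne_of_ne (by omega) (by omega)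
    simp only [pr, Equiv.swap_apply_eq_iff, Equiv.swap_apply_left, h1]

lemma π_fr (v : F n) : π (fr v : B (n + 1)) = 1 := by
  refine DFunLike.congr_fun (f := π.comp fr) (g := 1) (fhom_ext fun i hi => ?_) v
  rw [MonoidHom.comp_apply, fr_x hi, π_A hi (by omega)]
  rfl

lemma c_fr (v : F n) {q r : ℕ} (hq : q < n) (hr : r < n) : c (fr v : B (n + 1)) q r = 0 := by
  let H : Subgroup (F n) :=
    { carrier := {v | c (fr v : B (n + 1)) q r = 0}
      one_mem' := by simp
      mul_mem' := by
        intro a b ha hb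
        rw [Set.mem_ofPred_eq] at *
        rw [map_mul, c_mul_of_pure _ (π_fr a), ha, hb, add_zero]
      inv_mem' := by
        intro a ha
        rw [Set.mem_ofPred_eq] at *
        rw [map_inv, c_inv, π_fr]
        simp [ha] }
  refine mem_of_x (H := H) (fun j hj => ?_) v
  show c (fr (x j)) q r = 0
  rw [fr_x hj, c_A hj (by omega), pr, if_neg (by omega)]
  rfl

/-- The exponent of a generator in a word. -/
def xe (j : ℕ) : F n →* Multiplicative ℤ := flift (fun k => if k = j then .ofAdd 1 else 1)

lemma c_fr_last (v : F n) {q : ℕ} (hq : q < n) :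
    c (fr v : B (n + 1)) q n = 2 * (xe q v).toAdd := by
  let H : Subgroup (F n) :=
    { carrier := {v | c (fr v : B (n + 1)) q n = 2 * (xe q v).toAdd}
      one_mem' := by simp
      mul_mem' := by
        intro a b ha hb
        rw [Set.mem_ofPred_eq] at *
        rw [map_mul, c_mul_of_pure _ (π_fr a), ha, hb, map_mul, toAdd_mul, mul_add]
      inv_mem' := by
        intro a ha
        rw [Set.mem_ofPred_eq] at *
        rw [map_inv, c_inv, π_fr, map_inv, toAdd_inv, mul_neg]
        simp [ha] }
  refine mem_of_x (H := H) (fun j hj => ?_) v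
  show c (fr (x j)) q n = 2 * (xe q (x j)).toAdd
  rw [fr_x hj, c_A hj (by omega), xe, flift_x _ hj, pr]
  congr 1
  by_cases h : j = q
  · simp [h]
  · rw [if_neg h, if_neg (by omega)]; rfl

lemma π_ι (g : SD n) : π (ι g : B (n + 1)) = π g.right := by
  conv_lhs => rw [← SemidirectProduct.inl_left_mul_inr_right g]
  rw [map_mul, map_mul, ι_inl, ι_inr, π_fr, π_up, one_mul]

lemma c_ι (g : SD n) {q r : ℕ} (hq : q < n) (hr : r < n) :
    c (ι g : B (n + 1)) q r = c g.right q r := by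
  conv_lhs => rw [← SemidirectProduct.inl_left_mul_inr_right g]
  rw [map_mul, ι_inl, ι_inr, c_mul_of_pure _ (π_fr _), c_up, c_fr _ hq hr, zero_add]

end Stabiliser

end BraidAut

namespace BraidAut

/-! ### Centralisers in free groups -/

section FreeGroup

lemma freeGroup_center_eq_one {α : Type*} {a b : α} (hab : a ≠ b) {g : FreeGroup α}
    (hg : ∀ h, Commute h g) : g = 1 := by
  classical
  by_contra hne
  have hL : g.toWord ≠ [] := fun h => hne (FreeGroup.toWord_eq_nil_iff.1 h)
  obtain ⟨u, L, hu⟩ := List.exists_cons_of_ne_nil hL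
  obtain ⟨M, v, hv⟩ := (List.eq_nil_or_concat' g.toWord).resolve_left hL
  obtain ⟨i, hi⟩ : ∃ i, i ≠ u.1 := by
    by_cases h : a = u.1
    · exact ⟨b, fun h' => hab (h.trans h'.symm)⟩
    · exact ⟨a, h⟩
  have hred := FreeGroup.isReduced_toWord (x := g)
  have h1 : FreeGroup.IsReduced ((i, v.2) :: g.toWord) := by
    rw [hu] at hred ⊢
    exact List.isChain_cons_cons.2 ⟨fun h => absurd h hi, hred⟩
  have h2 : FreeGroup.IsReduced (g.toWord ++ [(i, v.2)]) := by
    rw [hv] at hred ⊢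
    refine List.isChain_append.2 ⟨hred, by simp, ?_⟩
    simp
  have key := congrArg FreeGroup.toWord (hg (FreeGroup.mk [(i, v.2)])).eq
  rw [← FreeGroup.mk_toWord (x := g), FreeGroup.mul_mk, FreeGroup.mul_mk, FreeGroup.toWord_mk,
    FreeGroup.toWord_mk, List.singleton_append, FreeGroup.isReduced_iff_reduce_eq.1 h1,
    FreeGroup.isReduced_iff_reduce_eq.1 h2, hu, List.cons_append] at key
  exact hi (congrArg Prod.fst (List.cons.inj key).1)

lemma isCyclic_of_center {G : Type*} [Group G] [IsFreeGroup G] {g : G} (hg : ∀ h, Commute h g)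
    (hne : g ≠ 1) : IsCyclic G := by
  set φ := IsFreeGroup.toFreeGroup G
  have hsub : Subsingleton (IsFreeGroup.Generators G) := by
    refine ⟨fun a b => by_contra fun hab => hne ?_⟩
    refine φ.injective ?_
    rw [map_one]
    refine freeGroup_center_eq_one hab fun h => ?_
    simpa using (hg (φ.symm h)).map φ
  rcases isEmpty_or_nonempty (IsFreeGroup.Generators G) with h | ⟨⟨a⟩⟩
  · exact absurd (φ.injective (Subsingleton.elim _ _)) hne
  · have : Unique (IsFreeGroup.Generators G) := ⟨⟨a⟩, fun b => Subsingleton.elim _ _⟩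
    exact isCyclic_of_surjective φ.symm φ.symm.surjective

variable {α : Type*}

/-- Centralisers of nontrivial elements of a free group are cyclic. -/
lemma exists_zpowers_of_commute {g : FreeGroup α} (hne : g ≠ 1) :
    ∃ d : FreeGroup α, ∀ h, Commute h g → h ∈ Subgroup.zpowers d := by
  set C := Subgroup.centralizer {g}
  have hgC : g ∈ C := Subgroup.mem_centralizer_singleton_iff.2 rfl
  have hC : IsCyclic C := by
    refine isCyclic_of_center (g := ⟨g, hgC⟩) (fun h => ?_) (fun h => hne (congrArg Subtype.val h))
    exact Subtype.ext (Subgroup.mem_centralizer_singleton_iff.1 h.2)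
  obtain ⟨d, hd⟩ := hC.exists_generator
  refine ⟨d, fun h hh => ?_⟩
  obtain ⟨k, hk⟩ := hd ⟨h, Subgroup.mem_centralizer_singleton_iff.2 hh⟩
  exact ⟨k, congrArg Subtype.val hk⟩

variable {f : FreeGroup α →* Multiplicative ℤ}

lemma eq_one_of_commute {g w : FreeGroup α} (hc : Commute w g) (hg : f g ≠ 1) (hw : f w = 1) :
    w = 1 := by
  obtain ⟨d, hd⟩ := exists_zpowers_of_commute (g := g) (by rintro rfl; simp at hg)
  obtain ⟨k, rfl⟩ := hd w hc
  obtain ⟨l, rfl⟩ := hd g (Commute.refl g)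
  simp only [map_zpow] at hg hw
  have h1 : f d ≠ 1 := fun h => hg (by rw [h, one_zpow])
  have : k * (f d).toAdd = 0 := by simpa using congrArg Multiplicative.toAdd hw
  have h2 : (f d).toAdd ≠ 0 := h1
  have : k = 0 := by simpa [h2] using this
  simp [this]

lemma mem_zpowers_of_commute_pow {g h : FreeGroup α} (hg : f g = Multiplicative.ofAdd 1) {k : ℕ}
    (hk : 0 < k) (hc : Commute h (g ^ k)) : h ∈ Subgroup.zpowers g := by
  have hgk : f (g ^ k) ≠ 1 := by
    rw [map_pow, hg, ← ofAdd_nsmul]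
    intro h
    have := congrArg Multiplicative.toAdd h
    simp at this
    omega
  obtain ⟨d, hd⟩ := exists_zpowers_of_commute (g := g ^ k) (by intro h; simp [h] at hgk)
  obtain ⟨a, rfl⟩ := hd h hc
  obtain ⟨b, hb⟩ := hd g ((Commute.refl g).pow_right k)
  dsimp only at hb
  have h1 : b * (f d).toAdd = 1 := by
    have := congrArg (fun v => (f v).toAdd) hb
    simpa [hg] using this
  rcases Int.isUnit_iff.1 (IsUnit.of_mul_eq_one _ h1) with rfl | rfl
  · rw [zpow_one] at hb
    exact ⟨a, by rw [hb]⟩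
  · exact ⟨-a, by rw [← hb]; simp⟩

end FreeGroup

end BraidAut

namespace BraidAut

/-! ### Free products of two subgroups -/

section FreeProduct

variable {Γ : Type*} [Group Γ]

/-- Reduced words in the elements of two subgroups. -/
structure Red (A : Bool → Subgroup Γ) (l : List (Bool × Γ)) : Prop where
  mem : ∀ s ∈ l, s.2 ∈ A s.1 ∧ s.2 ≠ 1
  chain : l.IsChain (fun a b => a.1 ≠ b.1)

/-- The product of a word. -/
def val (l : List (Bool × Γ)) : Γ := (l.map Prod.snd).prod

@[simp] lemma val_nil : val ([] : List (Bool × Γ)) = 1 := rfl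

@[simp] lemma val_cons (s : Bool × Γ) (l : List (Bool × Γ)) : val (s :: l) = s.2 * val l := by
  simp [val]

@[simp] lemma val_append (l m : List (Bool × Γ)) : val (l ++ m) = val l * val m := by
  simp [val]

/-- A group is the free product of two subgroups. -/
structure IsFreeProd (A : Bool → Subgroup Γ) : Prop where
  exists_red : ∀ g, ∃ l, Red A l ∧ val l = g
  unique : ∀ l m, Red A l → Red A m → val l = val m → l = m

lemma isFreeProd_range {G : Bool → Type*} [∀ i, Group (G i)] (ρ : ∀ i, G i →* Γ)
    (θ : Γ →* Monoid.CoprodI G) (h : ∀ i a, θ (ρ i a) = Monoid.CoprodI.of a)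
    (htop : ⨆ i, (ρ i).range = ⊤) : IsFreeProd (fun i => (ρ i).range) := by
  have hinj : Function.Injective (Monoid.CoprodI.lift ρ) := by
    have : θ.comp (Monoid.CoprodI.lift ρ) = MonoidHom.id _ := by
      ext i a
      simp [h]
    exact fun a b hab => by simpa [← MonoidHom.comp_apply, this] using congrArg θ hab
  have hρ : ∀ i, Function.Injective (ρ i) := fun i a b hab =>
    Monoid.CoprodI.of_injective i (by rw [← h, ← h, hab])
  have hval : ∀ w : Monoid.CoprodI.Word G,
      val (w.toList.map fun s => (s.1, ρ s.1 s.2)) = Monoid.CoprodI.lift ρ w.prod := by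
    intro w
    rw [Monoid.CoprodI.Word.prod, map_list_prod, val, List.map_map, List.map_map]
    congr 1
  have hw : ∀ l, Red (fun i => (ρ i).range) l → ∃ w : Monoid.CoprodI.Word G,
      (w.toList.map fun s => (s.1, ρ s.1 s.2)) = l := by
    intro l hl
    have : ∃ m : List (Σ i, G i), (m.map fun s => (s.1, ρ s.1 s.2)) = l := by
      have hm := hl.mem
      clear hl
      induction l with
      | nil => exact ⟨[], rfl⟩
      | cons s l ih =>
        obtain ⟨m, hm'⟩ := ih fun t ht => hm t (by simp [ht])
        obtain ⟨a, ha⟩ := (hm s (by simp)).1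
        exact ⟨⟨s.1, a⟩ :: m, by rw [List.map_cons, hm', ha]⟩
    obtain ⟨m, rfl⟩ := this
    refine ⟨⟨m, fun s hs hs1 => ?_, ?_⟩, rfl⟩
    · exact (hl.mem _ (List.mem_map_of_mem hs)).2 (by simp [hs1])
    · have := hl.chain
      rwa [List.isChain_map] at this
  refine ⟨fun g => ?_, fun l m hl hm hlm => ?_⟩
  · obtain ⟨c, rfl⟩ : g ∈ (Monoid.CoprodI.lift ρ).range := by
      rw [Monoid.CoprodI.range_eq_iSup, htop]
      trivial
    classical
    obtain ⟨w, rfl⟩ := (Monoid.CoprodI.Word.equiv (M := G)).symm.surjective c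
    refine ⟨_, ⟨?_, ?_⟩, hval w⟩
    · intro s hs
      obtain ⟨t, ht, rfl⟩ := List.mem_map.1 hs
      exact ⟨⟨t.2, rfl⟩, fun h1 => w.ne_one t ht (hρ _ (h1.trans (map_one _).symm))⟩
    · rw [List.isChain_map]
      exact w.chain_ne
  · obtain ⟨v, rfl⟩ := hw l hl
    obtain ⟨w, rfl⟩ := hw m hm
    rw [hval, hval] at hlm
    classical
    have : v = w := (Monoid.CoprodI.Word.equiv (M := G)).symm.injective (hinj hlm)
    rw [this]

variable {A : Bool → Subgroup Γ} {l m u v h : List (Bool × Γ)} {s t : Bool × Γ} {i : Bool}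

lemma red_nil : Red A [] := ⟨by simp, by simp⟩

lemma red_cons : Red A (s :: l) ↔
    s.2 ∈ A s.1 ∧ s.2 ≠ 1 ∧ (∀ t ∈ l.head?, s.1 ≠ t.1) ∧ Red A l := by
  constructor
  · rintro ⟨h1, h2⟩
    exact ⟨(h1 s (by simp)).1, (h1 s (by simp)).2, (List.isChain_cons.1 h2).1,
      fun t ht => h1 t (by simp [ht]), (List.isChain_cons.1 h2).2⟩
  · rintro ⟨h1, h2, h3, h4⟩
    refine ⟨?_, List.isChain_cons.2 ⟨h3, h4.chain⟩⟩
    rintro t ht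
    rcases List.mem_cons.1 ht with rfl | ht
    · exact ⟨h1, h2⟩
    · exact h4.mem t ht

lemma red_append : Red A (l ++ m) ↔
    Red A l ∧ Red A m ∧ ∀ s ∈ l.getLast?, ∀ t ∈ m.head?, s.1 ≠ t.1 := by
  constructor
  · rintro ⟨h1, h2⟩
    obtain ⟨h3, h4, h5⟩ := List.isChain_append.1 h2
    exact ⟨⟨fun s hs => h1 s (by simp [hs]), h3⟩, ⟨fun s hs => h1 s (by simp [hs]), h4⟩, h5⟩
  · rintro ⟨h1, h2, h3⟩
    refine ⟨fun s hs => ?_, List.isChain_append.2 ⟨h1.chain, h2.chain, h3⟩⟩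
    rcases List.mem_append.1 hs with hs | hs
    exacts [h1.mem s hs, h2.mem s hs]

lemma red_singleton : Red A [s] ↔ s.2 ∈ A s.1 ∧ s.2 ≠ 1 := by
  simp [red_cons, red_nil]

/-- The formal inverse of a word. -/
def invWord (l : List (Bool × Γ)) : List (Bool × Γ) := (l.map fun s => (s.1, s.2⁻¹)).reverse

@[simp] lemma invWord_nil : invWord ([] : List (Bool × Γ)) = [] := rfl

@[simp] lemma invWord_cons : invWord (s :: l) = invWord l ++ [(s.1, s.2⁻¹)] := by simp [invWord]

lemma val_invWord : val (invWord l) = (val l)⁻¹ := by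
  induction l with
  | nil => simp
  | cons s l ih => simp [ih]

lemma Red.invWord (hl : Red A l) : Red A (invWord l) := by
  induction l with
  | nil => exact red_nil
  | cons s l ih =>
    rw [red_cons] at hl
    rw [invWord_cons, red_append, red_singleton]
    refine ⟨ih hl.2.2.2, ⟨inv_mem hl.1, inv_ne_one.2 hl.2.1⟩, ?_⟩
    intro a ha b hb
    cases l with
    | nil => simp at ha
    | cons t l =>
      simp only [invWord_cons, List.getLast?_concat, Option.mem_def, Option.some.injEq] at ha
      simp only [List.head?_cons, Option.mem_def, Option.some.injEq] at hb
      subst ha hb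
      exact (hl.2.2.1 t (by simp)).symm

lemma Red.map {T : MulAut Γ} (hT : ∀ i, ∀ a ∈ A i, T a ∈ A i) (hl : Red A l) :
    Red A (l.map fun s => (s.1, T s.2)) := by
  refine ⟨fun s hs => ?_, ?_⟩
  · obtain ⟨t, ht, rfl⟩ := List.mem_map.1 hs
    exact ⟨hT _ _ (hl.mem t ht).1, by simpa using (hl.mem t ht).2⟩
  · rw [List.isChain_map]
    exact hl.chain

lemma val_map (T : MulAut Γ) : val (l.map fun s => (s.1, T s.2)) = T (val l) := by
  induction l with
  | nil => simp
  | cons s l ih => simp [ih]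

variable (hA : IsFreeProd A)
include hA

/-- Elements fixed by an automorphism preserving both factors. -/
lemma mem_closure_fixed {T : MulAut Γ} (hT : ∀ i, ∀ a ∈ A i, T a ∈ A i) {w : Γ} (hw : T w = w) :
    w ∈ Subgroup.closure {a | ∃ i, a ∈ A i ∧ T a = a} := by
  obtain ⟨l, hl, rfl⟩ := hA.exists_red w
  rw [← val_map] at hw
  have := hA.unique _ _ (hl.map hT) hl hw
  refine Subgroup.list_prod_mem _ fun a ha => ?_
  obtain ⟨s, hs, rfl⟩ := List.mem_map.1 ha
  refine Subgroup.subset_closure ⟨s.1, (hl.mem s hs).1, ?_⟩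
  have h1 : ∀ s ∈ l, (fun s : Bool × Γ => (s.1, T s.2)) s = s :=
    List.map_inj_left.1 (this.trans (List.map_id l).symm)
  exact congrArg Prod.snd (h1 s hs)

/-- Every element is conjugate to an element of a factor or to a cyclically reduced word. -/
lemma exists_conj (g : Γ) : (∃ h i, h * g * h⁻¹ ∈ A i) ∨
    ∃ h u, u ≠ [] ∧ Red A (u ++ u) ∧ h * g * h⁻¹ = val u := by
  obtain ⟨l, hl, rfl⟩ := hA.exists_red g
  induction hk : l.length using Nat.strong_induction_on generalizing l with
  | _ k ih =>
    rcases l with _ | ⟨s, l⟩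
    · exact Or.inl ⟨1, true, by simp [one_mem]⟩
    rcases List.eq_nil_or_concat' l with rfl | ⟨m, t, rfl⟩
    · exact Or.inl ⟨1, s.1, by simpa using (hl.mem s (by simp)).1⟩
    by_cases hst : t.1 = s.1
    · obtain ⟨m', hm', hlen, hval⟩ : ∃ m', Red A m' ∧ m'.length < k ∧
          val m' = s.2⁻¹ * val (s :: (m ++ [t])) * s.2 := by
        have hs := (hl.mem s (by simp)).1
        rw [red_cons, red_append, red_singleton] at hl
        obtain ⟨hsA, hs1, hsl, hm, ⟨htA, ht1⟩, hmt⟩ := hl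
        by_cases h1 : t.2 * s.2 = 1
        · refine ⟨m, hm, ?_, ?_⟩
          · simp at hk
            omega
          · simp [mul_assoc, h1]
        · refine ⟨m ++ [(t.1, t.2 * s.2)], ?_, ?_, ?_⟩
          · rw [red_append, red_singleton]
            exact ⟨hm, ⟨mul_mem htA (by rwa [hst]), h1⟩, fun a ha b hb => hmt a ha t (by simp) ∘
              fun h => h.trans (by simp at hb; rw [← hb])⟩
          · simp at hk ⊢
            omega
          · simp [mul_assoc]
      rcases ih _ hlen m' hm' rfl with ⟨h, i, hh⟩ | ⟨h, u, hu, hu', hh⟩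
      · exact Or.inl ⟨h * s.2⁻¹, i, by rw [hval] at hh; simpa [mul_assoc] using hh⟩
      · exact Or.inr ⟨h * s.2⁻¹, u, hu, hu', by rw [hval] at hh; simpa [mul_assoc] using hh⟩
    · refine Or.inr ⟨1, s :: (m ++ [t]), by simp, ?_, by simp⟩
      rw [red_append]
      refine ⟨hl, hl, fun a ha b hb => ?_⟩
      rw [← List.cons_append, List.getLast?_concat] at ha
      simp at ha hb
      subst ha hb
      exact hst

omit hA in
/-- A conjugate of a reduced word with equal end types. -/
lemma exists_conj_bad (h : List (Bool × Γ)) : ∀ (a b : Bool × Γ) (m : List (Bool × Γ)),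
    Red A (a :: m ++ [b]) → a.1 = b.1 → Red A (h ++ (a :: m ++ [b])) →
    ∃ a' b' m', Red A (a' :: m' ++ [b']) ∧ a'.1 = b'.1 ∧
      val (a' :: m' ++ [b']) = val h * val (a :: m ++ [b]) * (val h)⁻¹ := by
  induction h using List.reverseRecOn with
  | nil => exact fun a b m hl hab _ => ⟨a, b, m, hl, hab, by simp⟩
  | append_singleton h t ih =>
    intro a b m hl hab hr
    rw [List.append_assoc, red_append, List.singleton_append, red_cons] at hr
    obtain ⟨hh, ⟨htA, ht1, hta, -⟩, hht⟩ := hr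
    have hta : t.1 ≠ a.1 := hta a (by simp)
    have hl' : Red A (t :: (a :: m ++ [b]) ++ [(t.1, t.2⁻¹)]) := by
      rw [red_append, red_cons, red_singleton]
      refine ⟨⟨htA, ht1, by simpa using hta, hl⟩, ⟨inv_mem htA, inv_ne_one.2 ht1⟩, ?_⟩
      intro c hc d hd
      rw [← List.cons_append, List.getLast?_concat] at hc
      simp at hc hd
      subst hc hd
      rw [← hab]
      exact hta.symm
    obtain ⟨a', b', m', h1, h2, h3⟩ := ih _ _ _ hl' rfl (by
      rw [red_append]
      exact ⟨hh, hl', by simpa using hht⟩)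
    exact ⟨a', b', m', h1, h2, by rw [h3]; simp [mul_assoc]⟩

/-- Conjugate cyclically reduced words are rotations of each other. -/
lemma isRotated_of_conj (h : List (Bool × Γ)) (hh : Red A h) : ∀ u v, u ≠ [] → v ≠ [] →
    Red A (u ++ u) → Red A (v ++ v) → val h * val u * (val h)⁻¹ = val v → u ~r v := by
  induction h using List.reverseRecOn with
  | nil =>
    intro u v _ _ hu hv huv
    rw [red_append] at hu hv
    rw [hA.unique u v hu.1 hv.1 (by simpa using huv)]
  | append_singleton h t ih =>
    intro u v hu0 hv0 hu hv huv
    have key : ∀ a b m, Red A (a :: m ++ [b]) → a.1 = b.1 → Red A (h ++ (a :: m ++ [b])) →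
        val (h ++ [t]) * val u * (val (h ++ [t]))⁻¹
          = val h * val (a :: m ++ [b]) * (val h)⁻¹ → False := by
      intro a b m h1 h2 h3 h4
      obtain ⟨a', b', m', h5, h6, h7⟩ := exists_conj_bad h a b m h1 h2 h3
      rw [← h4, huv] at h7
      rw [red_append] at hv
      have := hA.unique _ _ h5 hv.1 h7
      subst this
      exact hv.2.2 b' (by rw [List.getLast?_concat]; rfl) a' (by simp) h6.symm
    rw [red_append, red_singleton] at hh
    obtain ⟨hh, ⟨htA, ht1⟩, hht⟩ := hh
    obtain ⟨a, u', rfl⟩ := List.exists_cons_of_ne_nil hu0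
    have hu'0 : u' ≠ [] := by
      rintro rfl
      simp [red_cons] at hu
    obtain ⟨w, b, rfl⟩ := (List.eq_nil_or_concat' u').resolve_left hu'0
    have hu2 := hu
    rw [red_append, red_cons, red_append, red_singleton] at hu
    obtain ⟨⟨haA, ha1, haw, hw, ⟨hbA, hb1⟩, hwb⟩, -, hends⟩ := hu
    have hba : b.1 ≠ a.1 :=
      hends b (by rw [← List.cons_append, List.getLast?_concat]; rfl) a (by simp)
    have hwb' : Red A (w ++ [b]) := by
      rw [red_append, red_singleton]
      exact ⟨hw, ⟨hbA, hb1⟩, hwb⟩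
    have haw' : Red A (a :: w) := by
      rw [red_cons]
      refine ⟨haA, ha1, fun c hc => haw c ?_, hw⟩
      rw [List.head?_append, hc]
      rfl
    by_cases hta : t.1 = a.1
    · by_cases h1 : t.2 * a.2 = 1
      · have hrot : a :: (w ++ [b]) ~r w ++ [b] ++ [a] :=
          ⟨1, by simp⟩
        refine hrot.trans (ih hh _ _ (by simp) hv0 ?_ hv ?_)
        · rw [red_append]
          have : Red A (w ++ [b] ++ [a]) := by
            rw [red_append, red_singleton]
            refine ⟨hwb', ⟨haA, ha1⟩, ?_⟩
            intro c hc d hd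
            rw [List.getLast?_concat] at hc
            simp at hc hd
            subst hc hd
            exact hba
          refine ⟨this, this, ?_⟩
          intro c hc d hd
          rw [List.getLast?_concat] at hc
          simp only [Option.mem_def, Option.some.injEq] at hc
          subst hc
          exact haw d (by rwa [List.head?_append_of_ne_nil _ (by simp)] at hd)
        · rw [← huv]
          have : t.2 = a.2⁻¹ := eq_inv_of_mul_eq_one_left h1
          simp [mul_assoc, this]
      · refine (key (t.1, t.2 * a.2) (t.1, t.2⁻¹) (w ++ [b]) ?_ rfl ?_ ?_).elim
        all_goals
          have hr : Red A ((t.1, t.2 * a.2) :: (w ++ [b]) ++ [(t.1, t.2⁻¹)]) := by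
            rw [red_append, red_cons, red_singleton]
            refine ⟨⟨mul_mem htA (by rwa [hta]), h1, fun c hc => ?_, hwb'⟩,
              ⟨inv_mem htA, inv_ne_one.2 ht1⟩, ?_⟩
            · rw [hta]
              exact haw c hc
            · intro c hc d hd
              rw [← List.cons_append, List.getLast?_concat] at hc
              simp at hc hd
              subst hc hd
              rw [hta]
              exact hba
        · exact hr
        · rw [red_append]
          exact ⟨hh, hr, by simpa using hht⟩
        · simp [mul_assoc]
    · have htb : t.1 = b.1 := by
        revert hta hba
        generalize t.1 = i
        generalize a.1 = j
        generalize b.1 = k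
        revert i j k
        decide
      by_cases h1 : b.2 * t.2⁻¹ = 1
      · have hrot : a :: (w ++ [b]) ~r b :: (a :: w) :=
          List.IsRotated.symm ⟨1, by simp⟩
        have hr : Red A (b :: a :: w) := by
          rw [red_cons]
          exact ⟨hbA, hb1, by simpa using hba, haw'⟩
        refine hrot.trans (ih hh _ _ (by simp) hv0 ?_ hv ?_)
        · rw [red_append]
          refine ⟨hr, hr, ?_⟩
          intro c hc d hd
          simp at hd
          subst hd
          rcases List.eq_nil_or_concat' w with rfl | ⟨w', e, rfl⟩
          · simp at hc
            subst hc
            exact hba.symm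
          · rw [← List.cons_append, ← List.cons_append, List.getLast?_concat] at hc
            refine hwb c ?_ b (by simp)
            rw [List.getLast?_concat]
            exact hc
        · rw [← huv]
          have : b.2 = t.2 := by rwa [mul_inv_eq_one] at h1
          simp [mul_assoc, this]
      · refine (key t (t.1, b.2 * t.2⁻¹) (a :: w) ?_ rfl ?_ ?_).elim
        all_goals
          have hr : Red A (t :: (a :: w) ++ [(t.1, b.2 * t.2⁻¹)]) := by
            rw [red_append, red_cons, red_singleton]
            refine ⟨⟨htA, ht1, by simpa using hta, haw'⟩,
              ⟨mul_mem (by rwa [htb]) (inv_mem htA), h1⟩, ?_⟩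
            intro c hc d hd
            simp at hd
            subst hd
            rcases List.eq_nil_or_concat' w with rfl | ⟨w', e, rfl⟩
            · simp at hc
              subst hc
              exact fun h => hta h.symm
            · rw [← List.cons_append, ← List.cons_append, List.getLast?_concat] at hc
              refine (htb ▸ hwb c ?_ b (by simp) : c.1 ≠ t.1)
              rw [List.getLast?_concat]
              exact hc
        · exact hr
        · rw [red_append]
          exact ⟨hh, hr, by simpa using hht⟩
        · simp [mul_assoc]

/-- Elements conjugate to their image under an automorphism preserving both factors. -/
lemma conj_mem_of_map_conj {T : MulAut Γ} (hT : ∀ i, ∀ a ∈ A i, T a ∈ A i) {w g : Γ}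
    (hw : T w = g * w * g⁻¹) : (∃ h i, h * w * h⁻¹ ∈ A i) ∨
      ∃ h, h * w * h⁻¹ ∈
        Subgroup.closure {a | ∃ i, a ∈ A i ∧ ∃ k : ℕ, 0 < k ∧ (T ^ k) a = a} := by
  refine (exists_conj hA w).imp_right ?_
  rintro ⟨h, u, hu0, hu, hwu⟩
  refine ⟨h, ?_⟩
  obtain ⟨c, hc, hcv⟩ := hA.exists_red (T h * g * h⁻¹)
  have hrot : u ~r u.map fun s => (s.1, T s.2) := by
    refine isRotated_of_conj hA c hc _ _ hu0 (by simpa using hu0) hu ?_ ?_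
    · rw [← List.map_append]
      exact hu.map hT
    · rw [val_map, ← hwu, hcv, map_mul, map_mul, hw, map_inv]
      group
  obtain ⟨r, hr⟩ := hrot
  have hpow : ∀ k : ℕ, u.rotate (r * k) = u.map fun s => (s.1, (T ^ k) s.2) := by
    intro k
    induction k with
    | zero => simp
    | succ k ih =>
      rw [mul_add, mul_one, ← List.rotate_rotate, ih, ← List.map_rotate, hr, List.map_map]
      exact List.map_congr_left fun s _ => by simp [pow_succ]
  have hlen := hpow u.length
  rw [mul_comm, List.rotate_length_mul] at hlen
  have hfix := List.map_inj_left.1 (hlen.symm.trans (List.map_id u).symm)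
  rw [hwu]
  refine Subgroup.list_prod_mem _ fun a ha => ?_
  obtain ⟨s, hs, rfl⟩ := List.mem_map.1 ha
  refine Subgroup.subset_closure ⟨s.1, (hu.mem s (by simp [hs])).1, u.length,
    List.length_pos_iff.2 hu0, congrArg Prod.snd (hfix s hs)⟩

/-- Torsion elements are conjugate into a factor. -/
lemma conj_mem_of_pow_eq_one {g : Γ} {k : ℕ} (hk : 0 < k) (hg : g ^ k = 1) :
    ∃ h i, h * g * h⁻¹ ∈ A i := by
  refine (exists_conj hA g).resolve_right ?_
  rintro ⟨h, u, hu0, hu, hgu⟩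
  have hpow : ∀ k : ℕ, ∃ l, Red A (u ++ l) ∧ val l = val u ^ k := by
    intro k
    induction k with
    | zero => exact ⟨[], by rw [red_append] at hu; simpa using hu.1, by simp⟩
    | succ k ih =>
      obtain ⟨l, hl, hlv⟩ := ih
      refine ⟨u ++ l, ?_, by rw [val_append, hlv, pow_succ']⟩
      rw [red_append] at hu ⊢
      refine ⟨hu.1, hl, fun a ha b hb => hu.2.2 a ha b ?_⟩
      rwa [List.head?_append_of_ne_nil _ hu0] at hb
  obtain ⟨l, hl, hlv⟩ := hpow (k - 1)
  have h1 : val (u ++ l) = val [] := by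
    rw [val_append, hlv, ← pow_succ', Nat.sub_add_cancel hk, ← hgu, conj_pow, hg]
    simp
  have := hA.unique _ _ hl red_nil h1
  simp [hu0] at this

/-- A free product of nontrivial groups has trivial centre. -/
lemma eq_one_of_central (hi : ∀ i, ∃ a ∈ A i, a ≠ 1) {z : Γ} (hz : ∀ g, Commute g z) : z = 1 := by
  obtain ⟨l, hl, rfl⟩ := hA.exists_red z
  rcases l with _ | ⟨s, l⟩
  · rfl
  exfalso
  obtain ⟨a, ha, ha1⟩ := hi (!s.1)
  have h1 : Red A ((!s.1, a) :: s :: l) := by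
    rw [red_cons]
    exact ⟨ha, ha1, by simp, hl⟩
  have hc := (hz a).eq
  obtain ⟨m, t, hm⟩ := (List.eq_nil_or_concat' (s :: l)).resolve_left (by simp)
  by_cases ht : t.1 = s.1
  · have h2 : Red A (s :: l ++ [(!s.1, a)]) := by
      rw [red_append, red_singleton]
      refine ⟨hl, ⟨ha, ha1⟩, ?_⟩
      rw [hm, List.getLast?_concat]
      simp [ht]
    have := hA.unique _ _ h1 h2 (by simpa [mul_assoc] using hc)
    simpa using congrArg Prod.fst (List.cons.inj this).1
  · have hts : t.1 = !s.1 := by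
      revert ht
      cases t.1 <;> cases s.1 <;> simp
    obtain ⟨w, hw, hwl, hwv⟩ : ∃ w, Red A w ∧ w.length ≤ (s :: l).length ∧
        val w = val (s :: l) * a := by
      rw [hm, red_append, red_singleton] at hl
      by_cases h0 : t.2 * a = 1
      · exact ⟨m, hl.1, by simp [hm], by simp [hm, mul_assoc, h0]⟩
      · refine ⟨m ++ [(t.1, t.2 * a)], ?_, by simp [hm], by simp [hm, mul_assoc]⟩
        rw [red_append, red_singleton]
        exact ⟨hl.1, ⟨mul_mem hl.2.1.1 (by rwa [hts]), h0⟩, by simpa using hl.2.2⟩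
    have := hA.unique _ _ h1 hw (by rw [hwv, ← hc]; rfl)
    subst this
    simp at hwl

omit hA in
lemma exists_strip (hl : Red A l) : ∃ a ∈ A true, ∃ b ∈ A false, ∃ m, Red A m ∧
    val l = a * val m * b ∧ (∀ t ∈ m.head?, t.1 = false) ∧ ∀ t ∈ m.getLast?, t.1 = true := by
  obtain ⟨a, ha, m, hm, hv, hh⟩ : ∃ a ∈ A true, ∃ m, Red A m ∧ val l = a * val m ∧
      ∀ t ∈ m.head?, t.1 = false := by
    rcases l with _ | ⟨s, l⟩
    · exact ⟨1, one_mem _, [], red_nil, by simp, by simp⟩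
    · by_cases hs : s.1 = true
      · rw [red_cons, hs] at hl
        exact ⟨s.2, hl.1, l, hl.2.2.2, by simp, fun t ht => by simpa using hl.2.2.1 t ht⟩
      · exact ⟨1, one_mem _, s :: l, hl, by simp, by simpa using hs⟩
  rcases List.eq_nil_or_concat' m with rfl | ⟨w, t, rfl⟩
  · exact ⟨a, ha, 1, one_mem _, [], red_nil, by simp [hv], by simp, by simp⟩
  by_cases ht : t.1 = true
  · exact ⟨a, ha, 1, one_mem _, _, hm, by rw [hv, mul_one], hh, by simpa using ht⟩
  · rw [red_append, red_singleton] at hm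
    simp only [Bool.not_eq_true] at ht
    refine ⟨a, ha, t.2, ht ▸ hm.2.1.1, w, hm.1, by simp [hv, mul_assoc], fun c hc => hh c ?_, ?_⟩
    · rw [List.head?_append, hc]
      rfl
    · intro c hc
      simpa [ht] using hm.2.2 c hc t (by simp)

/-- The endomorphism of a factor conjugating the second factor only. -/
def twist (g : Γ) (i : Bool) (a : Γ) : Γ := bif i then a else g * a * g⁻¹

omit hA in
lemma twist_mul (g : Γ) (i : Bool) (a b : Γ) :
    twist g i (a * b) = twist g i a * twist g i b := by
  cases i <;> simp [twist]

omit hA in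
lemma exists_twist (g : Γ) {y : Γ} {c : Γ} (hc : c ∈ A i)
    (hy : ∃ l, Red A l ∧ (l.map fun s => twist g s.1 s.2).prod = y) :
    ∃ l, Red A l ∧ (l.map fun s => twist g s.1 s.2).prod = twist g i c * y := by
  obtain ⟨l, hl, rfl⟩ := hy
  by_cases hc1 : c = 1
  · subst hc1
    exact ⟨l, hl, by cases i <;> simp [twist]⟩
  rcases l with _ | ⟨s, l⟩
  · exact ⟨[(i, c)], red_singleton.2 ⟨hc, hc1⟩, by simp⟩
  by_cases hs : i = s.1
  · subst hs
    rw [red_cons] at hl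
    by_cases h1 : c * s.2 = 1
    · refine ⟨l, hl.2.2.2, ?_⟩
      rw [List.map_cons, List.prod_cons, ← mul_assoc, ← twist_mul, h1]
      cases s.1 <;> simp [twist]
    · refine ⟨(s.1, c * s.2) :: l, ?_, by simp [twist_mul, mul_assoc]⟩
      rw [red_cons]
      exact ⟨mul_mem hc hl.1, h1, hl.2.2.1, hl.2.2.2⟩
  · exact ⟨(i, c) :: s :: l, red_cons.2 ⟨hc, hc1, by simpa using hs, hl⟩, by simp⟩

omit hA in
lemma exists_expand (hm : Red A m) (hm0 : m ≠ []) (hhead : ∀ t ∈ m.head?, t.1 = false)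
    (hlast : ∀ t ∈ m.getLast?, t.1 = true) (hl : Red A l) :
    ∃ l', Red A l' ∧ val l' = (l.map fun s => twist (val m) s.1 s.2).prod ∧
      (∀ i, (∀ t ∈ l.head?, i ≠ t.1) → ∀ t ∈ l'.head?, i ≠ t.1) ∧
      (l' = [] ∨ (∃ s, s.1 = true ∧ l' = [s]) ∨ 2 ≤ l'.length) := by
  induction l with
  | nil => exact ⟨[], red_nil, by simp, by simp, by simp⟩
  | cons s l ih =>
    rw [red_cons] at hl
    obtain ⟨l', h1, h2, h3, h4⟩ := ih hl.2.2.2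
    by_cases hs : s.1 = true
    · refine ⟨s :: l', red_cons.2 ⟨hl.1, hl.2.1, h3 _ hl.2.2.1, h1⟩, ?_, by simp, ?_⟩
      · simp [h2, twist, hs]
      · rcases l' with _ | ⟨a, l'⟩
        · exact Or.inr (Or.inl ⟨s, hs, rfl⟩)
        · exact Or.inr (Or.inr (by simp))
    · simp only [Bool.not_eq_true] at hs
      obtain ⟨a, m', ham⟩ := List.exists_cons_of_ne_nil hm0
      have ha : a.1 = false := hhead a (by simp [ham])
      refine ⟨m ++ (s :: (invWord m ++ l')), ?_, ?_, ?_, ?_⟩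
      · rw [red_append, red_cons, red_append]
        refine ⟨hm, ⟨hl.1, hl.2.1, ?_, hm.invWord, h1, ?_⟩, ?_⟩
        · intro t ht
          rw [List.head?_append_of_ne_nil _ (by simp [ham]), invWord, List.head?_reverse,
            List.getLast?_map] at ht
          obtain ⟨c, hc, rfl⟩ := Option.mem_map.1 ht
          rw [hs]
          simp [hlast c hc]
        · intro c hc
          rw [ham, invWord_cons, List.getLast?_concat] at hc
          simp only [Option.mem_def, Option.some.injEq] at hc
          subst hc
          refine h3 _ ?_
          simpa [ha, hs] using hl.2.2.1
        · intro c hc d hd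
          simp only [List.head?_cons, Option.mem_def, Option.some.injEq] at hd
          subst hd
          rw [hlast c hc, hs]
          simp
      · rw [val_append, val_cons, val_append, val_invWord, h2]
        simp [twist, hs, mul_assoc]
      · intro i hi t ht
        simp [ham] at ht
        subst ht
        rw [ha, ← hs]
        exact hi s (by simp)
      · refine Or.inr (Or.inr ?_)
        simp [ham]
        omega

/-- If one factor and a conjugate of the other generate a free product, then the conjugating
element is a product of elements of the two factors. -/
lemma eq_mul_of_closure_eq_top {g : Γ}
    (hg : Subgroup.closure ((A true : Set Γ) ∪ {v | ∃ b ∈ A false, v = g * b * g⁻¹}) = ⊤) :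
    ∃ a ∈ A true, ∃ b ∈ A false, g = a * b := by
  obtain ⟨l, hl, rfl⟩ := hA.exists_red g
  obtain ⟨a, ha, b, hb, m, hm, hv, hhead, hlast⟩ := exists_strip hl
  by_cases hm0 : m = []
  · exact ⟨a, ha, b, hb, by simp [hv, hm0]⟩
  exfalso
  have hgen : ∀ w ∈ (A true : Set Γ) ∪ {v | ∃ b ∈ A false, v = val l * b * (val l)⁻¹}, ∀ y,
      (∃ l, Red A l ∧ (l.map fun s => twist (val m) s.1 s.2).prod = y) →
      (∃ l, Red A l ∧ (l.map fun s => twist (val m) s.1 s.2).prod = w * y) ∧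
      ∃ l, Red A l ∧ (l.map fun s => twist (val m) s.1 s.2).prod = w⁻¹ * y := by
    have hconj : ∀ c ∈ A false, ∀ y,
        (∃ l, Red A l ∧ (l.map fun s => twist (val m) s.1 s.2).prod = y) →
        ∃ k, Red A k ∧ (k.map fun s => twist (val m) s.1 s.2).prod
          = val l * c * (val l)⁻¹ * y := by
      intro c hc y hy
      have := exists_twist (val m) ha (exists_twist (val m) (mul_mem (mul_mem hb hc) (inv_mem hb))
        (exists_twist (val m) (inv_mem ha) hy))
      simpa [twist, hv, mul_assoc] using this
    rintro w (hw | ⟨c, hc, rfl⟩) y hy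
    · exact ⟨exists_twist (i := true) (val m) hw hy,
        exists_twist (i := true) (val m) (inv_mem hw) hy⟩
    · exact ⟨hconj c hc y hy, by simpa [mul_assoc] using hconj c⁻¹ (inv_mem hc) y hy⟩
  have hall : ∀ y, ∃ l, Red A l ∧ (l.map fun s => twist (val m) s.1 s.2).prod = y := by
    intro y
    have hy : y ∈ Subgroup.closure
      ((A true : Set Γ) ∪ {v | ∃ b ∈ A false, v = val l * b * (val l)⁻¹}) := hg ▸ trivial
    induction hy using Subgroup.closure_induction_left with
    | one => exact ⟨[], red_nil, by simp⟩
    | mul_left w hw y _ ih => exact (hgen w hw y ih).1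
    | inv_mul_cancel w hw y _ ih => exact (hgen w hw y ih).2
  obtain ⟨s, m', rfl⟩ := List.exists_cons_of_ne_nil hm0
  have hs : Red A [s] := by
    rw [red_singleton]
    exact ⟨(red_cons.1 hm).1, (red_cons.1 hm).2.1⟩
  obtain ⟨k, hk, hks⟩ := hall s.2
  obtain ⟨k', h1, h2, -, h3⟩ := exists_expand hm hm0 hhead hlast hk
  have := hA.unique _ _ h1 hs (by rw [h2, hks]; simp)
  subst this
  rcases h3 with h3 | ⟨t, ht, h3⟩ | h3
  · simp at h3
  · rw [← (List.cons.inj h3).1, hhead s (by simp)] at ht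
    exact absurd ht (by simp)
  · simp at h3

end FreeProduct

end BraidAut

namespace BraidAut

/-! ### A splitting of the free group and rotations -/

section Splitting

variable {n : ℕ}

/-- The generators of the free group, split into the last one and the others. -/
def splitGen (n : ℕ) (i : Bool) : Set (F n) := {v | ∃ j, decide (j + 1 < n) = i ∧ v = x j}

/-- The two factors generated by the last generator and by the others. -/
def split (n : ℕ) (i : Bool) : Subgroup (F n) := Subgroup.closure (splitGen n i)

lemma x_mem_split (j : ℕ) : (x j : F n) ∈ split n (decide (j + 1 < n)) :=
  Subgroup.subset_closure ⟨j, rfl, rfl⟩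

lemma isFreeProd_split (n : ℕ) : IsFreeProd (split n) := by
  let f : ℕ → Monoid.CoprodI (fun i => split n i) := fun j =>
    Monoid.CoprodI.of (M := fun i => split n i) (i := decide (j + 1 < n)) ⟨x j, x_mem_split j⟩
  have h := isFreeProd_range (G := fun i => split n i) (fun i => (split n i).subtype)
    (flift f) ?_ ?_
  · simpa using h
  · intro i
    have : (flift f).comp (split n i).subtype = Monoid.CoprodI.of (M := fun i => split n i) := by
      refine MonoidHom.eq_of_eqOn_dense (Subgroup.closure_closure_coe_preimage (k := splitGen n i)) ?_
      rintro ⟨_, hm⟩ ⟨j, rfl, rfl⟩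
      by_cases hj : j < n
      · exact flift_x f hj
      · have h1 : (⟨x j, hm⟩ : split n (decide (j + 1 < n))) = 1 :=
          Subtype.ext (by simp [x, hj])
        exact (congrArg _ h1).trans ((map_one _).trans ((congrArg _ h1).trans (map_one _)).symm)
    exact fun a => DFunLike.congr_fun this a
  · rw [eq_top_iff]
    intro v _
    refine mem_of_x (fun j _ => ?_) v
    refine Subgroup.mem_iSup_of_mem (decide (j + 1 < n)) ?_
    simpa using x_mem_split j

/-- The product of the first `m` generators. -/
def D : ℕ → F n
  | 0 => 1
  | m + 1 => D m * x m

lemma D_succ (m : ℕ) : (D (m + 1) : F n) = D m * x m := rfl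

lemma xe_x {j k : ℕ} (hk : k < n) : xe j (x k : F n) = .ofAdd (if k = j then 1 else 0) := by
  rw [xe, flift_x _ hk]
  split_ifs <;> rfl

lemma xe_D {m : ℕ} (hm : m ≤ n) (j : ℕ) : xe j (D m : F n) = .ofAdd (if j < m then 1 else 0) := by
  induction m with
  | zero => simp [D]
  | succ m ih =>
    rw [D_succ, map_mul, ih (by omega), xe_x (by omega), ← ofAdd_add]
    congr 1
    split_ifs <;> omega

lemma act_D {i m : ℕ} (hi : i + 1 < n) (him : i + 1 ≠ m) : act (s i) (D m : F n) = D m := by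
  induction m using Nat.strong_induction_on with
  | _ m ih =>
    rcases m with _ | m
    · simp [D]
    · rw [D_succ, map_mul]
      by_cases h1 : i + 1 = m
      · subst h1
        rw [D_succ, map_mul, ih i (by omega) (by omega), act_left hi, act_right hi]
        group
      · rw [ih m (by omega) h1, act_far (by omega) (by omega)]

lemma act_D_self (b : B n) : act b (D n : F n) = D n := by
  have : b ∈ (MulAction.stabilizer (MulAut (F n)) (D n : F n)).comap act := by
    refine mem_of_s (fun i hi => ?_) b
    rw [Subgroup.mem_comap, MulAction.mem_stabilizer_iff]
    exact act_D hi (by omega)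
  exact this

/-- The rotation of the strands `0, …, m`. -/
def dl : ℕ → B n
  | 0 => 1
  | m + 1 => dl m * s m

lemma act_dl_gt {m j : ℕ} (h : m < j) : act (dl m) (x j : F n) = x j := by
  induction m with
  | zero => simp [dl]
  | succ m ih => rw [dl, map_mul, MulAut.mul_apply, act_far (by omega) (by omega), ih (by omega)]

lemma act_dl_lt {m j : ℕ} (hm : m < n) (h : j < m) : act (dl m) (x j : F n) = x (j + 1) := by
  induction m with
  | zero => omega
  | succ m ih =>
    rw [dl, map_mul, MulAut.mul_apply]
    by_cases hj : j = m
    · subst hj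
      rw [act_left hm, act_dl_gt (by omega)]
    · rw [act_far (by omega) (by omega), ih (by omega) (by omega)]

lemma act_dl_D {m k : ℕ} (hm : m < n) (h : m < k) : act (dl m) (D k : F n) = D k := by
  induction m with
  | zero => simp [dl]
  | succ m ih =>
    rw [dl, map_mul, MulAut.mul_apply, act_D (by omega) (by omega), ih (by omega) (by omega)]

lemma act_dl_self {m : ℕ} (hm : m < n) :
    act (dl m) (x m : F n) = (D (m + 1))⁻¹ * x 0 * D (m + 1) := by
  induction m with
  | zero => simp [dl, D]
  | succ m ih =>
    rw [dl, map_mul, MulAut.mul_apply, act_right hm, map_mul, map_mul, map_inv,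
      act_dl_gt (by omega), ih (by omega), D_succ (m + 1)]
    group

lemma act_dl_pow {m k : ℕ} (hm : m < n) (h : k ≤ m) : act (dl m ^ k) (x 0 : F n) = x k := by
  induction k with
  | zero => simp
  | succ k ih =>
    rw [pow_succ', map_mul, MulAut.mul_apply, ih (by omega), act_dl_lt hm (by omega)]

lemma act_dl_pow_D {m k l : ℕ} (hm : m < n) (h : m < k) : act (dl m ^ l) (D k : F n) = D k := by
  induction l with
  | zero => simp
  | succ l ih => rw [pow_succ, map_mul, MulAut.mul_apply, act_dl_D hm h, ih]

/-- The full twist of the strands `0, …, m`. -/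
def tw (m : ℕ) : B n := dl m ^ (m + 1)

lemma act_tw_le {m j : ℕ} (hm : m < n) (hj : j ≤ m) :
    act (tw m) (x j : F n) = (D (m + 1))⁻¹ * x j * D (m + 1) := by
  rw [← act_dl_pow hm hj, ← MulAut.mul_apply, ← map_mul, tw, ← pow_add, add_comm, pow_add,
    pow_succ', map_mul, map_mul, MulAut.mul_apply, MulAut.mul_apply, act_dl_pow hm le_rfl,
    act_dl_self hm, map_mul, map_mul, map_inv, act_dl_pow_D hm (by omega)]

lemma act_tw_gt {m j : ℕ} (h : m < j) : act (tw m) (x j : F n) = x j := by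
  have : ∀ k, act (dl m ^ k) (x j : F n) = x j := by
    intro k
    induction k with
    | zero => simp
    | succ k ih => rw [pow_succ, map_mul, MulAut.mul_apply, act_dl_gt h, ih]
  exact this _

lemma act_tw_D {m k : ℕ} (hm : m < n) (h : m < k) : act (tw m) (D k : F n) = D k :=
  act_dl_pow_D hm h

variable {m : ℕ}

lemma act_tw_true {v : F (m + 2)} (hv : v ∈ split (m + 2) true) :
    act (tw m) v = (D (m + 1))⁻¹ * v * D (m + 1) := by
  have : (act (tw m)).toMonoidHom.eqLocus
      (MulAut.conj (D (m + 1) : F (m + 2))⁻¹).toMonoidHom ≥ split (m + 2) true := by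
    refine (Subgroup.closure_le _).2 ?_
    rintro _ ⟨j, hj, rfl⟩
    have hj : j + 1 < m + 2 := by simpa using hj
    change act (tw m) _ = MulAut.conj _ _
    rw [act_tw_le (by omega) (by omega), MulAut.conj_apply, inv_inv]
  have := this hv
  change act (tw m) _ = MulAut.conj _ _ at this
  rwa [MulAut.conj_apply, inv_inv] at this

lemma act_tw_false {v : F (m + 2)} (hv : v ∈ split (m + 2) false) : act (tw m) v = v := by
  have : (act (tw m)).toMonoidHom.eqLocus (MonoidHom.id (F (m + 2))) ≥ split (m + 2) false := by
    refine (Subgroup.closure_le _).2 ?_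
    rintro _ ⟨j, hj, rfl⟩
    have hj : m + 2 ≤ j + 1 := by simpa using hj
    exact act_tw_gt (by omega)
  exact this hv

lemma D_mem_split : (D (m + 1) : F (m + 2)) ∈ split (m + 2) true := by
  have : ∀ k ≤ m + 1, (D k : F (m + 2)) ∈ split (m + 2) true := by
    intro k hk
    induction k with
    | zero => exact one_mem _
    | succ k ih =>
      refine mul_mem (ih (by omega)) ?_
      have := x_mem_split (n := m + 2) k
      rwa [decide_eq_true (by omega : k + 1 < m + 2)] at this
  exact this _ le_rfl

lemma act_tw_split : ∀ i, ∀ a ∈ split (m + 2) i, act (tw m) a ∈ split (m + 2) i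
  | true, a, ha => by
    rw [act_tw_true ha]
    exact mul_mem (mul_mem (inv_mem D_mem_split) ha) D_mem_split
  | false, a, ha => by rwa [act_tw_false ha]

lemma act_tw_pow {v : F (m + 2)} (hv : v ∈ split (m + 2) true) (k : ℕ) :
    (act (tw m) ^ k) v = (D (m + 1) ^ k)⁻¹ * v * D (m + 1) ^ k := by
  induction k with
  | zero => simp
  | succ k ih =>
    rw [pow_succ', MulAut.mul_apply, ih, map_mul, map_mul, map_inv, map_pow, act_tw_true hv,
      act_tw_D (by omega) (by omega), pow_succ]
    group

/-- The subgroup generated by the product of the first generators and by the last generator. -/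
def Q (m : ℕ) : Subgroup (F (m + 2)) := Subgroup.closure {D (m + 1), x (m + 1)}

lemma mem_Q_of_pow {v : F (m + 2)} {i : Bool} (hv : v ∈ split (m + 2) i) {k : ℕ} (hk : 0 < k)
    (h : (act (tw m) ^ k) v = v) : v ∈ Q m := by
  cases i with
  | true =>
    rw [act_tw_pow hv] at h
    have hc : Commute v (D (m + 1) ^ k) := by
      have := congrArg (D (m + 1) ^ k * ·) h
      simp only [← mul_assoc, mul_inv_cancel, one_mul] at this
      exact this
    have hD : xe 0 (D (m + 1) : F (m + 2)) = .ofAdd 1 := by simp [xe_D]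
    have := mem_zpowers_of_commute_pow hD hk hc
    exact (Subgroup.zpowers_le.2 (Subgroup.subset_closure (by simp))) this
  | false =>
    refine (Subgroup.closure_le _).2 ?_ hv
    rintro _ ⟨j, hj, rfl⟩
    have hj : m + 2 ≤ j + 1 := by simpa using hj
    by_cases h1 : j = m + 1
    · exact Subgroup.subset_closure (by simp [h1])
    · have : (x j : F (m + 2)) = 1 := by
        rw [x, dif_neg (by omega)]
      rw [this]
      exact one_mem _

lemma mem_Q_of_fixed {w : F (m + 2)} (h : act (tw m) w = w) : w ∈ Q m := by
  refine (Subgroup.closure_le _).2 ?_ (mem_closure_fixed (isFreeProd_split _) act_tw_split h)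
  rintro a ⟨i, hi, ha⟩
  exact mem_Q_of_pow hi one_pos (by rwa [pow_one])

lemma fixed_of_mem_Q {w : F (m + 2)} (h : w ∈ Q m) : act (tw m) w = w := by
  have : (act (tw m)).toMonoidHom.eqLocus (MonoidHom.id (F (m + 2))) ≥ Q m := by
    refine (Subgroup.closure_le _).2 ?_
    rintro _ (rfl | rfl)
    · exact act_tw_D (by omega) (by omega)
    · exact act_tw_gt (by omega)
  exact this h

lemma conj_mem_of_twist {w g : F (m + 2)} (h : act (tw m) w = g * w * g⁻¹) :
    (∃ h, h * w * h⁻¹ ∈ split (m + 2) true) ∨ ∃ h, h * w * h⁻¹ ∈ Q m := by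
  rcases conj_mem_of_map_conj (isFreeProd_split _) act_tw_split h with ⟨h, i, hi⟩ | ⟨h, hh⟩
  · cases i
    · exact Or.inr ⟨h, mem_Q_of_pow hi one_pos (by rw [pow_one, act_tw_false hi])⟩
    · exact Or.inl ⟨h, hi⟩
  · refine Or.inr ⟨h, (Subgroup.closure_le _).2 ?_ hh⟩
    rintro a ⟨i, hi, k, hk, ha⟩
    exact mem_Q_of_pow hi hk ha

end Splitting

end BraidAut

namespace BraidAut

/-! ### Automorphisms of the free group equivariant for the braid action -/

section Equivariant

variable {n m : ℕ}

/-- The total exponent of an element of the free group. -/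
def xs : F n →* Multiplicative ℤ := flift fun _ => .ofAdd 1

lemma xs_x {j : ℕ} (hj : j < n) : xs (x j : F n) = .ofAdd 1 := flift_x _ hj

lemma xs_act (b : B n) (v : F n) : xs (act b v) = xs v := by
  have : b ∈ ({
      carrier := {b | ∀ v : F n, xs (act b v) = xs v}
      mul_mem' := fun {a b} ha hb v => by
        rw [map_mul, MulAut.mul_apply, ha, hb]
      one_mem' := fun v => by simp
      inv_mem' := fun {a} ha v => by
        rw [← ha (act a⁻¹ v), ← MulAut.mul_apply, ← map_mul]
        simp } : Subgroup (B n)) := by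
    refine mem_of_s (fun i hi => ?_) b
    change ∀ v, _
    have : (xs (n := n)).comp (act (s i)).toMonoidHom = xs := by
      refine fhom_ext fun j hj => ?_
      change xs (act (s i) (x j)) = xs (x j)
      by_cases h1 : j = i
      · subst h1
        rw [act_left hi, xs_x hi, xs_x hj]
      · by_cases h2 : j = i + 1
        · subst h2
          rw [act_right hi, map_mul, map_mul, map_inv, xs_x hj, xs_x (by omega)]
          simp
        · rw [act_far h1 h2]
    exact fun v => DFunLike.congr_fun this v
  exact this v

lemma xs_D {k : ℕ} (hk : k ≤ n) : xs (D k : F n) = .ofAdd (k : ℤ) := by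
  induction k with
  | zero => simp [D]
  | succ k ih => rw [D_succ, map_mul, ih (by omega), xs_x (by omega), ← ofAdd_add]; simp

lemma xe_split_true {v : F (m + 2)} (hv : v ∈ split (m + 2) true) : xe (m + 1) v = 1 := by
  have : (xe (n := m + 2) (m + 1)).ker ≥ split (m + 2) true := by
    refine (Subgroup.closure_le _).2 ?_
    rintro _ ⟨j, hj, rfl⟩
    have hj : j + 1 < m + 2 := by simpa using hj
    change xe _ _ = 1
    rw [xe_x (by omega), if_neg (by omega), ofAdd_zero]
  exact this hv

lemma xe_Q (hm : 1 ≤ m) {v : F (m + 2)} (hv : v ∈ Q m) : xe 0 v = xe m v := by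
  have : (xe (n := m + 2) 0).eqLocus (xe m) ≥ Q m := by
    refine (Subgroup.closure_le _).2 ?_
    rintro _ (rfl | rfl)
    · change xe _ _ = xe _ _
      rw [xe_D (by omega), xe_D (by omega), if_pos (by omega), if_pos (by omega)]
    · change xe _ _ = xe _ _
      rw [xe_x (by omega), xe_x (by omega), if_neg (by omega), if_neg (by omega)]
  exact this hv

/-- The retraction of the free group sending `x 0` to `1` and fixing the product of the
generators. -/
def retr : F n →* F n := flift fun j => if j = 0 then 1 else if j = 1 then x 0 * x 1 else x j

lemma retr_x {j : ℕ} (hj : j < n) (h : 2 ≤ j) : retr (x j : F n) = x j := by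
  rw [retr, flift_x _ hj, if_neg (by omega), if_neg (by omega)]

lemma retr_zero (hn : 0 < n) : retr (x 0 : F n) = 1 := by
  rw [retr, flift_x _ hn, if_pos rfl]

lemma retr_D {k : ℕ} (hk : k ≤ n) (h : 2 ≤ k) : retr (D k : F n) = D k := by
  induction k, h using Nat.le_induction with
  | base =>
    rw [D_succ, D_succ, map_mul, map_mul, retr_zero (by omega), retr, flift_x _ (by omega)]
    simp [D]
  | succ k h ih => rw [D_succ, map_mul, ih (by omega), retr_x (by omega) h]

lemma retr_Q (hm : 1 ≤ m) {v : F (m + 2)} (hv : v ∈ Q m) : retr v = v := by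
  have : (retr (n := m + 2)).eqLocus (MonoidHom.id _) ≥ Q m := by
    refine (Subgroup.closure_le _).2 ?_
    rintro _ (rfl | rfl)
    · exact retr_D (by omega) (by omega)
    · exact retr_x (by omega) (by omega)
  exact this hv

lemma retr_act_dl_mem (hm : 1 ≤ m) {v : F (m + 2)} (hv : v ∈ Q m) :
    retr (act (dl (m + 1)) v) ∈ Subgroup.zpowers (D (m + 2) : F (m + 2)) := by
  have hy : retr (act (dl (m + 1)) (x (m + 1) : F (m + 2))) = 1 := by
    rw [act_dl_self (by omega), map_mul, map_mul, retr_zero (by omega), map_inv]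
    group
  have : (Subgroup.zpowers (D (m + 2) : F (m + 2))).comap
      (retr.comp (act (dl (m + 1))).toMonoidHom) ≥ Q m := by
    refine (Subgroup.closure_le _).2 ?_
    rintro _ (rfl | rfl)
    · change retr (act (dl (m + 1)) (D (m + 1))) ∈ Subgroup.zpowers (D (m + 2) : F (m + 2))
      have : (D (m + 1) : F (m + 2)) = D (m + 2) * (x (m + 1))⁻¹ := by rw [D_succ (m + 1)]; group
      rw [this, map_mul, map_mul, map_inv, map_inv, hy, act_dl_D (by omega) (by omega),
        retr_D le_rfl (by omega)]
      simp
    · change retr (act (dl (m + 1)) (x (m + 1))) ∈ Subgroup.zpowers (D (m + 2) : F (m + 2))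
      rw [hy]
      exact one_mem _
  exact this hv

section Twisted

variable {α : MulAut (F (m + 2))} {u : B (m + 2) → F (m + 2)}
  (hx : ∀ j < m + 2, ∀ v, xe j (α v) = xe j v)
  (hu : ∀ b v, α (act b v) = u b * act b (α v) * (u b)⁻¹)

include hx hu

lemma exists_map_D (hm : 1 ≤ m) : ∃ v, α (D (m + 2)) = v * D (m + 2) * v⁻¹ := by
  have h1 := hu (tw m) (D (m + 2))
  rw [act_D_self] at h1
  have h2 : act (tw m) (α (D (m + 2))) = (u (tw m))⁻¹ * α (D (m + 2)) * (u (tw m))⁻¹⁻¹ := by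
    nth_rewrite 2 [h1]
    group
  rcases conj_mem_of_twist h2 with ⟨h, hh⟩ | ⟨h, hh⟩
  · have h3 := xe_split_true hh
    rw [map_mul, map_mul, map_inv, hx _ (by omega), xe_D le_rfl, if_pos (by omega),
      mul_inv_cancel_comm] at h3
    exact absurd h3 (by decide)
  · have h3 := hu (dl (m + 1)) (D (m + 2))
    rw [act_D_self] at h3
    set w := h * α (D (m + 2)) * h⁻¹ with hw
    obtain ⟨k, hk⟩ := retr_act_dl_mem hm hh
    have hα : α (D (m + 2)) = h⁻¹ * w * h := by rw [hw]; group
    have h4 : w = (h * u (dl (m + 1)) * (act (dl (m + 1)) h)⁻¹) * act (dl (m + 1)) w *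
        (h * u (dl (m + 1)) * (act (dl (m + 1)) h)⁻¹)⁻¹ := by
      rw [hα] at h3
      conv_lhs => rw [hw, hα, h3]
      simp only [map_mul, map_inv]
      group
    have h5 := congrArg retr h4
    rw [retr_Q hm hh, map_mul, map_mul, map_inv, ← hk] at h5
    refine ⟨h⁻¹ * retr (h * u (dl (m + 1)) * (act (dl (m + 1)) h)⁻¹), ?_⟩
    have h6 : k = 1 := by
      have h7 := congrArg (xe 0) hα
      rw [h5, hx _ (by omega)] at h7
      simp only [map_mul, map_inv, map_zpow, xe_D (le_refl (m + 2)), mul_inv_cancel_comm,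
        inv_mul_cancel_comm] at h7
      have := congrArg Multiplicative.toAdd h7
      simp at this
      omega
    rw [hα, h5, h6]
    group

lemma exists_eq_mul_inv (hm : 1 ≤ m) (hs : ∀ b, xs (u b) = 1) :
    ∃ v, α (D (m + 2)) = v * D (m + 2) * v⁻¹ ∧ ∀ b, u b = v * (act b v)⁻¹ := by
  obtain ⟨v, hv⟩ := exists_map_D hx hu hm
  refine ⟨v, hv, fun b => ?_⟩
  have h1 := hu b (D (m + 2))
  rw [act_D_self, hv] at h1
  simp only [map_mul, map_inv, act_D_self] at h1
  have h2 : v⁻¹ * u b * act b v = 1 := by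
    refine eq_one_of_commute (f := xs) (g := D (m + 2)) ?_ ?_ ?_
    · change _ = _
      calc _ = v⁻¹ * (u b * (act b v * D (m + 2) * (act b v)⁻¹) * (u b)⁻¹) * u b * act b v := by
            group
        _ = _ := by rw [← h1]; group
    · rw [xs_D le_rfl]
      simp only [ne_eq, ofAdd_eq_one]
      omega
    · simp [hs, xs_act]
  calc u b = v * (v⁻¹ * u b * act b v) * (act b v)⁻¹ := by group
    _ = _ := by rw [h2, mul_one]

end Twisted

/-- The retraction of the free group fixing `x 1, x 2, …` and sending the product of the
generators to `1`. -/
def quot : F n →* F n := flift fun j => if j = 0 then (D n)⁻¹ * x 0 else x j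

lemma quot_x {j : ℕ} (h : 1 ≤ j) : quot (x j : F n) = x j := by
  by_cases hj : j < n
  · rw [quot, flift_x _ hj, if_neg (by omega)]
  · simp [x, hj]

lemma quot_D (hn : 1 ≤ n) : quot (D n : F n) = 1 := by
  have : ∀ k, 1 ≤ k → quot ((x 0)⁻¹ * D k : F n) = (x 0)⁻¹ * D k := by
    intro k hk
    induction k, hk using Nat.le_induction with
    | base => simp [D]
    | succ k h ih => rw [D_succ, ← mul_assoc, map_mul, ih, quot_x h]
  have h1 := this n hn
  have h2 : quot (x 0 : F n) = (D n)⁻¹ * x 0 := by rw [quot, flift_x _ hn, if_pos rfl]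
  rw [map_mul, map_inv, h2] at h1
  calc quot (D n : F n) = (D n)⁻¹ * x 0 * (((D n)⁻¹ * x 0)⁻¹ * quot (D n)) := by group
    _ = 1 := by rw [h1]; group

lemma quot_Q {v : F (m + 2)} (hv : v ∈ Q m) : quot v ∈ Subgroup.zpowers (x (m + 1) : F (m + 2)) := by
  have hy : quot (x (m + 1) : F (m + 2)) = x (m + 1) := quot_x (by omega)
  have : (Subgroup.zpowers (x (m + 1) : F (m + 2))).comap quot ≥ Q m := by
    refine (Subgroup.closure_le _).2 ?_
    rintro _ (rfl | rfl)
    · change quot (D (m + 1)) ∈ Subgroup.zpowers (x (m + 1) : F (m + 2))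
      have : (D (m + 1) : F (m + 2)) = D (m + 2) * (x (m + 1))⁻¹ := by rw [D_succ (m + 1)]; group
      rw [this, map_mul, map_inv, hy, quot_D (by omega)]
      simp
    · change quot (x (m + 1)) ∈ Subgroup.zpowers (x (m + 1) : F (m + 2))
      rw [hy]
      simp
  exact this hv

lemma quot_act_dl {v : F (m + 2)} (hv : v ∈ split (m + 2) true) :
    quot (act (dl (m + 1)) v) = act (dl (m + 1)) v := by
  have : (quot.comp (act (dl (m + 1))).toMonoidHom).eqLocus
      (act (dl (m + 1)) : MulAut (F (m + 2))).toMonoidHom ≥ split (m + 2) true := by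
    refine (Subgroup.closure_le _).2 ?_
    rintro _ ⟨j, hj, rfl⟩
    have hj : j + 1 < m + 2 := by simpa using hj
    change quot (act (dl (m + 1)) _) = act (dl (m + 1)) _
    rw [act_dl_lt (by omega) (by omega), quot_x (by omega)]
  exact this hv

/-- The embedding of the free group of rank two with range `Q m`. -/
def emb (m : ℕ) : F 2 →* F (m + 2) := flift fun j => if j = 0 then D (m + 2) else x (m + 1)

lemma emb_zero : emb m (x 0) = D (m + 2) := flift_x _ (by omega)

lemma emb_one : emb m (x 1) = x (m + 1) := flift_x _ (by omega)

lemma D_mem_Q : (D (m + 2) : F (m + 2)) ∈ Q m :=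
  mul_mem (Subgroup.subset_closure (by simp)) (Subgroup.subset_closure (by simp))

lemma emb_mem (v : F 2) : emb m v ∈ Q m := by
  have : v ∈ (Q m).comap (emb m) := by
    refine mem_of_x (fun j hj => ?_) v
    rw [Subgroup.mem_comap]
    interval_cases j
    · rw [emb_zero]
      exact D_mem_Q
    · rw [emb_one]
      exact Subgroup.subset_closure (by simp)
  exact this

lemma exists_emb {w : F (m + 2)} (hw : w ∈ Q m) : ∃ v, emb m v = w := by
  have : Q m ≤ (emb m).range := by
    refine (Subgroup.closure_le _).2 ?_
    rintro _ (rfl | rfl)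
    · refine ⟨x 0 * (x 1)⁻¹, ?_⟩
      rw [map_mul, map_inv, emb_zero, emb_one, D_succ (m + 1)]
      group
    · exact ⟨x 1, emb_one⟩
  exact this hw

/-- A left inverse of `emb m`. -/
def embInv (m : ℕ) : F (m + 2) →* F 2 :=
  flift fun j => if j = 0 then x 0 * (x 1)⁻¹ else if j = m + 1 then x 1 else 1

lemma embInv_last : embInv m (x (m + 1)) = x 1 := by
  rw [embInv, flift_x _ (by omega), if_neg (by omega), if_pos rfl]

lemma embInv_D : embInv m (D (m + 2)) = x 0 := by
  have : ∀ k, 1 ≤ k → k ≤ m + 1 → embInv m (D k) = x 0 * (x 1)⁻¹ := by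
    intro k hk
    induction k, hk using Nat.le_induction with
    | base =>
      intro _
      rw [D_succ, D, one_mul, embInv, flift_x _ (by omega), if_pos rfl]
    | succ k h ih =>
      intro hk
      rw [D_succ, map_mul, ih (by omega), embInv, flift_x _ (by omega), if_neg (by omega),
        if_neg (by omega), mul_one]
  rw [D_succ, map_mul, this _ (by omega) le_rfl, embInv_last]
  group

lemma embInv_emb (v : F 2) : embInv m (emb m v) = v := by
  have : (embInv m).comp (emb m) = MonoidHom.id _ := by
    refine fhom_ext fun j hj => ?_
    change embInv m (emb m _) = _
    interval_cases j
    · rw [emb_zero, embInv_D, MonoidHom.id_apply]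
    · rw [emb_one, embInv_last, MonoidHom.id_apply]
  exact DFunLike.congr_fun this v

lemma split_two_true {v : F 2} (hv : v ∈ split 2 true) : v ∈ Subgroup.zpowers (x 0 : F 2) := by
  refine (Subgroup.closure_le _).2 ?_ hv
  rintro _ ⟨j, hj, rfl⟩
  have hj : j + 1 < 2 := of_decide_eq_true hj
  obtain rfl : j = 0 := by omega
  simp

lemma split_two_false {v : F 2} (hv : v ∈ split 2 false) : v ∈ Subgroup.zpowers (x 1 : F 2) := by
  refine (Subgroup.closure_le _).2 ?_ hv
  rintro _ ⟨j, hj, rfl⟩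
  have hj : ¬ j + 1 < 2 := of_decide_eq_false hj
  by_cases h : j = 1
  · simp [h]
  · have : (x j : F 2) = 1 := by rw [x, dif_neg (by omega)]
    rw [this]
    exact one_mem _

section Commuting

variable {α : MulAut (F (m + 2))} (hx : ∀ j < m + 2, ∀ v, xe j (α v) = xe j v)
  (hα : ∀ b v, α (act b v) = act b (α v))

include hα in
lemma map_mem_Q {w : F (m + 2)} (hw : w ∈ Q m) : α w ∈ Q m :=
  mem_Q_of_fixed (by rw [← hα, fixed_of_mem_Q hw])

include hα in
lemma symm_map_mem_Q {w : F (m + 2)} (hw : w ∈ Q m) : α.symm w ∈ Q m := by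
  refine mem_Q_of_fixed (α.injective ?_)
  rw [hα, MulEquiv.apply_symm_apply, fixed_of_mem_Q hw]

lemma x_mem_Q : (x (m + 1) : F (m + 2)) ∈ Q m := Subgroup.subset_closure (by simp)

include hx hα in
lemma exists_map_last (hm : 1 ≤ m) : ∃ h, α (x (m + 1)) = h * x (m + 1) * h⁻¹ := by
  have h1 : act (tw m) (α (x m)) = (α (D (m + 1)))⁻¹ * α (x m) * (α (D (m + 1)))⁻¹⁻¹ := by
    rw [← hα, act_tw_le (by omega) le_rfl, map_mul, map_mul, map_inv, inv_inv]
  rcases conj_mem_of_twist h1 with ⟨h, hh⟩ | ⟨h, hh⟩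
  · set d : MulAut (F (m + 2)) := act (dl (m + 1)) with hd
    have h2 : α (x (m + 1)) = d (α (x m)) := by
      rw [hd, ← hα, act_dl_lt (by omega) (by omega)]
    have h3 := quot_act_dl hh
    simp only [← hd, map_mul, map_inv, ← h2] at h3
    obtain ⟨k, hk⟩ := quot_Q (map_mem_Q hα x_mem_Q)
    rw [← hk] at h3
    have h4 : α (x (m + 1)) =
        ((d h)⁻¹ * quot (d h)) * x (m + 1) ^ k * ((d h)⁻¹ * quot (d h))⁻¹ := by
      calc _ = (d h)⁻¹ * (d h * α (x (m + 1)) * (d h)⁻¹) * d h := by group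
        _ = _ := by rw [← h3]; group
    have h6 : k = 1 := by
      have h7 := congrArg (xe (m + 1)) h4
      rw [hx _ (by omega), map_mul, map_mul, map_inv, map_zpow, xe_x (by omega), if_pos rfl,
        mul_inv_cancel_comm] at h7
      have := congrArg Multiplicative.toAdd h7
      simp at this
      omega
    rw [h6, zpow_one] at h4
    exact ⟨_, h4⟩
  · have h2 := xe_Q hm hh
    simp only [map_mul, map_inv, mul_inv_cancel_comm] at h2
    rw [hx _ (by omega), hx _ (by omega), xe_x (by omega), xe_x (by omega), if_pos rfl,
      if_neg (by omega)] at h2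
    exact absurd h2 (by decide)

include hx hα in
lemma exists_zpow_conj (hm : 1 ≤ m) (hD : α (D (m + 2)) = D (m + 2)) :
    ∃ k : ℤ, ∀ w, α w = D (m + 2) ^ k * w * (D (m + 2) ^ k)⁻¹ := by
  obtain ⟨h, hh⟩ := exists_map_last hx hα hm
  obtain ⟨z, hz⟩ := exists_emb (map_mem_Q hα (x_mem_Q (m := m)))
  have hz1 : z = embInv m h * x 1 * (embInv m h)⁻¹ := by
    rw [← embInv_emb (m := m) z, hz, hh, map_mul, map_mul, map_inv, embInv_last]
  have htop : Subgroup.closure ((split 2 true : Set (F 2)) ∪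
      {v | ∃ b ∈ split 2 false, v = embInv m h * b * (embInv m h)⁻¹}) = ⊤ := by
    rw [eq_top_iff]
    intro w _
    set R := Subgroup.closure ((split 2 true : Set (F 2)) ∪
      {v | ∃ b ∈ split 2 false, v = embInv m h * b * (embInv m h)⁻¹})
    obtain ⟨w', hw'⟩ := exists_emb (symm_map_mem_Q hα (emb_mem (m := m) w))
    have h1 : embInv m (α (emb m w')) = w := by
      rw [hw', MulEquiv.apply_symm_apply, embInv_emb]
    have h2 : w' ∈ R.comap ((embInv m).comp (α.toMonoidHom.comp (emb m))) := by
      refine mem_of_x (fun j hj => ?_) w'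
      change embInv m (α (emb m _)) ∈ R
      interval_cases j
      · rw [emb_zero, hD, embInv_D]
        exact Subgroup.subset_closure (Or.inl (by simpa using x_mem_split (n := 2) 0))
      · rw [emb_one, ← hz, embInv_emb, hz1]
        exact Subgroup.subset_closure (Or.inr ⟨x 1, by simpa using x_mem_split (n := 2) 1, rfl⟩)
    rw [← h1]
    exact h2
  obtain ⟨a, ha, b, hb, hab⟩ := eq_mul_of_closure_eq_top (isFreeProd_split 2) htop
  obtain ⟨k, rfl⟩ := split_two_true ha
  obtain ⟨l, rfl⟩ := split_two_false hb
  have hz2 : z = x 0 ^ k * x 1 * (x 0 ^ k)⁻¹ := by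
    rw [hz1, hab]
    group
  have hlast : α (x (m + 1)) = D (m + 2) ^ k * x (m + 1) * (D (m + 2) ^ k)⁻¹ := by
    rw [← hz, hz2, map_mul, map_mul, map_inv, map_zpow, emb_zero, emb_one]
  refine ⟨k, fun w => ?_⟩
  have hzero : α (x 0) = D (m + 2) ^ k * x 0 * (D (m + 2) ^ k)⁻¹ := by
    refine (act (dl (m + 1) ^ (m + 1)) : MulAut (F (m + 2))).injective ?_
    rw [← hα, map_mul, map_mul, map_inv, map_zpow, act_D_self, act_dl_pow (by omega) le_rfl, hlast]
  have : α.toMonoidHom = (MulAut.conj (D (m + 2) ^ k)).toMonoidHom := by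
    refine fhom_ext fun j hj => ?_
    change α _ = D (m + 2) ^ k * x j * (D (m + 2) ^ k)⁻¹
    rw [← act_dl_pow (m := m + 1) (k := j) (by omega) (by omega), hα, hzero, map_mul, map_mul,
      map_inv, map_zpow, act_D_self]
  exact DFunLike.congr_fun this w

end Commuting

/-- A twisted-equivariant automorphism of the free group acting trivially on the abelianization
is inner, and so is its twisting cocycle. -/
theorem exists_conj_of_twisted (hm : 1 ≤ m) {α : MulAut (F (m + 2))} {u : B (m + 2) → F (m + 2)}
    (hx : ∀ j < m + 2, ∀ v, xe j (α v) = xe j v)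
    (hu : ∀ b v, α (act b v) = u b * act b (α v) * (u b)⁻¹) (hs : ∀ b, xs (u b) = 1) :
    ∃ v, (∀ w, α w = v * w * v⁻¹) ∧ ∀ b, u b = v * (act b v)⁻¹ := by
  obtain ⟨v, hD, hv⟩ := exists_eq_mul_inv hx hu hm hs
  obtain ⟨k, hk⟩ := exists_zpow_conj (α := MulAut.conj v⁻¹ * α) (m := m)
    (fun j hj w => by simp [hx j hj]) (fun b w => by simp [hu, hv, mul_assoc]) hm
    (by simp [hD, mul_assoc])
  refine ⟨v * D (m + 2) ^ k, fun w => ?_, fun b => ?_⟩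
  · have := hk w
    simp only [MulAut.mul_apply, MulAut.conj_apply] at this
    calc α w = v * (v⁻¹ * α w * v⁻¹⁻¹) * v⁻¹ := by group
      _ = _ := by rw [this]; group
  · rw [hv, map_mul, map_zpow, act_D_self]
    group

end Equivariant

end BraidAut

namespace BraidAut

/-! ### Automorphisms acting trivially on the symmetric group and on the abelianized pure group -/

section Pure

variable {n N : ℕ}

lemma eq_one_of_le_one (hn : n ≤ 1) (b : B n) : b = 1 :=
  Subgroup.mem_bot.1 (mem_of_s (fun i hi => by omega) b)

lemma pure_apply {p : B n} (hp : π p = 1) (q : ℕ) : π p q = q := by rw [hp, Equiv.Perm.one_apply]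

lemma un_mul {a b : B (n + 1)} (ha : π a n = n) (hb : π b n = n) :
    un (a * b) = un a * un b := by
  apply ι_injective
  rw [map_mul, ι_un, ι_un, ι_un] <;> simp [ha, hb]

lemma π_un {b : B (n + 1)} (hb : π b n = n) : π (un b).right = π b := by
  rw [← π_ι, ι_un hb]

lemma c_un {b : B (n + 1)} (hb : π b n = n) {q r : ℕ} (hq : q < n) (hr : r < n) :
    c (un b).right q r = c b q r := by
  rw [← c_ι _ hq hr, ι_un hb]

lemma eq_fr_mul_up {b : B (n + 1)} (hb : π b n = n) :
    b = fr (un b).left * up (un b).right := by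
  conv_lhs => rw [← ι_un hb, ← SemidirectProduct.inl_left_mul_inr_right (un b), map_mul, ι_inl, ι_inr]

lemma fr_injective : Function.Injective (fr (n := n)) := fun a b h => by
  rw [← ι_inl, ← ι_inl] at h
  exact SemidirectProduct.inl_injective (ι_injective h)

/-- Forgetting the last strand of a pure braid. -/
def forget : (π (n := n + 1)).ker →* B n where
  toFun p := (un p.1).right
  map_one' := by simp [un]
  map_mul' a b := by
    rw [Subgroup.coe_mul, un_mul (pure_apply a.2 n) (pure_apply b.2 n), SemidirectProduct.mul_right]

lemma c_fr_last_eq {v : F n} {q : ℕ} (hq : q < n) {k : ℤ} (h : c (fr v : B (n + 1)) q n = 2 * k) :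
    xe q v = .ofAdd k := by
  rw [c_fr_last v hq] at h
  apply Multiplicative.toAdd.injective
  rw [toAdd_ofAdd]
  omega

/-- A homomorphism from a pure braid group compatible with the crossing numbers kills the
generators involving the remaining strands. -/
theorem map_A_eq_one : ∀ (k : ℕ) (h : (π (n := N)).ker →* B k), (∀ p, π (h p) = 1) →
    (∀ p q r, q < k → r < k → c (h p) q r = c p.1 q r) →
    ∀ i j (hij : i < j) (hj : j < N), k ≤ j → h ⟨A i j, π_A hij hj⟩ = 1 := by
  intro k
  induction k with
  | zero => exact fun h _ _ i j _ _ _ => eq_one_of_le_one (by omega) _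
  | succ k ih =>
    intro h hp hc i j hij hj hkj
    rcases Nat.eq_zero_or_pos k with rfl | hk0
    · exact eq_one_of_le_one (by omega) _
    have hfr : ∀ i j (hij : i < j) (hj : j < N), k ≤ j →
        ∃ v : F k, h ⟨A i j, π_A hij hj⟩ = fr v ∧
          ∀ q < k, xe q v = .ofAdd (pr i j q k) := by
      intro i j hij hj hkj
      have hpk : ∀ p, π (h p) k = k := fun p => by rw [hp, Equiv.Perm.one_apply]
      have h1 := ih (forget.comp (h.codRestrict π.ker fun p => MonoidHom.mem_ker.2 (hp p)))
        (fun p => (π_un (hpk p)).trans (hp p))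
        (fun p q r hq hr => (c_un (hpk p) hq hr).trans (hc p q r (by omega) (by omega)))
        i j hij hj hkj
      have h2 := eq_fr_mul_up (b := h ⟨A i j, π_A hij hj⟩) (by simp [hp])
      change (un (h ⟨A i j, π_A hij hj⟩)).right = 1 at h1
      rw [h1, map_one, mul_one] at h2
      refine ⟨_, h2, fun q hq => c_fr_last_eq hq ?_⟩
      rw [← h2, hc _ _ _ (by omega) (by omega), c_A hij hj]
    obtain ⟨k, rfl⟩ := Nat.exists_eq_add_of_le' hk0
    have hX := π_A (m := N) (i := k) (j := k + 1) (by omega) (by omega)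
    obtain ⟨v, hv, hv1⟩ := hfr k (k + 1) (by omega) (by omega) le_rfl
    have hvk : xe k v ≠ 1 := by
      rw [hv1 k (by omega)]
      simp [pr]
    have key : ∀ i j (hij : i < j) (hj : j < N), k + 1 < j → ∀ w : F (k + 1),
        h ⟨A i j, π_A hij hj⟩ = fr w → xe k w = 1 := by
      intro i j hij hj hkj w hw
      obtain ⟨w', hw', hx⟩ := hfr i j hij hj (by omega)
      obtain rfl : w = w' := fr_injective (hw.symm.trans hw')
      rw [hx k (by omega), pr, if_neg (by omega), ofAdd_zero]
    by_cases hik : i = k ∨ i = k + 1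
    · have hW := π_A (m := N) (i := k) (j := j) (by omega) (by omega)
      have hV := π_A (m := N) (i := k + 1) (j := j) (by omega) (by omega)
      obtain ⟨w, hw, -⟩ := hfr k j (by omega) hj (by omega)
      obtain ⟨y, hy, -⟩ := hfr (k + 1) j (by omega) hj (by omega)
      have hL := conj_A_left (m := N) (i := k) hj (by omega)
      have hR := conj_A_right (m := N) (i := k) hj (by omega)
      have e1 : (s k ^ 2 * A k j * (s k ^ 2)⁻¹ : B N) =
          (A (k + 1) j)⁻¹ * A k j * A (k + 1) j := by
        rw [← hR, ← hL]
        simp only [pow_two, mul_inv_rev, mul_assoc]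
      have e2 : (s k ^ 2 * (A k j * A (k + 1) j) : B N) = A k j * A (k + 1) j * s k ^ 2 := by
        have : (s k * (A k j * A (k + 1) j) * (s k)⁻¹ : B N) = A k j * A (k + 1) j := by
          calc (s k * (A k j * A (k + 1) j) * (s k)⁻¹ : B N) =
              (s k * A k j * (s k)⁻¹) * (s k * A (k + 1) j * (s k)⁻¹) := by group
            _ = _ := by rw [hL, hR]; group
        have h3 : Commute (s k : B N) (A k j * A (k + 1) j) := mul_inv_eq_iff_eq_mul.1 this
        exact h3.pow_left 2
      rw [← A_self] at e1 e2
      have e1' := congrArg h (Subtype.ext e1 : (⟨A k (k + 1), hX⟩ * ⟨A k j, hW⟩ *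
        ⟨A k (k + 1), hX⟩⁻¹ : (π (n := N)).ker) = ⟨A (k + 1) j, hV⟩⁻¹ * ⟨A k j, hW⟩ *
        ⟨A (k + 1) j, hV⟩)
      have e2' := congrArg h (Subtype.ext e2 : (⟨A k (k + 1), hX⟩ * (⟨A k j, hW⟩ *
        ⟨A (k + 1) j, hV⟩) : (π (n := N)).ker) = ⟨A k j, hW⟩ * ⟨A (k + 1) j, hV⟩ *
        ⟨A k (k + 1), hX⟩)
      simp only [map_mul, map_inv, hv, hw, hy] at e1' e2'
      simp only [← map_mul, ← map_inv] at e1' e2'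
      have e1 := fr_injective e1'
      have e2 := fr_injective e2'
      have hwk := key k j (by omega) hj (by omega) w hw
      have hyk := key (k + 1) j (by omega) hj (by omega) y hy
      have hwy : w * y = 1 := eq_one_of_commute (show Commute (w * y) v from e2.symm) hvk
        (by rw [map_mul, hwk, hyk, mul_one])
      obtain rfl : y = w⁻¹ := eq_inv_of_mul_eq_one_right hwy
      have hw1 : w = 1 := by
        refine eq_one_of_commute (g := v) (f := xe k) ?_ hvk hwk
        have : v * w * v⁻¹ = w := by
          rw [e1]
          group
        exact (mul_inv_eq_iff_eq_mul.1 this).symm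
      subst hw1
      rcases hik with rfl | rfl
      · rw [hw, map_one]
      · rw [hy, inv_one, map_one]
    · obtain ⟨w, hw, -⟩ := hfr i j hij hj (by omega)
      have hc : Commute (A i j : B N) (A k (k + 1)) := by
        rw [A_self]
        refine Commute.pow_right (Commute.symm ?_) 2
        rcases Nat.lt_or_ge i k with h1 | h1
        · exact A_comm_of_mem hj h1 (by omega)
        · exact A_comm_of_lt hij (by omega)
      have := congrArg h (Subtype.ext hc.eq : (⟨A i j, π_A hij hj⟩ * ⟨A k (k + 1), hX⟩ :
        (π (n := N)).ker) = ⟨A k (k + 1), hX⟩ * ⟨A i j, π_A hij hj⟩)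
      rw [map_mul, map_mul, hv, hw, ← map_mul, ← map_mul] at this
      rw [hw, eq_one_of_commute (fr_injective this) hvk (key i j hij hj (by omega) w hw), map_one]

/-- A braid in the center of the pure braid group with a vanishing crossing number is trivial. -/
lemma eq_one_of_pure_central (hn : 2 ≤ n) (p : B n) (hp : π p = 1)
    (hc : ∀ q, π q = 1 → Commute q p) (h0 : c p 0 1 = 0) : p = 1 := by
  induction n, hn using Nat.le_induction with
  | base =>
    have : p ∈ Subgroup.zpowers (s 0) := mem_of_s (fun i hi => by
      obtain rfl : i = 0 := by omega
      exact Subgroup.mem_zpowers _) p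
    obtain ⟨k, rfl⟩ := this
    have := sum_c (s 0 ^ k : B 2)
    simp [Finset.sum_range_succ, c_self, c_symm _ 1 0, h0, ex_s] at this
    simp [this]
  | succ n hn ih =>
    have h1 := eq_fr_mul_up (b := p) (by simp [hp])
    have hr : (un p).right = 1 := by
      refine ih _ ((π_un (by simp [hp])).trans hp) (fun q hq => ?_) ?_
      · have := hc (up q) (by rw [π_up, hq])
        have h2 := un_mul (a := up q) (b := p) (by simp [π_up, hq]) (by simp [hp])
        rw [this.eq, un_mul (by simp [hp]) (by simp [π_up, hq]), ← ι_inr, un_ι] at h2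
        exact (congrArg SemidirectProduct.right h2).symm
      · rw [c_un (by simp [hp]) (by omega) (by omega), h0]
    rw [hr, map_one, mul_one] at h1
    have : (un p).left = 1 := by
      refine freeGroup_center_eq_one (a := (⟨0, by omega⟩ : Fin n)) (b := ⟨1, by omega⟩)
        (by simp) fun w => ?_
      have := hc (fr w) (π_fr w)
      rw [h1] at this
      refine fr_injective ?_
      rw [map_mul, map_mul]
      exact this
    rw [h1, this, map_one]

end Pure

end BraidAut

namespace BraidAut

section IA

variable {n : ℕ}

/-- Automorphisms of the braid group acting trivially on the symmetric group and on the
crossing numbers of pure braids. -/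
structure IsIA (φ : MulAut (B n)) : Prop where
  perm (b : B n) : π (φ b) = π b
  cross (p : B n) (hp : π p = 1) (q r : ℕ) : c (φ p) q r = c p q r

lemma IsIA.symm {φ : MulAut (B n)} (h : IsIA φ) : IsIA φ⁻¹ where
  perm b := by
    have := h.perm (φ⁻¹ b)
    rwa [MulAut.apply_inv_self, eq_comm] at this
  cross p hp q r := by
    have hp' : π (φ⁻¹ p) = 1 := by rw [← h.perm, MulAut.apply_inv_self, hp]
    have := h.cross (φ⁻¹ p) hp' q r
    rwa [MulAut.apply_inv_self, eq_comm] at this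

lemma IsIA.conj_mul {φ : MulAut (B n)} (h : IsIA φ) {g : B n} (hg : π g = 1) :
    IsIA (MulAut.conj g * φ) where
  perm b := by simp [hg, h.perm]
  cross p hp q r := by
    rw [MulAut.mul_apply, MulAut.conj_apply, c_conj _ (by rw [h.perm, hp]), h.cross p hp, hg]
    simp

lemma IsIA.ex {φ : MulAut (B n)} (h : IsIA φ) (b : B n) : ex (φ b) = ex b := by
  have hs : (e (n := n)).comp φ.toMonoidHom = e := by
    refine hom_ext fun i hi => ?_
    have h1 := sum_c (φ (s i ^ 2))
    simp only [h.cross _ (π_sq hi)] at h1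
    rw [sum_c, map_pow, ex_pow, ex_pow] at h1
    apply Multiplicative.toAdd.injective
    change BraidAut.ex (φ (s i)) = BraidAut.ex (s i)
    push_cast at h1
    omega
  exact congrArg Multiplicative.toAdd (DFunLike.congr_fun hs b)

lemma ex_A {i j : ℕ} (hij : i < j) (hj : j < n) : ex (A i j : B n) = 2 := by
  refine A_induction (p := fun j a => j < n → ex a = 2) ?_ ?_ hij hj
  · intro h
    simp [ex_s h]
  · intro j h1 h2 h3
    simp [h2 (by omega)]

lemma ex_fr (v : F n) : ex (fr v) = 2 * (xs v).toAdd := by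
  have hs : (e (n := n + 1)).comp fr = xs ^ 2 := by
    refine fhom_ext fun i hi => ?_
    apply Multiplicative.toAdd.injective
    change ex (fr (x i)) = (xs (x i) ^ 2).toAdd
    rw [fr_x hi, xs_x hi, ex_A hi (by omega)]
    rfl
  have := congrArg Multiplicative.toAdd (DFunLike.congr_fun hs v)
  change ex (fr v) = (xs v ^ 2).toAdd at this
  rw [this, toAdd_pow]
  simp

lemma perm_eq_one (hn : 3 ≤ n) {τ : Equiv.Perm ℕ} (h : ∀ q, n ≤ q → τ q = q)
    (hc : ∀ i, i + 1 < n → Commute τ (Equiv.swap i (i + 1))) : τ = 1 := by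
  have key : ∀ i, i + 1 < n → (τ i = i ∨ τ i = i + 1) ∧ (τ (i + 1) = i ∨ τ (i + 1) = i + 1) := by
    intro i hi
    have h1 := DFunLike.congr_fun (hc i hi).eq i
    have h2 := DFunLike.congr_fun (hc i hi).eq (i + 1)
    have h3 : τ i ≠ τ (i + 1) := τ.injective.ne (by omega)
    simp only [Equiv.Perm.mul_apply, Equiv.swap_apply_left, Equiv.swap_apply_right,
      Equiv.swap_apply_def] at h1 h2
    split_ifs at h1 h2 <;> omega
  have mid : ∀ i, 1 ≤ i → i + 1 < n → τ i = i := by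
    intro i h1 h2
    have h3 := key i h2
    have h4 := key (i - 1) (by omega)
    rw [Nat.sub_add_cancel h1] at h4
    omega
  ext q
  rw [Equiv.Perm.one_apply]
  by_cases h1 : n ≤ q
  · exact h q h1
  · by_cases h2 : 1 ≤ q ∧ q + 1 < n
    · exact mid q h2.1 h2.2
    · rcases Nat.eq_zero_or_pos q with rfl | h3
      · have h4 := key 0 (by omega)
        have h5 : τ 0 ≠ τ 1 := τ.injective.ne (by omega)
        have h6 := mid 1 le_rfl (by omega)
        simp only [zero_add] at h4
        omega
      · have h4 := key (q - 1) (by omega)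
        have h5 : τ (q - 1) ≠ τ q := τ.injective.ne (by omega)
        have h6 := mid (q - 1) (by omega) (by omega)
        rw [Nat.sub_add_cancel h3] at h4
        omega

lemma π_eq_one_of_conj (hn : 3 ≤ n) {g : B n} (h : ∀ b, π (g * b * g⁻¹) = π b) : π g = 1 := by
  refine perm_eq_one hn (fun q hq => π_lt hq) fun i hi => ?_
  have := h (s i)
  rw [map_mul, map_mul, map_inv, π_s hi] at this
  exact mul_inv_eq_iff_eq_mul.1 this

lemma right_un_fr_mul (v : F n) {b : B (n + 1)} (hb : π b n = n) :
    (un (fr v * b)).right = (un b).right := by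
  rw [un_mul (pure_apply (π_fr v) n) hb, ← ι_inl, un_ι]
  simp

section Step

variable {φ : MulAut (B (n + 1))} (h : IsIA φ)

include h

lemma IsIA.right_un_map_fr (v : F n) : (un (φ (fr v))).right = 1 := by
  have hφ : ∀ p : (π (n := n + 1)).ker, φ p.1 ∈ (π (n := n + 1)).ker := fun p => by
    rw [MonoidHom.mem_ker, h.perm, MonoidHom.mem_ker.1 p.2]
  have hf : ∀ v : F n, (fr v : B (n + 1)) ∈ (π (n := n + 1)).ker := π_fr
  set f : (π (n := n + 1)).ker →* B n := forget.comp
    ((φ.toMonoidHom.comp π.ker.subtype).codRestrict π.ker hφ)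
  have hfix : ∀ p : (π (n := n + 1)).ker, π (φ p.1) n = n := fun p => pure_apply (hφ p) n
  have key := map_A_eq_one n f (fun p => (π_un (hfix p)).trans (hφ p))
    (fun p q r hq hr => (c_un (hfix p) hq hr).trans (h.cross _ p.2 _ _))
  have : f.comp (fr.codRestrict π.ker hf) = 1 := by
    refine fhom_ext fun j hj => ?_
    rw [MonoidHom.one_apply, ← key j n hj (by omega) le_rfl, MonoidHom.comp_apply]
    congr 1
    exact Subtype.ext (fr_x hj)
  exact DFunLike.congr_fun this v

lemma IsIA.map_fr (v : F n) : φ (fr v) = fr (un (φ (fr v))).left := by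
  have := eq_fr_mul_up (b := φ (fr v)) (by rw [h.perm, π_fr, Equiv.Perm.one_apply])
  rwa [h.right_un_map_fr, map_one, mul_one] at this

lemma IsIA.fix_up (b : B n) : π (φ (up b)) n = n := by
  rw [h.perm, π_up, π_lt le_rfl]

/-- The automorphism induced on the free normal subgroup. -/
def IsIA.restrict : MulAut (F n) where
  toFun v := (un (φ (fr v))).left
  invFun v := (un (φ⁻¹ (fr v))).left
  left_inv v := by
    apply fr_injective
    change fr (un (φ⁻¹ (fr (un (φ (fr v))).left))).left = fr v
    rw [← h.symm.map_fr, ← h.map_fr, MulAut.inv_apply_self]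
  right_inv v := by
    apply fr_injective
    change fr (un (φ (fr (un (φ⁻¹ (fr v))).left))).left = fr v
    rw [← h.map_fr, ← h.symm.map_fr, MulAut.apply_inv_self]
  map_mul' v w := by
    apply fr_injective
    rw [← h.map_fr (v * w), map_mul fr v w, map_mul φ, map_mul fr, ← h.map_fr v, ← h.map_fr w]

lemma IsIA.fr_restrict (v : F n) : fr (h.restrict v) = φ (fr v) := (h.map_fr v).symm

lemma IsIA.right_un_right_un (b : B n) :
    (un (φ (up (un (φ⁻¹ (up b))).right))).right = b := by
  have h1 := congrArg φ (eq_fr_mul_up (h.symm.fix_up b))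
  rw [MulAut.apply_inv_self, map_mul, h.map_fr] at h1
  have h2 := congrArg (fun b => (un b).right) h1
  rw [right_un_fr_mul _ (h.fix_up _)] at h2
  rw [← h2, ← ι_inr b, un_ι, SemidirectProduct.right_inr]

/-- The automorphism induced on the quotient by the free normal subgroup. -/
def IsIA.induced : MulAut (B n) where
  toFun b := (un (φ (up b))).right
  invFun b := (un (φ⁻¹ (up b))).right
  left_inv b := by
    have := h.symm.right_un_right_un b
    rwa [_root_.inv_inv] at this
  right_inv b := h.right_un_right_un b
  map_mul' a b := by
    rw [map_mul, map_mul, un_mul (h.fix_up a) (h.fix_up b), SemidirectProduct.mul_right]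

lemma IsIA.map_up (b : B n) : φ (up b) = fr (un (φ (up b))).left * up (h.induced b) :=
  eq_fr_mul_up (h.fix_up b)

lemma IsIA.isIA_induced : IsIA h.induced where
  perm b := (π_un (h.fix_up b)).trans ((h.perm _).trans (π_up b))
  cross p hp q r := by
    by_cases hqr : n ≤ q ∨ n ≤ r
    · rw [c_eq_zero _ hqr, c_eq_zero _ hqr]
    · refine (c_un (h.fix_up p) (by omega) (by omega)).trans ?_
      rw [h.cross _ (by rw [π_up, hp]), c_up]

/-- An automorphism inducing the identity on the quotient is conjugate to one which is the
identity on the stabilizer of the last strand. -/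
lemma IsIA.exists_conj_of_induced (hn : 3 ≤ n) (hi : h.induced = 1) :
    ∃ v : F n, ∀ b : B (n + 1), π b n = n → φ b = fr v * b * (fr v)⁻¹ := by
  obtain ⟨m, rfl⟩ := Nat.exists_eq_add_of_le' hn
  have hup := h.map_up
  simp only [hi, MulAut.one_apply] at hup
  have hx : ∀ j < m + 3, ∀ v, xe j (h.restrict v) = xe j v := by
    intro j hj v
    have h1 := h.cross (fr v) (π_fr v) j (m + 3)
    rw [← h.fr_restrict, c_fr_last _ hj, c_fr_last _ hj] at h1
    apply Multiplicative.toAdd.injective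
    omega
  have hu : ∀ b v, h.restrict (act b v) =
      (un (φ (up b))).left * act b (h.restrict v) * (un (φ (up b))).left⁻¹ := by
    intro b v
    apply fr_injective
    rw [h.fr_restrict, fr_act, map_mul, map_mul, map_mul, map_mul, map_inv, map_inv, fr_act,
      h.fr_restrict]
    nth_rewrite 1 2 [hup]
    group
  have hs : ∀ b, xs (un (φ (up b))).left = 1 := by
    intro b
    have h1 := h.ex (up b)
    rw [hup, ex_mul, ex_fr] at h1
    apply Multiplicative.toAdd.injective
    rw [toAdd_one]
    omega
  obtain ⟨v, hv, hv'⟩ := exists_conj_of_twisted (m := m + 1) (by omega) hx hu hs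
  refine ⟨v, fun b hb => ?_⟩
  rw [eq_fr_mul_up hb, map_mul, ← h.fr_restrict, hup, hv, hv']
  simp only [map_mul, map_inv, fr_act]
  group

end Step

/-- An automorphism which is the identity on the stabilizer of the last strand is trivial. -/
lemma IsIA.eq_one (hn : 3 ≤ n) {φ : MulAut (B (n + 1))} (h : IsIA φ)
    (hφ : ∀ b : B (n + 1), π b n = n → φ b = b) : φ = 1 := by
  have hpure : ∀ p : B (n + 1), π p = 1 → φ p = p := fun p hp => hφ p (pure_apply hp n)
  set t : B (n + 1) := s (n - 1) with ht
  have hπt : π t = Equiv.swap (n - 1) n := by rw [ht, π_s (by omega), Nat.sub_add_cancel (by omega)]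
  set p := φ t * t⁻¹ with hp
  have hφt : φ t = p * t := by rw [hp]; group
  have hπp : π p = 1 := by rw [hp, map_mul, h.perm, ← map_mul, mul_inv_cancel, map_one]
  have hcomm : ∀ q, π q = 1 → Commute q p := by
    intro q hq
    have h1 := hpure (t⁻¹ * q * t) (by simp [hq])
    rw [map_mul, map_mul, map_inv, hpure q hq, hφt] at h1
    have h2 : p⁻¹ * q * p = q := by
      calc p⁻¹ * q * p = t * ((p * t)⁻¹ * q * (p * t)) * t⁻¹ := by group
        _ = q := by rw [h1]; group
    calc q * p = p * (p⁻¹ * q * p) := by group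
      _ = p * q := by rw [h2]
  have hp1 : p = 1 := by
    refine eq_one_of_pure_central (by omega) p hπp hcomm ?_
    have h1 := hpure (t ^ 2) (π_sq (by omega))
    rw [map_pow, hφt] at h1
    have h2 : p * (t * p * t⁻¹) = 1 := by
      calc p * (t * p * t⁻¹) = (p * t) ^ 2 * (t ^ 2)⁻¹ := by rw [pow_two, pow_two]; group
        _ = 1 := by rw [h1, mul_inv_cancel]
    have h3 := congrArg (fun b => c b 0 1) h2
    simp only [c_mul_of_pure _ hπp, c_conj _ hπp, hπt, c_one, Equiv.swap_inv, Pi.zero_apply] at h3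
    rw [Equiv.swap_apply_of_ne_of_ne (by omega) (by omega),
      Equiv.swap_apply_of_ne_of_ne (by omega) (by omega)] at h3
    omega
  have hs : φ.toMonoidHom = MonoidHom.id _ := by
    refine hom_ext fun i hi => ?_
    change φ (s i) = s i
    by_cases h1 : i + 1 = n
    · obtain rfl : i = n - 1 := by omega
      rw [← ht, hφt, hp1, one_mul]
    · refine hφ _ ?_
      rw [π_s hi]
      exact Equiv.swap_apply_of_ne_of_ne (by omega) (by omega)
  ext b
  exact DFunLike.congr_fun hs b

theorem IsIA.exists_conj_succ (hn : 3 ≤ n) (ih : ∀ φ : MulAut (B n), IsIA φ → ∃ g, φ = MulAut.conj g)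
    {φ : MulAut (B (n + 1))} (h : IsIA φ) : ∃ g, φ = MulAut.conj g := by
  obtain ⟨g, hg⟩ := ih h.induced h.isIA_induced
  have hπg : π g = 1 := π_eq_one_of_conj hn fun b => by
    rw [← h.isIA_induced.perm b, hg, MulAut.conj_apply]
  have h1 : IsIA (MulAut.conj (up g)⁻¹ * φ) := h.conj_mul (by rw [map_inv, π_up, hπg, inv_one])
  have h1i : h1.induced = 1 := by
    ext b
    change (un ((up g)⁻¹ * φ (up b) * (up g)⁻¹⁻¹)).right = b
    have h2 : h.induced b = g * b * g⁻¹ := by rw [hg, MulAut.conj_apply]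
    rw [_root_.inv_inv, h.map_up, h2, map_mul, map_mul, map_inv]
    set v := (un (φ (up b))).left
    have h3 : (up g)⁻¹ * (fr v * (up g * up b * (up g)⁻¹)) * up g =
        fr (act g⁻¹ v) * up b := by
      rw [fr_act, map_inv]
      group
    rw [h3, right_un_fr_mul _ (by rw [π_up, π_lt le_rfl]), ← ι_inr b, un_ι,
      SemidirectProduct.right_inr]
  obtain ⟨v, hv⟩ := h1.exists_conj_of_induced hn h1i
  have h2 : IsIA (MulAut.conj (fr v)⁻¹ * (MulAut.conj (up g)⁻¹ * φ)) :=
    h1.conj_mul (by rw [map_inv, π_fr, inv_one])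
  have h3 := h2.eq_one hn fun b hb => by
    rw [MulAut.mul_apply, hv b hb, MulAut.conj_apply]
    group
  refine ⟨up g * fr v, ?_⟩
  rw [map_mul]
  rw [map_inv, map_inv, ← mul_assoc, ← mul_inv_rev, inv_mul_eq_one] at h3
  exact h3.symm

end IA

end BraidAut

namespace BraidAut

section Three

/-- The half twist on three strands. -/
def hX : B 3 := s 0 * s 1 * s 0

/-- The rotation on three strands. -/
def hY : B 3 := s 0 * s 1

lemma hX_mul_zero : hX * s 0 = s 1 * hX := by
  have h := s_braid (n := 3) (i := 0) (by omega)
  simp only [zero_add] at h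
  rw [hX]
  nth_rewrite 1 [h]
  simp only [mul_assoc]

lemma hX_mul_one : hX * s 1 = s 0 * hX := by
  have h := s_braid (n := 3) (i := 0) (by omega)
  simp only [zero_add] at h
  rw [hX]
  nth_rewrite 2 [h]
  simp only [mul_assoc]

lemma hY_pow : hY ^ 3 = hX ^ 2 := by
  have h := hX_mul_one
  rw [hX] at h
  rw [hY, hX, pow_succ, pow_two, pow_two]
  simp only [mul_assoc] at h ⊢
  rw [h]

/-- The infinite cyclic group generated by the full twist on three strands. -/
def tz : Subgroup (B 3) := Subgroup.zpowers (hX ^ 2)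

lemma tz_le_center : tz ≤ Subgroup.center (B 3) := by
  rw [tz, Subgroup.zpowers_le, Subgroup.mem_center_iff]
  intro g
  have : g ∈ Subgroup.centralizer {(hX ^ 2 : B 3)} := by
    refine mem_of_s (fun i hi => ?_) g
    rw [Subgroup.mem_centralizer_singleton_iff]
    have h0 := hX_mul_zero
    have h1 := hX_mul_one
    have hi : i < 2 := by omega
    interval_cases i
    · rw [pow_two, mul_assoc hX, h0, ← mul_assoc hX, h1, mul_assoc]
    · rw [pow_two, mul_assoc hX, h1, ← mul_assoc hX, h0, mul_assoc]
  exact Subgroup.mem_centralizer_singleton_iff.1 this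

instance : tz.Normal := ⟨fun a ha g => by
  rwa [(Subgroup.mem_center_iff.1 (tz_le_center ha)) g, mul_inv_cancel_right]⟩

lemma s_zero_eq : (s 0 : B 3) = hY⁻¹ * hX := by rw [hX, hY]; group

lemma s_one_eq : (s 1 : B 3) = hX⁻¹ * hY ^ 2 := by rw [hX, hY, pow_two]; group

lemma ex_hX : ex hX = 3 := by simp [hX, ex_s]

lemma ex_hY : ex hY = 2 := by simp [hY, ex_s]

/-- The quotient by the full twist. -/
abbrev Bz : Type := B 3 ⧸ tz

/-- The two cyclic factors of the modular group. -/
def fac (i : Bool) : Subgroup Bz := Subgroup.zpowers (bif i then (hX : Bz) else (hY : Bz))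

lemma exists_ex {a b : B 3} (h : (a : Bz) = b) : ∃ k : ℤ, b = a * (hX ^ 2) ^ k := by
  obtain ⟨k, hk⟩ := QuotientGroup.eq.1 h
  exact ⟨k, by simp only [hk, mul_inv_cancel_left]⟩

lemma exists_ex_eq {a b : B 3} (h : (a : Bz) = b) : ∃ k : ℤ, ex b = ex a + 6 * k := by
  obtain ⟨k, rfl⟩ := exists_ex h
  exact ⟨k, by simp [ex_hX]; ring⟩

lemma eq_of_mk {a b : B 3} (h : (a : Bz) = b) (he : ex a = ex b) : a = b := by
  obtain ⟨k, rfl⟩ := exists_ex h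
  simp [ex_hX] at he
  simp [he]

lemma mk_hX_sq : (hX : Bz) ^ 2 = 1 :=
  (QuotientGroup.eq_one_iff (hX ^ 2)).2 (Subgroup.mem_zpowers _)

lemma mk_hY_cube : (hY : Bz) ^ 3 = 1 := by
  refine (QuotientGroup.eq_one_iff (hY ^ 3)).2 ?_
  rw [hY_pow]
  exact Subgroup.mem_zpowers _

/-- The image of the half twist in the coproduct of the factors. -/
def cX : Monoid.CoprodI (fun i => fac i) :=
  Monoid.CoprodI.of (M := fun i => fac i) (i := true) ⟨(hX : Bz), Subgroup.mem_zpowers _⟩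

/-- The image of the rotation in the coproduct of the factors. -/
def cY : Monoid.CoprodI (fun i => fac i) :=
  Monoid.CoprodI.of (M := fun i => fac i) (i := false) ⟨(hY : Bz), Subgroup.mem_zpowers _⟩

lemma cX_mul : cX * cX = 1 := by
  rw [cX, ← map_mul, ← map_one Monoid.CoprodI.of]
  congr 1
  exact Subtype.ext (by simpa [pow_two] using mk_hX_sq)

lemma cY_mul : cY * cY * cY = 1 := by
  rw [cY, ← map_mul, ← map_mul, ← map_one Monoid.CoprodI.of]
  congr 1
  exact Subtype.ext (by simpa [pow_succ] using mk_hY_cube)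

/-- The map from the braid group to the coproduct. -/
def toC : B 3 →* Monoid.CoprodI (fun i => fac i) :=
  lift (fun i => if i = 0 then cY⁻¹ * cX else cX * cY⁻¹)
    { comm := fun i j h hj => by omega
      braid := fun i h => by
        obtain rfl : i = 0 := by omega
        have h1 := cX_mul
        have h2 : cY⁻¹ * cY⁻¹ = cY := by
          rw [← mul_inv_rev, inv_eq_iff_mul_eq_one, cY_mul]
        have h3 : cX⁻¹ = cX := inv_eq_of_mul_eq_one_right h1
        simp only [zero_add, if_true, one_ne_zero, if_false]
        calc cY⁻¹ * cX * (cX * cY⁻¹) * (cY⁻¹ * cX)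
            = cY⁻¹ * (cX * cX) * (cY⁻¹ * cY⁻¹) * cX := by group
          _ = cX * (cY⁻¹ * cY⁻¹) * (cX * cX) * cY⁻¹ := by rw [h1, h2]; group
          _ = cX * cY⁻¹ * (cY⁻¹ * cX) * (cX * cY⁻¹) := by group }

lemma toC_hX : toC hX = cX := by
  have h1 := cX_mul
  have h2 : cY⁻¹ * cY⁻¹ = cY := by
    rw [← mul_inv_rev, inv_eq_iff_mul_eq_one, cY_mul]
  rw [hX, map_mul, map_mul, toC, lift_s _ _ (by omega), lift_s _ _ (by omega), if_pos rfl,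
    if_neg one_ne_zero]
  calc cY⁻¹ * cX * (cX * cY⁻¹) * (cY⁻¹ * cX)
      = cY⁻¹ * (cX * cX) * (cY⁻¹ * cY⁻¹) * cX := by group
    _ = cX := by rw [h1, h2]; group

lemma toC_hY : toC hY = cY := by
  have h1 := cX_mul
  have h2 : cY⁻¹ * cY⁻¹ = cY := by
    rw [← mul_inv_rev, inv_eq_iff_mul_eq_one, cY_mul]
  rw [hY, map_mul, toC, lift_s _ _ (by omega), lift_s _ _ (by omega), if_pos rfl,
    if_neg one_ne_zero]
  calc cY⁻¹ * cX * (cX * cY⁻¹) = cY⁻¹ * (cX * cX) * cY⁻¹ := by group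
    _ = cY := by rw [h1, mul_one, h2]

/-- The map from the quotient of the braid group to the coproduct. -/
def ofBz : Bz →* Monoid.CoprodI (fun i => fac i) :=
  QuotientGroup.lift tz toC (by
    refine Subgroup.zpowers_le.2 ?_
    rw [MonoidHom.mem_ker, map_pow, toC_hX, pow_two, cX_mul])

lemma ofBz_hX : ofBz (hX : Bz) = cX := toC_hX

lemma ofBz_hY : ofBz (hY : Bz) = cY := toC_hY

lemma isFreeProd_fac : IsFreeProd fac := by
  have h := isFreeProd_range (G := fun i => fac i) (fun i => (fac i).subtype) ofBz ?_ ?_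
  · simpa using h
  · rintro i ⟨_, k, rfl⟩
    cases i
    · change ofBz ((hY : Bz) ^ k) = _
      rw [map_zpow, ofBz_hY, cY, ← map_zpow]
      rfl
    · change ofBz ((hX : Bz) ^ k) = _
      rw [map_zpow, ofBz_hX, cX, ← map_zpow]
      rfl
  · have hXm : (hX : Bz) ∈ ⨆ i, (fac i).subtype.range :=
      Subgroup.mem_iSup_of_mem true
        (by rw [Subgroup.range_subtype]; exact Subgroup.mem_zpowers (hX : Bz))
    have hYm : (hY : Bz) ∈ ⨆ i, (fac i).subtype.range :=
      Subgroup.mem_iSup_of_mem false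
        (by rw [Subgroup.range_subtype]; exact Subgroup.mem_zpowers (hY : Bz))
    rw [eq_top_iff]
    intro v _
    induction v using QuotientGroup.induction_on with
    | H b =>
      have : b ∈ (⨆ i, (fac i).subtype.range).comap (QuotientGroup.mk' tz) := by
        refine mem_of_s (fun i hi => ?_) b
        rw [Subgroup.mem_comap]
        have hi : i < 2 := by omega
        interval_cases i
        · rw [s_zero_eq, map_mul, map_inv]
          exact mul_mem (inv_mem hYm) hXm
        · rw [s_one_eq, map_mul, map_inv, map_pow]
          exact mul_mem (inv_mem hXm) (pow_mem hYm 2)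
      exact this

lemma mem_tz_of_central {z : B 3} (hz : ∀ g, Commute g z) : z ∈ tz := by
  rw [← QuotientGroup.eq_one_iff]
  refine eq_one_of_central isFreeProd_fac (fun i => ?_) fun g => ?_
  · cases i
    · refine ⟨hY, Subgroup.mem_zpowers _, fun h => ?_⟩
      obtain ⟨k, hk⟩ := exists_ex_eq (a := 1) (b := hY) h.symm
      rw [ex_hY, ex_one] at hk
      omega
    · refine ⟨hX, Subgroup.mem_zpowers _, fun h => ?_⟩
      obtain ⟨k, hk⟩ := exists_ex_eq (a := 1) (b := hX) h.symm
      rw [ex_hX, ex_one] at hk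
      omega
  · induction g using QuotientGroup.induction_on with
    | H b => exact congrArg (QuotientGroup.mk' tz) (hz b).eq

variable {φ : MulAut (B 3)}

lemma map_sq_mem (φ : MulAut (B 3)) : φ (hX ^ 2) ∈ tz := by
  refine mem_tz_of_central fun g => ?_
  have h := Subgroup.mem_center_iff.1 (tz_le_center (Subgroup.mem_zpowers _)) (φ.symm g)
  have := congrArg φ h
  rwa [map_mul, map_mul, MulEquiv.apply_symm_apply] at this

lemma exists_conj_hX (he : ∀ b, ex (φ b) = ex b) :
    ∃ h : Bz, (φ hX : Bz) = h⁻¹ * (hX : Bz) * h := by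
  obtain ⟨h, i, hi⟩ := conj_mem_of_pow_eq_one isFreeProd_fac (g := (φ hX : Bz)) (k := 2) (by omega)
    (by
      rw [← QuotientGroup.mk_pow, ← map_pow, QuotientGroup.eq_one_iff]
      exact map_sq_mem φ)
  refine ⟨h, ?_⟩
  induction h using QuotientGroup.induction_on with
  | H h =>
  obtain ⟨k, hk⟩ := hi
  cases i
  · obtain ⟨l, hl⟩ := exists_ex_eq (a := hY ^ k) (b := h * φ hX * h⁻¹) hk
    simp [he, ex_hX, ex_hY] at hl
    omega
  · obtain ⟨l, hl⟩ := exists_ex_eq (a := hX ^ k) (b := h * φ hX * h⁻¹) hk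
    simp [he, ex_hX] at hl
    have : (hX : Bz) ^ k = hX := by
      obtain rfl : k = 2 * (-l) + 1 := by omega
      rw [zpow_add, zpow_mul, zpow_ofNat, mk_hX_sq]
      simp
    change (hX : Bz) ^ k = h * φ hX * (h : Bz)⁻¹ at hk
    rw [← this, hk]
    group

lemma exists_conj_hY (he : ∀ b, ex (φ b) = ex b) :
    ∃ h : Bz, (φ hY : Bz) = h⁻¹ * (hY : Bz) * h := by
  obtain ⟨h, i, hi⟩ := conj_mem_of_pow_eq_one isFreeProd_fac (g := (φ hY : Bz)) (k := 3) (by omega)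
    (by
      rw [← QuotientGroup.mk_pow, ← map_pow, QuotientGroup.eq_one_iff, hY_pow]
      exact map_sq_mem φ)
  refine ⟨h, ?_⟩
  induction h using QuotientGroup.induction_on with
  | H h =>
  obtain ⟨k, hk⟩ := hi
  cases i
  · obtain ⟨l, hl⟩ := exists_ex_eq (a := hY ^ k) (b := h * φ hY * h⁻¹) hk
    simp [he, ex_hY] at hl
    have : (hY : Bz) ^ k = hY := by
      obtain rfl : k = 3 * (-l) + 1 := by omega
      rw [zpow_add, zpow_mul, zpow_ofNat, mk_hY_cube]
      simp
    change (hY : Bz) ^ k = h * φ hY * (h : Bz)⁻¹ at hk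
    rw [← this, hk]
    group
  · obtain ⟨l, hl⟩ := exists_ex_eq (a := hX ^ k) (b := h * φ hY * h⁻¹) hk
    simp [he, ex_hX, ex_hY] at hl
    omega

theorem exists_conj_three (he : ∀ b, ex (φ b) = ex b) : ∃ g, φ = MulAut.conj g := by
  obtain ⟨h, hh⟩ := exists_conj_hX he
  obtain ⟨g, hg⟩ := exists_conj_hY he
  have htop : Subgroup.closure ((fac true : Set Bz) ∪
      {v | ∃ b ∈ fac false, v = h * g⁻¹ * b * (h * g⁻¹)⁻¹}) = ⊤ := by
    rw [eq_top_iff]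
    intro v _
    set R := Subgroup.closure ((fac true : Set Bz) ∪
      {v | ∃ b ∈ fac false, v = h * g⁻¹ * b * (h * g⁻¹)⁻¹})
    have hXR : h * φ hX * h⁻¹ ∈ R := by
      refine Subgroup.subset_closure (Or.inl ?_)
      rw [hh]
      have : h * (h⁻¹ * hX * h) * h⁻¹ = hX := by group
      rw [this]
      exact Subgroup.mem_zpowers _
    have hYR : h * φ hY * h⁻¹ ∈ R := by
      refine Subgroup.subset_closure (Or.inr ⟨hY, Subgroup.mem_zpowers _, ?_⟩)
      rw [hg]
      group
    obtain ⟨w, hw⟩ := QuotientGroup.mk_surjective (h⁻¹ * v * h)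
    obtain ⟨w, rfl⟩ := φ.surjective w
    have : w ∈ R.comap ((MulAut.conj h).toMonoidHom.comp
        ((QuotientGroup.mk' tz).comp φ.toMonoidHom)) := by
      refine mem_of_s (fun i hi => ?_) w
      rw [Subgroup.mem_comap]
      have hi : i < 2 := by omega
      interval_cases i
      · rw [s_zero_eq, map_mul, map_inv]
        exact mul_mem (inv_mem hYR) hXR
      · rw [s_one_eq, map_mul, map_inv, map_pow]
        exact mul_mem (inv_mem hXR) (pow_mem hYR 2)
    have h2 : h * (φ w : Bz) * h⁻¹ ∈ R := this
    rw [hw] at h2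
    convert h2 using 1
    group
  obtain ⟨a, ⟨k, rfl⟩, b, ⟨l, rfl⟩, hab⟩ := eq_mul_of_closure_eq_top isFreeProd_fac htop
  simp only [cond_true, cond_false] at hab
  obtain ⟨W, hW⟩ := QuotientGroup.mk_surjective ((hX : Bz) ^ (-k) * h)
  have hX1 : W * φ hX * W⁻¹ = hX := by
    refine eq_of_mk ?_ (by simp [he])
    rw [QuotientGroup.mk_mul, QuotientGroup.mk_mul, QuotientGroup.mk_inv, hW, hh]
    group
  have hY1 : W * φ hY * W⁻¹ = hY := by
    refine eq_of_mk ?_ (by simp [he])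
    rw [QuotientGroup.mk_mul, QuotientGroup.mk_mul, QuotientGroup.mk_inv, hW, hg]
    calc (hX : Bz) ^ (-k) * h * (g⁻¹ * hY * g) * ((hX : Bz) ^ (-k) * h)⁻¹
        = (hX : Bz) ^ (-k) * (h * g⁻¹) * hY * (h * g⁻¹)⁻¹ * ((hX : Bz) ^ (-k))⁻¹ := by group
      _ = hY := by rw [hab]; group
  have hs : (MulAut.conj W * φ).toMonoidHom = MonoidHom.id _ := by
    have hX2 : (MulAut.conj W * φ) hX = hX := hX1
    have hY2 : (MulAut.conj W * φ) hY = hY := hY1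
    refine hom_ext fun i hi => ?_
    change (MulAut.conj W * φ) (s i) = s i
    have hi : i < 2 := by omega
    interval_cases i
    · rw [s_zero_eq, map_mul, map_inv, hX2, hY2]
    · rw [s_one_eq, map_mul, map_inv, map_pow, hX2, hY2]
  refine ⟨W⁻¹, ?_⟩
  rw [map_inv, eq_inv_iff_mul_eq_one, mul_eq_one_iff_eq_inv, eq_comm, inv_eq_iff_mul_eq_one]
  ext b
  exact DFunLike.congr_fun hs b

end Three

/-- Automorphisms acting trivially on permutations and crossing numbers are inner. -/
theorem IsIA.exists_conj {n : ℕ} (hn : 3 ≤ n) {φ : MulAut (B n)} (h : IsIA φ) :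
    ∃ g, φ = MulAut.conj g := by
  induction n, hn using Nat.le_induction with
  | base => exact exists_conj_three h.ex
  | succ n hn ih => exact h.exists_conj_succ hn fun φ hφ => ih hφ

end BraidAut

namespace BraidAut

open Equiv

variable {G : Type*} [Group G]

lemma eq_of_braid {a b : G} (h : Commute a b) (h' : a * b * a = b * a * b) : a = b := by
  rw [h.eq, mul_assoc, mul_assoc] at h'
  exact mul_left_cancel (mul_left_cancel (h'.trans (by rw [h.eq])))

lemma eq_of_commute {n : ℕ} (f : B n →* G) {i : ℕ} (hi : i + 2 < n)
    (h : Commute (f (s i)) (f (s (i + 1)))) : f (s i) = f (s (i + 1)) :=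
  eq_of_braid h (by simpa only [map_mul] using congrArg f (s_braid hi))

lemma map_s_eq {n : ℕ} (f : B n →* G) {i : ℕ} (hi : i + 2 < n) (h : f (s i) = f (s (i + 1))) {j : ℕ}
    (hj : j + 1 < n) : f (s j) = f (s 0) := by
  have comm {i j : ℕ} (h : i + 2 ≤ j) : Commute (f (s i)) (f (s j)) := by
    rw [commute_iff_eq]
    simpa only [map_mul] using congrArg f (s_comm (n := n) h)
  have down : ∀ k, k ≤ i → f (s (i - k)) = f (s (i - k + 1)) := by
    intro k
    induction k with
    | zero => exact fun _ => h
    | succ k ih =>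
      intro hk
      have h1 := ih (by omega)
      obtain ⟨l, rfl⟩ : ∃ l, i = l + (k + 1) := ⟨i - (k + 1), by omega⟩
      rw [show l + (k + 1) - k = l + 1 by omega] at h1
      rw [show l + (k + 1) - (k + 1) = l by omega]
      refine eq_of_commute f (by omega) ?_
      rw [h1]
      exact comm le_rfl
  have h0 : f (s 0) = f (s 1) := by simpa using down i le_rfl
  have up : ∀ j, j + 2 < n → f (s j) = f (s (j + 1)) := by
    intro j
    induction j with
    | zero => exact fun _ => h0
    | succ j ih =>
      intro hj
      refine eq_of_commute f hj ?_
      rw [← ih (by omega)]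
      exact comm le_rfl
  induction j with
  | zero => rfl
  | succ j ih => exact (up j hj).symm.trans (ih (by omega))

lemma eq_of_commute_div {n : ℕ} (hn : 5 ≤ n) (f : B n →* G)
    (h : Commute (f (s 2 * (s 0)⁻¹)) (f (s 3 * (s 0)⁻¹))) : f (s 0) = f (s 1) := by
  have h2 : f (s 2) * f (s 0) = f (s 0) * f (s 2) := by
    rw [← map_mul, ← map_mul, s_comm (i := 0) (j := 2) (by omega)]
  have h3 : f (s 3) * f (s 0) = f (s 0) * f (s 3) := by
    rw [← map_mul, ← map_mul, s_comm (i := 0) (j := 3) (by omega)]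
  have h2' : Commute (f (s 2)) (f (s 0))⁻¹ := Commute.inv_right h2
  have h3' : Commute (f (s 3)) (f (s 0))⁻¹ := Commute.inv_right h3
  have key : Commute (f (s 2)) (f (s 3)) := by
    have h4 := h.eq
    simp only [map_mul, map_inv] at h4
    refine mul_right_cancel (b := (f (s 0))⁻¹ * (f (s 0))⁻¹) ?_
    calc f (s 2) * f (s 3) * ((f (s 0))⁻¹ * (f (s 0))⁻¹)
        = f (s 2) * (f (s 3) * (f (s 0))⁻¹) * (f (s 0))⁻¹ := by simp only [mul_assoc]
      _ = f (s 2) * (f (s 0))⁻¹ * (f (s 3) * (f (s 0))⁻¹) := by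
        rw [h3'.eq]
        simp only [mul_assoc]
        rw [h3'.eq]
      _ = f (s 3) * (f (s 0))⁻¹ * (f (s 2) * (f (s 0))⁻¹) := h4
      _ = f (s 3) * ((f (s 0))⁻¹ * f (s 2)) * (f (s 0))⁻¹ := by simp only [mul_assoc]
      _ = f (s 3) * f (s 2) * ((f (s 0))⁻¹ * (f (s 0))⁻¹) := by rw [← h2'.eq]; simp only [mul_assoc]
  exact (map_s_eq f (by omega) (eq_of_commute f (i := 2) (by omega) key) (by omega)).symm

lemma s_conj {n : ℕ} {i : ℕ} (hi : i + 1 < n) : ∃ w : B n, s i = w * s 0 * w⁻¹ := by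
  induction i with
  | zero => exact ⟨1, by simp⟩
  | succ i ih =>
    obtain ⟨w, hw⟩ := ih (by omega)
    refine ⟨s i * s (i + 1) * w, ?_⟩
    have h := s_braid (n := n) (i := i) hi
    calc s (i + 1) = s (i + 1) * s i * s (i + 1) * (s i * s (i + 1))⁻¹ := by group
      _ = s i * s (i + 1) * s i * (s i * s (i + 1))⁻¹ := by rw [h]
      _ = s i * s (i + 1) * (w * s 0 * w⁻¹) * (s i * s (i + 1))⁻¹ := by rw [← hw]
      _ = _ := by group

/-- The permutations of the first `m` natural numbers induced by a braid. -/
def finPerm {n m : ℕ} (h : n ≤ m) : B n →* Perm (Fin m) where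
  toFun b :=
    { toFun q := ⟨π b q, by
        by_cases hq : n ≤ q.1
        · rw [π_lt hq]; exact q.2
        · exact (π_lt_iff.2 (not_le.1 hq)).trans_le h⟩
      invFun q := ⟨π b⁻¹ q, by
        by_cases hq : n ≤ q.1
        · rw [π_lt hq]; exact q.2
        · exact (π_lt_iff.2 (not_le.1 hq)).trans_le h⟩
      left_inv q := by simp
      right_inv q := by simp }
  map_one' := by ext; simp
  map_mul' a b := by ext; simp

@[simp] lemma finPerm_apply {n m : ℕ} (h : n ≤ m) (b : B n) (q : Fin m) :
    (finPerm h b q : ℕ) = π b q := rfl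

lemma finPerm_eq_iff {n m : ℕ} (h : n ≤ m) {a b : B n} : finPerm h a = finPerm h b ↔ π a = π b := by
  refine ⟨fun hab => ?_, fun hab => ?_⟩
  · ext q
    by_cases hq : q < m
    · exact congrArg Fin.val (DFunLike.congr_fun hab ⟨q, hq⟩)
    · rw [π_lt (by omega), π_lt (by omega)]
  · ext q
    simp [hab]

lemma finPerm_s {n : ℕ} {i : ℕ} (hi : i + 1 < n) :
    finPerm le_rfl (s i : B n) = swap ⟨i, by omega⟩ ⟨i + 1, hi⟩ := by
  ext q
  rw [finPerm_apply, π_s hi, swap_apply_def, swap_apply_def]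
  simp only [Fin.ext_iff]
  split_ifs <;> rfl

lemma finPerm_surjective {n : ℕ} : Function.Surjective (finPerm (le_refl n)) := by
  cases n with
  | zero => exact fun p => ⟨1, Subsingleton.elim _ _⟩
  | succ n =>
    intro p
    have h : p ∈ Submonoid.closure (Set.range fun i : Fin n => swap i.castSucc i.succ) := by
      rw [Perm.mclosure_swap_castSucc_succ]; trivial
    have h2 : Submonoid.closure (Set.range fun i : Fin n => swap i.castSucc i.succ) ≤
        MonoidHom.mrange (finPerm (le_refl (n + 1))) := by
      rw [Submonoid.closure_le]
      rintro _ ⟨i, rfl⟩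
      exact ⟨s i, finPerm_s (by omega)⟩
    exact h2 h

lemma π_map_ne {n : ℕ} (φ : MulAut (B n)) {i : ℕ} (hi : i + 2 < n) :
    π (φ (s i)) ≠ π (φ (s (i + 1))) := by
  intro h
  let f : B n →* Perm ℕ := π.comp φ.toMonoidHom
  have hf : ∀ b, f b ∈ Subgroup.zpowers (f (s 0)) := fun b =>
    mem_of_s (H := (Subgroup.zpowers (f (s 0))).comap f) (fun j hj => by
      rw [Subgroup.mem_comap, map_s_eq f hi h hj]
      exact Subgroup.mem_zpowers _) b
  have hc : ∀ a b : B n, Commute (π a) (π b) := by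
    intro a b
    obtain ⟨k, hk⟩ := hf (φ.symm a)
    obtain ⟨l, hl⟩ := hf (φ.symm b)
    have h1 : f (φ.symm a) = π a := congrArg π (φ.apply_symm_apply a)
    have h2 : f (φ.symm b) = π b := congrArg π (φ.apply_symm_apply b)
    rw [← h1, ← h2, ← hk, ← hl]
    exact (Commute.refl _).zpow_zpow k l
  have h1 := DFunLike.congr_fun (hc (s 0) (s 1)).eq 0
  rw [π_s (by omega), π_s (by omega)] at h1
  simp [swap_apply_def] at h1

/-- The automorphism inverting every generator. -/
def invHom (n : ℕ) : B n →* B n :=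
  lift (fun i => (s i)⁻¹)
    { comm := fun i j h _ => by rw [← mul_inv_rev, ← mul_inv_rev, s_comm h]
      braid := fun i h => by
        simp only [← mul_inv_rev, ← mul_assoc]
        rw [s_braid h] }

lemma invHom_s {n i : ℕ} (hi : i + 1 < n) : invHom n (s i) = (s i)⁻¹ := lift_s _ _ hi

lemma invHom_comp (n : ℕ) : (invHom n).comp (invHom n) = MonoidHom.id _ :=
  hom_ext fun i hi => by
    rw [MonoidHom.comp_apply, invHom_s hi, map_inv, invHom_s hi, inv_inv, MonoidHom.id_apply]

/-- The automorphism inverting every generator. -/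
def invAut (n : ℕ) : MulAut (B n) :=
  MonoidHom.toMulEquiv (invHom n) (invHom n) (invHom_comp n) (invHom_comp n)

lemma invAut_s {n i : ℕ} (hi : i + 1 < n) : invAut n (s i) = (s i)⁻¹ := invHom_s hi

lemma invAut_mul (n : ℕ) : invAut n * invAut n = 1 :=
  MulEquiv.ext fun b => DFunLike.congr_fun (invHom_comp n) b

lemma ex_eq_of_s {n : ℕ} (φ : MulAut (B n)) {k : ℤ} (h : ∀ i, i + 1 < n → ex (φ (s i)) = k)
    (b : B n) : ex (φ b) = k * ex b := by
  have : e.comp φ.toMonoidHom = (zpowGroupHom k).comp (e : B n →* _) := hom_ext fun i hi =>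
    Multiplicative.toAdd.injective <| by
      have := ex_s hi
      rw [ex] at this
      simpa [this, ex] using h i hi
  have := congrArg Multiplicative.toAdd (DFunLike.congr_fun this b)
  simpa [ex] using this

lemma ex_invAut {n : ℕ} (b : B n) : ex (invAut n b) = -ex b := by
  rw [ex_eq_of_s (k := -1) _ fun i hi => by rw [invAut_s hi, ex_inv, ex_s hi], neg_one_mul]

lemma ex_map {n : ℕ} (hn : 2 ≤ n) (φ : MulAut (B n)) :
    (∀ b, ex (φ b) = ex b) ∨ ∀ b, ex (φ b) = -ex b := by
  have h := ex_eq_of_s φ (k := ex (φ (s 0))) fun i hi => by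
    obtain ⟨w, hw⟩ := s_conj hi
    rw [hw]
    simp
  have h1 := h (φ.symm (s 0))
  rw [MulEquiv.apply_symm_apply, ex_s (by omega)] at h1
  rcases Int.eq_one_or_neg_one_of_mul_eq_one h1.symm with h2 | h2
  · exact Or.inl fun b => by rw [h, h2, one_mul]
  · exact Or.inr fun b => by rw [h, h2, neg_one_mul]

/-- Squares of generators normally generate the pure braids. -/
lemma mem_normalClosure {n : ℕ} {p : B n} (hp : π p = 1) :
    p ∈ Subgroup.normalClosure {b : B n | ∃ i, i + 1 < n ∧ b = s i ^ 2} := by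
  induction n with
  | zero =>
    have : p ∈ (⊥ : Subgroup (B 0)) := mem_of_s (fun i hi => by omega) p
    rw [Subgroup.mem_bot.1 this]
    exact one_mem _
  | succ n ih =>
    have hpn : π p n = n := by simp [hp]
    rw [eq_fr_mul_up hpn]
    refine mul_mem (mem_of_x (H := (Subgroup.normalClosure _).comap fr) (fun j hj => ?_) _) ?_
    · rw [Subgroup.mem_comap, fr_x hj]
      refine A_induction (p := fun k a => k < n + 1 →
        a ∈ Subgroup.normalClosure {b : B (n + 1) | ∃ i, i + 1 < n + 1 ∧ b = s i ^ 2})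
        (fun h => Subgroup.subset_normalClosure ⟨j, h, rfl⟩) (fun k _ h hk => ?_) hj (by omega)
      exact Subgroup.normalClosure_normal.conj_mem _ (h (by omega)) _
    · have h := ih (p := (un p).right) (by rw [π_un hpn, hp])
      have hle : Subgroup.normalClosure {b : B n | ∃ i, i + 1 < n ∧ b = s i ^ 2} ≤
          (Subgroup.normalClosure {b : B (n + 1) | ∃ i, i + 1 < n + 1 ∧ b = s i ^ 2}).comap up := by
        refine Subgroup.normalClosure_le_normal ?_
        rintro _ ⟨i, hi, rfl⟩
        refine Subgroup.subset_normalClosure ⟨i, by omega, ?_⟩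
        rw [map_pow, up_s hi]
      exact hle h

end BraidAut

namespace BraidAut

open Equiv

section Perm

variable {X : Type} [Fintype X] [DecidableEq X] {g a b : Perm X}

lemma exists_zpow_of_commute (ha : ∀ c ∈ g.cycleFactorsFinset, Commute a c) {x : X} (hx : g x ≠ x) :
    ∃ k : ℤ, (g ^ k) x = a x := by
  have h1 := ha _ (Perm.cycleOf_mem_cycleFactorsFinset_iff.2 (Perm.mem_support.2 hx))
  have h2 : a x ∈ (g.cycleOf x).support := by
    rw [Perm.mem_support, ← Perm.mul_apply, ← h1.eq, Perm.mul_apply, Perm.cycleOf_apply_self]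
    exact a.injective.ne hx
  exact (Perm.mem_support_cycleOf_iff.1 h2).1

lemma commute_of_cycles (hag : Commute a g) (hbg : Commute b g)
    (ha : ∀ c ∈ g.cycleFactorsFinset, Commute a c) (hb : ∀ c ∈ g.cycleFactorsFinset, Commute b c)
    (hfix : ∀ x, g x = x → a (b x) = b (a x)) : Commute a b := by
  ext x
  rw [Perm.mul_apply, Perm.mul_apply]
  by_cases hx : g x = x
  · exact hfix x hx
  · obtain ⟨k, hk⟩ := exists_zpow_of_commute ha hx
    obtain ⟨l, hl⟩ := exists_zpow_of_commute hb hx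
    have h1 := DFunLike.congr_fun (hag.zpow_right l).eq x
    have h2 := DFunLike.congr_fun (hbg.zpow_right k).eq x
    have h3 := DFunLike.congr_fun (Commute.zpow_zpow (Commute.refl g) k l).eq x
    simp only [Perm.mul_apply] at h1 h2 h3
    rw [← hl, h1, ← hk, h2, ← hl, h3]

/-- The action of the centralizer on the fixed points. -/
def fixHom (g : Perm X) :
    Subgroup.centralizer {g} →* Perm {x // x ∈ Function.fixedPoints g} where
  toFun a := a.1.subtypePerm fun x => by
    have h := DFunLike.congr_fun (Subgroup.mem_centralizer_singleton_iff.1 a.2) x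
    rw [Perm.mul_apply, Perm.mul_apply] at h
    rw [Function.mem_fixedPoints_iff, Function.mem_fixedPoints_iff, ← h]
    exact a.1.injective.eq_iff
  map_one' := rfl
  map_mul' _ _ := rfl

lemma card_fixed (g : Perm X) :
    Fintype.card {x // x ∈ Function.fixedPoints g} = Fintype.card X - g.support.card := by
  rw [← Perm.sum_cycleType, ← Perm.card_fixedPoints]

lemma two_mul_card_cycleFactorsFinset (g : Perm X) :
    2 * g.cycleFactorsFinset.card ≤ g.support.card := by
  have h := Multiset.card_nsmul_le_sum (s := g.cycleType) (a := 2) fun _ =>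
    Perm.two_le_of_mem_cycleType
  rw [Perm.sum_cycleType, Perm.cycleType_def, Multiset.card_map, smul_eq_mul, mul_comm] at h
  exact h

/-- The last generators acting on the centralizer of the first one. -/
def shiftHom {G : Type*} [Group G] {k : ℕ} (f : B (k + 2) →* G) :
    B k →* Subgroup.centralizer {f (s 0)} :=
  lift (fun i => ⟨f (s (i + 2)), Subgroup.mem_centralizer_singleton_iff.2 (by
      rw [← map_mul, ← map_mul, s_comm (i := 0) (j := i + 2) (by omega)])⟩)
    { comm := fun i j h hj => Subtype.ext <| by
        simp only [Subgroup.coe_mul, ← map_mul]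
        rw [s_comm (by omega)]
      braid := fun i h => Subtype.ext <| by
        simp only [Subgroup.coe_mul, ← map_mul]
        rw [show i + 1 + 2 = i + 2 + 1 by omega, s_braid (by omega)] }

lemma shiftHom_s {G : Type*} [Group G] {k : ℕ} (f : B (k + 2) →* G) {i : ℕ} (hi : i + 1 < k) :
    (shiftHom f (s i) : G) = f (s (i + 2)) := by
  rw [shiftHom, lift_s _ _ hi]

lemma map_eq_of_small {k : ℕ} (hk : 5 ≤ k) (ih : ∀ (Y : Type) [Fintype Y] (f : B k →* Perm Y),
      Fintype.card Y < k → f (s 0) = f (s 1))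
    (f : B (k + 2) →* Perm X) (hc : (f (s 0)).cycleFactorsFinset.card < k)
    (hf : Fintype.card {x // x ∈ Function.fixedPoints (f (s 0))} < k) : f (s 0) = f (s 1) := by
  set g := f (s 0) with hg
  have hC := ih _ ((Perm.OnCycleFactors.toPermHom g).comp (shiftHom f)) (by simpa using hc)
  have hF := ih _ ((fixHom g).comp (shiftHom f)) hf
  have triv : ∀ i, i + 1 < k →
      (∀ c ∈ g.cycleFactorsFinset, Commute (shiftHom f (s i * (s 0)⁻¹) : Perm X) c) ∧
      ∀ x, g x = x → (shiftHom f (s i * (s 0)⁻¹) : Perm X) x = x := by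
    intro i hi
    have h1 := map_s_eq _ (i := 0) (by omega) hC hi
    have h2 := map_s_eq _ (i := 0) (by omega) hF hi
    constructor
    · rw [← Perm.OnCycleFactors.mem_ker_toPermHom_iff, MonoidHom.mem_ker, map_mul, map_inv, map_mul,
        map_inv]
      exact mul_inv_eq_one.2 h1
    · intro x hx
      have h3 : fixHom g (shiftHom f (s i * (s 0)⁻¹)) = 1 := by
        rw [map_mul, map_inv, map_mul, map_inv]
        exact mul_inv_eq_one.2 h2
      exact congrArg Subtype.val (DFunLike.congr_fun h3 ⟨x, hx⟩)
  have hcomm : ∀ a : Subgroup.centralizer {g}, Commute (a : Perm X) g := fun a =>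
    Subgroup.mem_centralizer_singleton_iff.1 a.2
  have key : Commute (shiftHom f (s 2 * (s 0)⁻¹)) (shiftHom f (s 3 * (s 0)⁻¹)) := by
    refine Subtype.ext (commute_of_cycles (g := g) (hcomm _) (hcomm _) (triv 2 (by omega)).1
      (triv 3 (by omega)).1 fun x hx => ?_)
    rw [(triv 3 (by omega)).2 x hx, (triv 2 (by omega)).2 x hx, (triv 3 (by omega)).2 x hx]
  have h := congrArg Subtype.val (eq_of_commute_div hk _ key)
  rw [shiftHom_s f (by omega), shiftHom_s f (by omega)] at h
  exact (map_s_eq f (i := 2) (by omega) h (by omega)).symm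

set_option maxRecDepth 100000 in
lemma fin_four_braid : ∀ g : Perm (Fin 4), g ≠ 1 → ∀ a : Perm (Fin 4), (∀ i, g (a i) = a (g i)) →
    ∀ b : Perm (Fin 4), (∀ i, g (b i) = b (g i)) → (∀ i, a (b (a i)) = b (a (b i))) → a = b := by
  decide +kernel

set_option maxRecDepth 100000 in
set_option synthInstance.maxHeartbeats 400000 in
set_option synthInstance.maxSize 4096 in
lemma fin_five_braid : ∀ g : Perm (Fin 5), g 0 = 1 → (g 1 = 0 ∨ g 1 = 2) →
    ∀ a : Perm (Fin 5), (∀ i, g (a i) = a (g i)) → ∀ b : Perm (Fin 5), (∀ i, g (b i) = b (g i)) →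
    (∀ i, a (b (a i)) = b (a (b i))) → a = b ∨ ∀ c : Perm (Fin 5), (∀ i, g (c i) = c (g i)) →
    (∀ i, c (b (c i)) = b (c (b i))) → (∀ i, a (c i) = c (a i)) → a = c := by
  decide +kernel

lemma exists_conj_normal {g : Perm (Fin 5)} (hg : g ≠ 1) :
    ∃ t : Perm (Fin 5), (t * g * t⁻¹) 0 = 1 ∧ ((t * g * t⁻¹) 1 = 0 ∨ (t * g * t⁻¹) 1 = 2) := by
  obtain ⟨x, hx⟩ : ∃ x, g x ≠ x := by
    by_contra! h
    exact hg (Perm.ext h)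
  have h1 : swap x 0 (g x) ≠ 0 := fun h =>
    hx ((swap x 0).injective (h.trans (swap_apply_left x 0).symm))
  let t := swap (swap x 0 (g x)) 1 * swap x 0
  have htx : t x = 0 := by
    rw [Perm.mul_apply, swap_apply_left]
    exact swap_apply_of_ne_of_ne h1.symm (by decide)
  have hty : t (g x) = 1 := by rw [Perm.mul_apply, swap_apply_left]
  have h0 : t⁻¹ 0 = x := Perm.inv_eq_iff_eq.2 htx.symm
  have h1 : t⁻¹ 1 = g x := Perm.inv_eq_iff_eq.2 hty.symm
  by_cases hz : g (g x) = x
  · exact ⟨t, by rw [Perm.mul_apply, Perm.mul_apply, h0, hty],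
      Or.inl (by rw [Perm.mul_apply, Perm.mul_apply, h1, hz, htx])⟩
  · have hz0 : t (g (g x)) ≠ 0 := fun h => hz (t.injective (h.trans htx.symm))
    have hz1 : t (g (g x)) ≠ 1 := fun h => hx (g.injective (t.injective (h.trans hty.symm)))
    let u := swap (t (g (g x))) 2 * t
    have hux : u x = 0 := by
      rw [Perm.mul_apply, htx]
      exact swap_apply_of_ne_of_ne hz0.symm (by decide)
    have huy : u (g x) = 1 := by
      rw [Perm.mul_apply, hty]
      exact swap_apply_of_ne_of_ne hz1.symm (by decide)
    have huz : u (g (g x)) = 2 := by rw [Perm.mul_apply, swap_apply_left]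
    have h0 : u⁻¹ 0 = x := Perm.inv_eq_iff_eq.2 hux.symm
    have h1 : u⁻¹ 1 = g x := Perm.inv_eq_iff_eq.2 huy.symm
    exact ⟨u, by rw [Perm.mul_apply, Perm.mul_apply, h0, huy],
      Or.inr (by rw [Perm.mul_apply, Perm.mul_apply, h1, huz])⟩

lemma map_one_eq {G : Type*} [Group G] {m : ℕ} (hm : 2 < m) {f : B m →* G} (h : f (s 0) = 1) :
    f (s 0) = f (s 1) := by
  obtain ⟨w, hw⟩ := s_conj (n := m) (i := 1) hm
  rw [hw, map_mul, map_mul, h, mul_one, ← map_mul, mul_inv_cancel, map_one]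

lemma commute_map {G : Type*} [Group G] {m : ℕ} (f : B m →* G) {i j : ℕ} (h : i + 2 ≤ j) :
    f (s i) * f (s j) = f (s j) * f (s i) := by
  rw [← map_mul, ← map_mul, s_comm h]

lemma braid_map {G : Type*} [Group G] {m : ℕ} (f : B m →* G) {i : ℕ} (h : i + 2 < m) :
    f (s i) * f (s (i + 1)) * f (s i) = f (s (i + 1)) * f (s i) * f (s (i + 1)) := by
  simp only [← map_mul]
  rw [s_braid h]

lemma map_eq_four (f : B 5 →* Perm (Fin 4)) : f (s 0) = f (s 1) := by
  by_cases h : f (s 0) = 1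
  · exact map_one_eq (by omega) h
  · have h2 := fin_four_braid _ h (f (s 2)) (DFunLike.congr_fun (commute_map f (by omega)))
      (f (s 3)) (DFunLike.congr_fun (commute_map f (by omega)))
      (DFunLike.congr_fun (braid_map f (by omega)))
    exact (map_s_eq f (i := 2) (by omega) h2 (by omega)).symm

lemma map_eq_five (f : B 6 →* Perm (Fin 5)) : f (s 0) = f (s 1) := by
  by_cases h : f (s 0) = 1
  · exact map_one_eq (by omega) h
  · obtain ⟨t, ht0, ht1⟩ := exists_conj_normal h
    let f' : B 6 →* Perm (Fin 5) := (MulAut.conj t).toMonoidHom.comp f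
    have h2 := fin_five_braid (f' (s 0)) ht0 ht1 (f' (s 2))
      (DFunLike.congr_fun (commute_map f' (by omega)))
      (f' (s 3)) (DFunLike.congr_fun (commute_map f' (by omega)))
      (DFunLike.congr_fun (braid_map f' (by omega)))
    have h3 : f (s 2) = f (s 3) := by
      rcases h2 with h2 | h2
      · exact (MulAut.conj t).injective h2
      · have h4 := (MulAut.conj t).injective <| h2 (f' (s 4))
          (DFunLike.congr_fun (commute_map f' (by omega)))
          (DFunLike.congr_fun (braid_map f' (i := 3) (by omega)).symm)
          (DFunLike.congr_fun (commute_map f' (by omega)))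
        have h5 : f (s 1) = f (s 2) := by
          refine eq_of_commute f (i := 1) (by omega) ?_
          rw [h4]
          exact commute_map f (by omega)
        rw [map_s_eq f (by omega) h5 (by omega), map_s_eq f (j := 3) (by omega) h5 (by omega)]
    exact (map_s_eq f (i := 2) (by omega) h3 (by omega)).symm

end Perm

/-- Actions of braid groups on sets smaller than the number of strands are cyclic. -/
theorem map_eq_of_card_lt {m : ℕ} (hm : 5 ≤ m) (X : Type) [Fintype X] (f : B m →* Perm X)
    (hX : Fintype.card X < m) : f (s 0) = f (s 1) := by
  classical
  induction m using Nat.strong_induction_on generalizing X with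
  | _ m ih =>
    by_cases h5 : m = 5
    · subst h5
      obtain ⟨ι⟩ := Function.Embedding.nonempty_of_card_le (α := X) (β := Fin 4) (by simp; omega)
      exact Perm.viaEmbeddingHom_injective ι (map_eq_four ((Perm.viaEmbeddingHom ι).comp f))
    by_cases h6 : m = 6
    · subst h6
      obtain ⟨ι⟩ := Function.Embedding.nonempty_of_card_le (α := X) (β := Fin 5) (by simp; omega)
      exact Perm.viaEmbeddingHom_injective ι (map_eq_five ((Perm.viaEmbeddingHom ι).comp f))
    obtain ⟨k, rfl⟩ : ∃ k, m = k + 2 := ⟨m - 2, by omega⟩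
    by_cases h : f (s 0) = 1
    · exact map_one_eq (by omega) h
    have h1 := two_mul_card_cycleFactorsFinset (f (s 0))
    have h2 := Finset.card_le_univ (f (s 0)).support
    have h3 : 2 ≤ (f (s 0)).support.card := Perm.two_le_card_support_of_ne_one h
    refine map_eq_of_small (by omega) (fun Y _ f hY => ih k (by omega) (by omega) Y f hY) f
      (by omega) ?_
    rw [card_fixed]
    omega

end BraidAut

namespace BraidAut

open Equiv

lemma perm_mul_comm_of_card_le_two {X : Type} [Fintype X] (h : Fintype.card X ≤ 2) (a b : Perm X) : a * b = b * a := by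
  obtain ⟨ι⟩ := Function.Embedding.nonempty_of_card_le (α := X) (β := Fin 2) (by simpa using h)
  apply Perm.viaEmbeddingHom_injective ι
  rw [map_mul, map_mul]
  have h2 : ∀ a b : Perm (Fin 2), a * b = b * a := by decide
  exact h2 _ _

section Perm

variable {X : Type} [Fintype X] [DecidableEq X] {g a b : Perm X}

lemma exists_mem_cycleType_ne_two (hg : g ^ 2 ≠ 1) : ∃ l ∈ g.cycleType, l ≠ 2 := by
  by_contra! h
  exact hg (orderOf_dvd_iff_pow_eq_one.1 (by
    rw [← Perm.lcm_cycleType]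
    exact Multiset.lcm_dvd.2 fun l hl => (h l hl).dvd))

lemma nodup_cycleType (hX : Fintype.card X ≤ 6) (hs : Perm.sign g = -1) (hg : g ^ 2 ≠ 1) :
    g.cycleType.Nodup ∧ 4 ≤ g.support.card := by
  have h1 := Finset.card_le_univ g.support
  have h2 := two_mul_card_cycleFactorsFinset g
  have h3 : g.cycleFactorsFinset.card = g.cycleType.card := by
    rw [Perm.cycleType_def, Multiset.card_map]; rfl
  have h4 : ∀ l ∈ g.cycleType, 2 ≤ l := fun l => Perm.two_le_of_mem_cycleType
  obtain ⟨l, hl, hl2⟩ := exists_mem_cycleType_ne_two hg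
  have hodd : ¬ Even (g.cycleType.sum + g.cycleType.card) := fun h => by
    rw [Perm.sign_of_cycleType, h.neg_one_pow] at hs
    exact absurd hs (by decide)
  rw [← Perm.sum_cycleType] at h1 h2 ⊢
  rw [h3] at h2
  generalize g.cycleType = T at *
  rcases Nat.lt_or_ge T.card 1 with hc | hc
  · rw [Multiset.card_eq_zero.1 (by omega : T.card = 0)] at hl
    simp at hl
  rcases hc.eq_or_lt with hc | hc
  · obtain ⟨x, rfl⟩ := Multiset.card_eq_one.1 hc.symm
    simp only [Multiset.mem_singleton, Multiset.sum_singleton, Multiset.card_singleton,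
      Multiset.nodup_singleton, forall_eq, true_and, Nat.not_even_iff] at *
    omega
  rcases (show 2 ≤ T.card from hc).eq_or_lt with hc | hc
  · obtain ⟨x, y, rfl⟩ := Multiset.card_eq_two.1 hc.symm
    simp only [Multiset.insert_eq_cons, Multiset.mem_cons, Multiset.mem_singleton,
      Multiset.sum_cons, Multiset.sum_singleton, Multiset.card_cons, Multiset.card_singleton,
      Nat.not_even_iff, Multiset.nodup_cons, Multiset.nodup_singleton, and_true] at *
    have h5 := h4 x (by simp)
    have h6 := h4 y (by simp)
    omega
  · obtain ⟨x, y, z, rfl⟩ := Multiset.card_eq_three.1 (by omega : T.card = 3)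
    simp only [Multiset.insert_eq_cons, Multiset.mem_cons, Multiset.mem_singleton,
      Multiset.sum_cons, Multiset.sum_singleton] at *
    have h5 := h4 x (by simp)
    have h6 := h4 y (by simp)
    have h7 := h4 z (by simp)
    omega

lemma commute_cycle_of_nodup (hT : g.cycleType.Nodup) (ha : Commute a g) {c : Perm X}
    (hc : c ∈ g.cycleFactorsFinset) : Commute a c := by
  have h1 : a * c * a⁻¹ ∈ g.cycleFactorsFinset := by
    have h := (Perm.mem_cycleFactorsFinset_conj g a c).2 hc
    rwa [ha.eq, mul_inv_cancel_right] at h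
  rw [Perm.cycleType_def] at hT
  have h2 := Multiset.inj_on_of_nodup_map hT _ h1 _ hc (by
    rw [Function.comp_apply, Function.comp_apply, Perm.card_support_conj])
  rw [mul_inv_eq_iff_eq_mul] at h2
  exact h2

/-- Centralizers of odd permutations of small degree which are not involutions are abelian. -/
lemma commute_of_odd (hX : Fintype.card X ≤ 6) (hs : Perm.sign g = -1) (hg : g ^ 2 ≠ 1)
    (ha : Commute a g) (hb : Commute b g) : Commute a b := by
  obtain ⟨hT, h4⟩ := nodup_cycleType hX hs hg
  refine commute_of_cycles ha hb (fun c => commute_cycle_of_nodup hT ha)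
    (fun c => commute_cycle_of_nodup hT hb) fun x hx => ?_
  have h := perm_mul_comm_of_card_le_two (X := {x // x ∈ Function.fixedPoints g})
    (by rw [card_fixed]; omega)
    (fixHom g ⟨a, Subgroup.mem_centralizer_singleton_iff.2 ha.eq⟩)
    (fixHom g ⟨b, Subgroup.mem_centralizer_singleton_iff.2 hb.eq⟩)
  exact congrArg Subtype.val (DFunLike.congr_fun h ⟨x, hx⟩)

end Perm

lemma sign_map_s {n : ℕ} {f : B n →* Perm (Fin n)} (hf : Function.Surjective f) {i : ℕ}
    (hi : i + 1 < n) : Perm.sign (f (s i)) = -1 := by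
  by_contra h
  have h0 : ∀ j, j + 1 < n → Perm.sign (f (s j)) = Perm.sign (f (s 0)) := by
    intro j hj
    obtain ⟨w, hw⟩ := s_conj hj
    rw [hw, map_mul, map_mul, map_inv, map_mul, map_mul, map_inv, mul_comm, inv_mul_cancel_left]
  have h1 : Perm.sign (f (s 0)) = 1 := by
    rw [← h0 i hi]
    exact (Int.units_eq_one_or _).resolve_right h
  have h2 : Perm.sign.comp f = 1 := hom_ext fun j hj => by
    rw [MonoidHom.comp_apply, h0 j hj, h1, MonoidHom.one_apply]
  obtain ⟨b, hb⟩ := hf (swap ⟨i, by omega⟩ ⟨i + 1, hi⟩)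
  have h3 := DFunLike.congr_fun h2 b
  rw [MonoidHom.comp_apply, hb, Perm.sign_swap (by simp), MonoidHom.one_apply] at h3
  exact absurd h3 (by decide)

lemma map_s_isSwap_of_seven_le {n : ℕ} (hn : 7 ≤ n) {f : B n →* Perm (Fin n)}
    (h : f (s 0) ≠ f (s 1)) : (f (s 0)).IsSwap := by
  by_contra hsw
  obtain ⟨k, rfl⟩ : ∃ k, n = k + 2 := ⟨n - 2, by omega⟩
  have h1 := two_mul_card_cycleFactorsFinset (f (s 0))
  have h2 := Finset.card_le_univ (f (s 0)).support
  have h3 := Perm.two_le_card_support_of_ne_one (f := f (s 0)) fun h' =>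
    h (map_one_eq (by omega) h')
  rw [← Perm.card_support_eq_two] at hsw
  rw [Fintype.card_fin] at h2
  refine h (map_eq_of_small (by omega) (fun Y _ f hY => map_eq_of_card_lt (by omega) Y f hY) f
      (by omega) ?_)
  rw [card_fixed, Fintype.card_fin]
  omega

lemma map_s_sq_eq_one {n : ℕ} (hn : 5 ≤ n) (hn6 : n ≤ 6) {f : B n →* Perm (Fin n)}
    (hf : Function.Surjective f) (h : f (s 0) ≠ f (s 1)) : f (s 0) ^ 2 = 1 := by
  by_contra hg
  have h1 := commute_of_odd (by simpa using hn6) (sign_map_s hf (by omega)) hg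
    (commute_map f (i := 0) (j := 2) (by omega)).symm
    (commute_map f (i := 0) (j := 3) (by omega)).symm
  exact h (map_s_eq f (i := 2) (by omega) (eq_of_commute f (by omega) h1) (by omega)).symm

/-- An odd involution on at most six points is a transposition or fixed point free. -/
lemma isSwap_or_fixed_point_free {X : Type} [Fintype X] [DecidableEq X] {g : Perm X}
    (hX : Fintype.card X ≤ 6) (hs : Perm.sign g = -1) (hg : g ^ 2 = 1) :
    g.IsSwap ∨ Fintype.card X = 6 ∧ ∀ x, g x ≠ x := by
  have h1 := Finset.card_le_univ g.support
  have h4 : ∀ l ∈ g.cycleType, l = 2 := fun l hl => by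
    have h5 := Perm.two_le_of_mem_cycleType hl
    have h6 : l ∣ 2 := (Perm.dvd_of_mem_cycleType hl).trans (orderOf_dvd_iff_pow_eq_one.2 hg)
    exact le_antisymm (Nat.le_of_dvd (by omega) h6) h5
  have h2 := Multiset.eq_replicate_card.2 h4
  have h3 : g.support.card = g.cycleType.card * 2 := by
    rw [← Perm.sum_cycleType]
    nth_rewrite 1 [h2]
    rw [Multiset.sum_replicate, smul_eq_mul]
  have hodd : ¬ Even (g.cycleType.sum + g.cycleType.card) := fun h => by
    rw [Perm.sign_of_cycleType, h.neg_one_pow] at hs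
    exact absurd hs (by decide)
  rw [Perm.sum_cycleType, Nat.not_even_iff] at hodd
  by_cases h5 : g.cycleType.card = 1
  · exact Or.inl (Perm.card_support_eq_two.1 (by omega))
  · refine Or.inr ⟨by omega, fun x => Perm.mem_support.1 ?_⟩
    rw [Finset.eq_univ_of_card g.support (by omega)]
    exact Finset.mem_univ x

end BraidAut

namespace BraidAut

open Equiv

/-- The total crossing number of strand `q` with the other strands. -/
noncomputable def row {n : ℕ} (b : B n) (q : ℕ) : ℤ := ∑ t ∈ Finset.range n, c b q t

lemma sum_range_perm {n : ℕ} (b : B n) (f : ℕ → ℤ) :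
    ∑ t ∈ Finset.range n, f ((π b)⁻¹ t) = ∑ t ∈ Finset.range n, f t := by
  refine Finset.sum_equiv (π b)⁻¹ (fun t => ?_) fun _ _ => rfl
  rw [Finset.mem_range, Finset.mem_range, ← map_inv, π_lt_iff]

lemma sum_row {n : ℕ} (b : B n) : ∑ q ∈ Finset.range n, row b q = 2 * ex b := sum_c b

lemma row_apply_of_commute {n : ℕ} {a p : B n} (hp : π p = 1) (h : Commute a p) (q : ℕ) :
    row p ((π a) q) = row p q := by
  have h1 : a * p * a⁻¹ = p := by rw [h.eq, mul_inv_cancel_right]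
  rw [row, row, ← sum_range_perm a fun t => c p q t]
  refine Finset.sum_congr rfl fun t _ => ?_
  rw [← congrArg (fun x => c x (π a q) t) h1]
  show c (a * p * a⁻¹) _ _ = _
  rw [c_conj a hp, Perm.inv_eq_iff_eq.2 rfl]

/-- If a braid permuting the strands transitively commutes with a pure braid `p`, then all the
strands have the same even crossing number in `p`. -/
lemma two_mul_ex_of_commute {n : ℕ} {a p : B n} (hp : π p = 1) (h : Commute a p)
    (ht : ∀ q < n, ∃ k : ℕ, ((π a) ^ k) 0 = q) : ∃ r : ℤ, ex p = n * r := by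
  have h1 : ∀ k : ℕ, row p (((π a) ^ k) 0) = row p 0 := by
    intro k
    induction k with
    | zero => rfl
    | succ k ih => rw [pow_succ', Perm.mul_apply, row_apply_of_commute hp h, ih]
  have h2 : Even (row p 0) := Finset.even_sum _ fun t _ => even_c hp 0 t
  obtain ⟨r, hr⟩ := h2
  refine ⟨r, ?_⟩
  have h3 := sum_row p
  rw [Finset.sum_congr rfl (g := fun _ => row p 0) fun q hq => by
    obtain ⟨k, hk⟩ := ht q (Finset.mem_range.1 hq)
    rw [← hk, h1 k], Finset.sum_const, Finset.card_range, hr, nsmul_eq_mul] at h3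
  linarith

lemma finPerm_pow_apply {n m : ℕ} (h : n ≤ m) (b : B n) (k : ℕ) (x : Fin m) :
    (((finPerm h b) ^ k) x : ℕ) = ((π b) ^ k) x := by
  rw [← map_pow, ← map_pow, finPerm_apply]

lemma finPerm_eq_one {n m : ℕ} (h : n ≤ m) {b : B n} : finPerm h b = 1 ↔ π b = 1 := by
  rw [← map_one (finPerm h), finPerm_eq_iff, map_one]

/-- The action on the strands twisted by an automorphism. -/
def strandHom {n : ℕ} (φ : MulAut (B n)) : B n →* Perm (Fin n) := (finPerm le_rfl).comp φ.toMonoidHom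

lemma strandHom_apply {n : ℕ} (φ : MulAut (B n)) (b : B n) : strandHom φ b = finPerm le_rfl (φ b) := rfl

lemma strandHom_surjective {n : ℕ} (φ : MulAut (B n)) : Function.Surjective (strandHom φ) :=
  finPerm_surjective.comp φ.surjective

lemma strandHom_ne {n : ℕ} (φ : MulAut (B n)) {i : ℕ} (hi : i + 2 < n) :
    strandHom φ (s i) ≠ strandHom φ (s (i + 1)) := fun h =>
  π_map_ne φ hi ((finPerm_eq_iff le_rfl).1 h)

lemma two_mul_ex_of_strandHom {n : ℕ} (hn : 0 < n) {φ : MulAut (B n)} (hφ : ∀ b, ex (φ b) = ex b)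
    {a p : B n} (hp : strandHom φ p = 1) (h : Commute a p)
    (ht : ∀ q : Fin n, ∃ k : ℕ, ((strandHom φ a) ^ k) ⟨0, hn⟩ = q) : ∃ r : ℤ, ex p = n * r := by
  rw [← hφ]
  refine two_mul_ex_of_commute (a := φ a) ((finPerm_eq_one le_rfl).1 hp) (h.map φ) fun q hq => ?_
  obtain ⟨k, hk⟩ := ht ⟨q, hq⟩
  exact ⟨k, by rw [← finPerm_pow_apply le_rfl _ k ⟨0, hn⟩, ← strandHom_apply, hk]⟩

lemma dvd_card_support {X : Type} [Fintype X] [DecidableEq X] {g : Perm X} {p : ℕ}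
    (hp : p.Prime) (hg : g ^ p = 1) : p ∣ g.support.card := by
  rw [← Perm.sum_cycleType]
  refine Multiset.dvd_sum fun l hl => ?_
  have h1 : l ∣ p := (Perm.dvd_of_mem_cycleType hl).trans (orderOf_dvd_iff_pow_eq_one.2 hg)
  have h2 := Perm.two_le_of_mem_cycleType hl
  rw [((Nat.dvd_prime hp).1 h1).resolve_left (by omega)]

lemma ne_of_commute_of_cube {g r : Perm (Fin 6)} (hg : ∀ x, g x ≠ x) (hg2 : g ^ 2 = 1)
    (hr : r ≠ 1) (hr3 : r ^ 3 = 1) (h : Commute g r) (x : Fin 6) : r x ≠ x := by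
  obtain ⟨m, hm⟩ := dvd_card_support Nat.prime_three hr3
  have h1 := Finset.card_le_univ r.support
  have h2 := Perm.two_le_card_support_of_ne_one hr
  have h3 := card_fixed r
  rw [Fintype.card_fin] at h1 h3
  let a : Subgroup.centralizer {r} := ⟨g, Subgroup.mem_centralizer_singleton_iff.2 h.eq⟩
  have h4 : fixHom r a ^ 2 = 1 := by
    rw [← map_pow, show a ^ 2 = 1 from Subtype.ext hg2, map_one]
  have h5 : (fixHom r a).support = Finset.univ := by
    refine Finset.eq_univ_of_forall fun y => Perm.mem_support.2 fun hy => hg y ?_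
    exact congrArg Subtype.val hy
  obtain ⟨l, hl⟩ := dvd_card_support Nat.prime_two h4
  rw [h5, Finset.card_univ] at hl
  rw [← Perm.mem_support, Finset.eq_univ_of_card r.support (by rw [Fintype.card_fin]; omega)]
  exact Finset.mem_univ x

lemma exists_pow_apply_eq {g r : Perm (Fin 6)} (hg : ∀ x, g x ≠ x) (hg2 : g ^ 2 = 1)
    (hr : ∀ x, r x ≠ x) (hr3 : r ^ 3 = 1) (h : Commute g r) (x y : Fin 6) :
    ∃ k : ℕ, ((g * r) ^ k) x = y := by
  have h6 : (g * r) ^ 6 = 1 := by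
    rw [h.mul_pow, pow_mul g 2 3, hg2, one_pow, pow_mul r 3 2, hr3, one_pow, one_mul]
  have h2 : ((g * r) ^ 2) x ≠ x := fun h' => hr x (by
    rw [h.mul_pow, hg2, one_mul] at h'
    rw [← h', ← Perm.mul_apply, ← pow_succ', hr3, Perm.one_apply, h'])
  have h3 : ((g * r) ^ 3) x ≠ x := by
    rw [h.mul_pow, hr3, mul_one, pow_succ, hg2, one_mul]
    exact hg x
  have hmin : Function.minimalPeriod (g * r) x = 6 := by
    have hd : Function.minimalPeriod (g * r) x ∣ 6 := by
      refine Function.IsPeriodicPt.minimalPeriod_dvd ?_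
      rw [Function.IsPeriodicPt, ← Perm.coe_pow, h6]
      rfl
    have hd2 : ¬ Function.minimalPeriod (g * r) x ∣ 2 := fun hd => h2 (by
      have := (Function.isPeriodicPt_iff_minimalPeriod_dvd).2 hd
      rwa [Function.IsPeriodicPt, ← Perm.coe_pow] at this)
    have hd3 : ¬ Function.minimalPeriod (g * r) x ∣ 3 := fun hd => h3 (by
      have := (Function.isPeriodicPt_iff_minimalPeriod_dvd).2 hd
      rwa [Function.IsPeriodicPt, ← Perm.coe_pow] at this)
    have hle := Nat.le_of_dvd (by omega) hd
    generalize Function.minimalPeriod (g * r) x = d at *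
    interval_cases d <;> omega
  have hinj : Function.Injective fun k : Fin 6 => ((g * r) ^ (k : ℕ)) x := fun k l hkl => by
    refine Fin.ext (Function.iterate_injOn_Iio_minimalPeriod (f := g * r) (x := x) ?_ ?_ ?_)
    · exact Set.mem_Iio.2 (k.2.trans_eq hmin.symm)
    · exact Set.mem_Iio.2 (l.2.trans_eq hmin.symm)
    · simpa only [Perm.coe_pow] using hkl
  obtain ⟨k, hk⟩ := Finite.surjective_of_injective hinj y
  exact ⟨k, hk⟩

lemma not_fixed_point_free {φ : MulAut (B 6)} (hφ : ∀ b, ex (φ b) = ex b)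
    (hg2 : strandHom φ (s 0) ^ 2 = 1) : ¬ ∀ x, strandHom φ (s 0) x ≠ x := by
  intro hg
  have hi2 : ∀ i, i + 1 < 6 → strandHom φ (s i) * strandHom φ (s i) = 1 := by
    intro i hi
    obtain ⟨w, hw⟩ := s_conj hi
    rw [hw, map_mul, map_mul, map_inv, ← pow_two, conj_pow, hg2, mul_one, mul_inv_cancel]
  have hr : strandHom φ (s 2 * s 3) ≠ 1 := fun h => strandHom_ne φ (i := 2) (by omega) (by
    rw [map_mul] at h
    rw [eq_inv_of_mul_eq_one_left h, ← eq_inv_of_mul_eq_one_left (hi2 3 (by omega))])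
  have hr3 : strandHom φ (s 2 * s 3) ^ 3 = 1 := by
    have hb := braid_map (strandHom φ) (i := 2) (by omega)
    rw [map_mul]
    calc _ = (strandHom φ (s 2) * strandHom φ (s 3) * strandHom φ (s 2)) *
          (strandHom φ (s 3) * strandHom φ (s 2) * strandHom φ (s 3)) := by
          simp only [pow_succ, pow_zero, one_mul, mul_assoc]
      _ = strandHom φ (s 2) * strandHom φ (s 3) * (strandHom φ (s 2) * strandHom φ (s 2)) * strandHom φ (s 3) *
          strandHom φ (s 2) := by rw [← hb]; group
      _ = 1 := by rw [hi2 2 (by omega), mul_one, mul_assoc (strandHom φ (s 2)), hi2 3 (by omega),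
                    mul_one, hi2 2 (by omega)]
  have hc : Commute (s 0 : B 6) (s 2 * s 3) :=
    Commute.mul_right (s_comm (by omega)) (s_comm (by omega))
  obtain ⟨r, h⟩ := two_mul_ex_of_strandHom (by omega) hφ (a := s 0 * (s 2 * s 3)) (p := s 0 ^ 2)
    (by rw [map_pow, hg2]) (((Commute.refl _).mul_left hc.symm).pow_right 2) fun q => by
      rw [map_mul]
      exact exists_pow_apply_eq hg hg2 (ne_of_commute_of_cube hg hg2 hr hr3 (hc.map _)) hr3
        (hc.map _) _ q
  rw [ex_pow, ex_s (by omega)] at h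
  push_cast at h
  omega

set_option maxRecDepth 100000 in
lemma fin_four_odd : ∀ g : Perm (Fin 4), Perm.sign g = -1 → g ^ 2 ≠ 1 →
    (∀ q, ∃ k : Fin 4, (g ^ (k : ℕ)) 0 = q) ∧ ∀ a : Perm (Fin 4), (∀ i, g (a i) = a (g i)) →
      Perm.sign a = -1 → a = g ∨ a = g⁻¹ := by
  decide +kernel

lemma map_eq_one_of_central {n : ℕ} (hn : 3 ≤ n) {f : B n →* Perm (Fin n)}
    (hf : Function.Surjective f) {p : B n} (hp : ∀ b, Commute (f p) (f b)) : f p = 1 := by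
  by_contra h
  obtain ⟨x, hx⟩ : ∃ x, f p x ≠ x := by
    by_contra! h'
    exact h (Perm.ext h')
  obtain ⟨z, hzx, hz⟩ := Finset.exists_mem_ne (s := (Finset.univ : Finset (Fin n)).erase x) (by
    rw [Finset.card_erase_of_mem (Finset.mem_univ _), Finset.card_univ, Fintype.card_fin]
    omega) (f p x)
  obtain ⟨b, hb⟩ := hf (swap x z)
  have h1 := DFunLike.congr_fun (hp b).eq x
  rw [hb, Perm.mul_apply, Perm.mul_apply, swap_apply_left,
    swap_apply_of_ne_of_ne hx hz.symm] at h1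
  exact (Finset.ne_of_mem_erase hzx) ((f p).injective h1)

lemma commute_of_braid {G : Type*} [Group G] {x y : G} (h : x * y * x = y * x * y) :
    Commute ((x * y * x) ^ 2) x ∧ Commute ((x * y * x) ^ 2) y := by
  have h1 : x * y * x * x = y * (x * y * x) := by
    nth_rewrite 1 [h]
    simp only [mul_assoc]
  have h2 : x * y * x * y = x * (x * y * x) := by
    nth_rewrite 2 [h]
    simp only [mul_assoc]
  constructor
  · rw [Commute, SemiconjBy, pow_two, mul_assoc, h1, ← mul_assoc, h2, mul_assoc]
  · rw [Commute, SemiconjBy, pow_two, mul_assoc, h2, ← mul_assoc, h1, mul_assoc]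

lemma strandHom_s_sq_eq_one {φ : MulAut (B 4)} (hφ : ∀ b, ex (φ b) = ex b) :
    strandHom φ (s 0) ^ 2 = 1 := by
  by_contra hg
  obtain ⟨ht, ha⟩ := fin_four_odd _ (sign_map_s (strandHom_surjective φ) (by omega)) hg
  have ht' : ∀ q : Fin 4, ∃ k : ℕ, (strandHom φ (s 0) ^ k) ⟨0, by omega⟩ = q := fun q => by
    obtain ⟨k, hk⟩ := ht q
    exact ⟨k, hk⟩
  rcases ha (strandHom φ (s 2))
    (DFunLike.congr_fun (commute_map (strandHom φ) (i := 0) (j := 2) (by omega)))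
    (sign_map_s (strandHom_surjective φ) (by omega)) with h | h
  · have hc := commute_of_braid (s_braid (n := 4) (i := 0) (by omega))
    have hp : strandHom φ ((s 0 * s 1 * s 0) ^ 2) = 1 := by
      refine map_eq_one_of_central (by omega) (strandHom_surjective φ) fun b => ?_
      refine (Subgroup.mem_centralizer_singleton_iff.1 (mem_of_s (H := (Subgroup.centralizer
        {strandHom φ ((s 0 * s 1 * s 0) ^ 2)}).comap (strandHom φ)) (fun i hi => ?_) b)).symm
      rw [Subgroup.mem_comap, Subgroup.mem_centralizer_singleton_iff]
      obtain rfl | rfl | rfl : i = 0 ∨ i = 1 ∨ i = 2 := by omega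
      · exact (hc.1.map _).symm.eq
      · exact (hc.2.map _).symm.eq
      · rw [h]
        exact (hc.1.map _).symm.eq
    obtain ⟨r, h⟩ := two_mul_ex_of_strandHom (by omega) hφ hp hc.1.symm ht'
    rw [ex_pow, ex_mul, ex_mul, ex_s (by omega), ex_s (by omega)] at h
    push_cast at h
    omega
  · have hc : Commute (s 0 : B 4) (s 2) := s_comm (by omega)
    obtain ⟨r, h⟩ := two_mul_ex_of_strandHom (by omega) hφ (a := s 0) (p := s 0 * s 2)
      (by rw [map_mul, h, mul_inv_cancel]) ((Commute.refl _).mul_right hc) ht'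
    rw [ex_mul, ex_s (by omega), ex_s (by omega)] at h
    push_cast at h
    omega

end BraidAut

namespace BraidAut

open Equiv

lemma strandHom_isSwap {n : ℕ} (hn : 4 ≤ n) {φ : MulAut (B n)} (hφ : ∀ b, ex (φ b) = ex b) {i : ℕ}
    (hi : i + 1 < n) : (strandHom φ (s i)).IsSwap := by
  obtain ⟨w, hw⟩ := s_conj hi
  rw [← Perm.card_support_eq_two, hw, map_mul, map_mul, map_inv, Perm.card_support_conj,
    Perm.card_support_eq_two]
  rcases Nat.lt_or_ge n 7 with h7 | h7
  · have h2 : strandHom φ (s 0) ^ 2 = 1 := by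
      rcases hn.eq_or_lt with rfl | hn
      · exact strandHom_s_sq_eq_one hφ
      · exact map_s_sq_eq_one hn (by omega) (strandHom_surjective φ) (strandHom_ne φ (by omega))
    refine (isSwap_or_fixed_point_free (by rw [Fintype.card_fin]; omega)
      (sign_map_s (strandHom_surjective φ) (by omega)) h2).resolve_right fun h => ?_
    rw [Fintype.card_fin] at h
    obtain rfl := h.1
    exact not_fixed_point_free hφ h2 h.2
  · exact map_s_isSwap_of_seven_le h7 (strandHom_ne φ (by omega))

section Swap

variable {X : Type} [DecidableEq X]

lemma eq_of_commute_swap {x y z : X} (hy : x ≠ y) (hz : x ≠ z)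
    (h : Commute (swap x y) (swap x z)) : y = z := by
  by_contra hyz
  have h1 := DFunLike.congr_fun h.eq x
  rw [Perm.mul_apply, Perm.mul_apply, swap_apply_left, swap_apply_left,
    swap_apply_of_ne_of_ne hz.symm (Ne.symm hyz), swap_apply_of_ne_of_ne hy.symm hyz] at h1
  exact hyz h1.symm

lemma exists_swap_of_not_commute {a b : Perm X} (ha : a.IsSwap) (hb : b.IsSwap)
    (h : ¬ Commute a b) : ∃ x y z, x ≠ y ∧ y ≠ z ∧ x ≠ z ∧ a = swap x y ∧ b = swap y z := by
  obtain ⟨x, y, hxy, rfl⟩ := ha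
  obtain ⟨z, w, hzw, rfl⟩ := hb
  have key : ∀ {x y z : X}, x ≠ y → y ≠ z → ¬ Commute (swap x y) (swap y z) →
      ∃ x' y' z', x' ≠ y' ∧ y' ≠ z' ∧ x' ≠ z' ∧ swap x y = swap x' y' ∧ swap y z = swap y' z' := by
    intro x y z hxy hyz h
    refine ⟨x, y, z, hxy, hyz, ?_, rfl, rfl⟩
    rintro rfl
    exact h (by rw [swap_comm x y])
  by_cases h1 : y = z
  · subst h1
    exact key hxy hzw h
  by_cases h2 : y = w
  · subst h2
    rw [swap_comm z y] at h ⊢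
    exact key hxy hzw.symm h
  by_cases h3 : x = z
  · subst h3
    rw [swap_comm x y] at h ⊢
    exact key hxy.symm hzw h
  by_cases h4 : x = w
  · subst h4
    rw [swap_comm x y, swap_comm z x] at h ⊢
    exact key hxy.symm hzw.symm h
  refine absurd (Perm.Disjoint.commute fun p => ?_) h
  by_cases hx : p = x
  · exact Or.inr (by rw [hx, swap_apply_of_ne_of_ne h3 h4])
  by_cases hy : p = y
  · exact Or.inr (by rw [hy, swap_apply_of_ne_of_ne h1 h2])
  exact Or.inl (swap_apply_of_ne_of_ne hx hy)

end Swap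

section Label

variable {n : ℕ} {f : B n →* Perm (Fin n)} (hs : ∀ i, i + 1 < n → (f (s i)).IsSwap)
  (hne : ∀ i, i + 2 < n → f (s i) ≠ f (s (i + 1)))

include hne in
lemma not_commute_map {i : ℕ} (hi : i + 2 < n) : ¬ Commute (f (s i)) (f (s (i + 1))) := fun h =>
  hne i hi (eq_of_commute f hi h)

include hs hne in
lemma map_s_ne_add_two (hf : Function.Surjective f) {i : ℕ} (hi : i + 3 < n) :
    f (s i) ≠ f (s (i + 2)) := by
  intro h
  rcases Nat.eq_zero_or_pos i with rfl | h0
  · rcases (show 4 ≤ n by omega).eq_or_lt with rfl | h4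
    · obtain ⟨x, y, z, hxy, hyz, hxz, h0, h1⟩ := exists_swap_of_not_commute (hs 0 (by omega))
        (hs 1 (by omega)) (not_commute_map hne (by omega))
      obtain ⟨w, hw⟩ : ∃ w, w ∉ ({x, y, z} : Finset (Fin 4)) := by
        by_contra! hw
        have h2 := Finset.card_le_three (a := x) (b := y) (c := z)
        rw [Finset.eq_univ_of_forall hw, Finset.card_univ, Fintype.card_fin] at h2
        omega
      simp only [Finset.mem_insert, Finset.mem_singleton, not_or] at hw
      obtain ⟨b, hb⟩ := hf (swap w x)
      have h3 : f b w = w := by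
        refine mem_of_s (H := (MulAction.stabilizer (Perm (Fin 4)) w).comap f) (fun i hi => ?_) b
        rw [Subgroup.mem_comap, MulAction.mem_stabilizer_iff, Perm.smul_def]
        obtain rfl | rfl | rfl : i = 0 ∨ i = 1 ∨ i = 2 := by omega
        · rw [h0, swap_apply_of_ne_of_ne hw.1 hw.2.1]
        · rw [h1, swap_apply_of_ne_of_ne hw.2.1 hw.2.2]
        · rw [← h, h0, swap_apply_of_ne_of_ne hw.1 hw.2.1]
      rw [hb, swap_apply_left] at h3
      exact hw.1 h3.symm
    · refine not_commute_map hne (i := 2) (by omega) ?_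
      rw [← h]
      exact commute_map f (by omega)
  · obtain ⟨j, rfl⟩ : ∃ j, i = j + 1 := ⟨i - 1, by omega⟩
    refine not_commute_map hne (i := j) (by omega) ?_
    rw [h]
    exact commute_map f (by omega)

include hs hne in
lemma exists_label (hf : Function.Surjective f) (hn : 4 ≤ n) {k : ℕ} (hk2 : 2 ≤ k) (hk : k < n) :
    ∃ q : ℕ → Fin n, Set.InjOn q (Set.Iic k) ∧ ∀ i < k, f (s i) = swap (q i) (q (i + 1)) := by
  induction k, hk2 using Nat.le_induction with
  | base =>
    obtain ⟨x, y, z, hxy, hyz, hxz, h0, h1⟩ := exists_swap_of_not_commute (hs 0 (by omega))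
      (hs 1 (by omega)) (not_commute_map hne (by omega))
    let q : ℕ → Fin n := fun i => if i = 0 then x else if i = 1 then y else z
    refine ⟨q, fun i hi j hj hij => ?_, fun i hi => ?_⟩
    · rw [Set.mem_Iic] at hi hj
      interval_cases i <;> interval_cases j <;> simp_all [q]
    · interval_cases i
      · exact h0
      · exact h1
  | succ k hk2 ih =>
    obtain ⟨q, hq, hs'⟩ := ih (by omega)
    obtain ⟨m, rfl⟩ : ∃ m, k = m + 2 := ⟨k - 2, by omega⟩
    have hqne : ∀ {i j}, i ≤ m + 2 → j ≤ m + 2 → i ≠ j → q i ≠ q j := fun hi hj h h' =>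
      h (hq (Set.mem_Iic.2 hi) (Set.mem_Iic.2 hj) h')
    obtain ⟨x, y, z, hxy, hyz, hxz, h0, h1⟩ := exists_swap_of_not_commute (hs (m + 1) (by omega))
      (hs (m + 2) (by omega)) (not_commute_map hne (by omega))
    have hy : y = q (m + 2) ∧ x = q (m + 1) := by
      have h2 : f (s (m + 1)) = swap (q (m + 1)) (q (m + 2)) := hs' _ (by omega)
      rw [h0] at h2
      have h3 : y = q (m + 1) ∨ y = q (m + 2) := by
        by_contra! h
        have h4 := DFunLike.congr_fun h2 y
        rw [swap_apply_right, swap_apply_of_ne_of_ne h.1 h.2] at h4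
        exact hxy h4
      have h5 := DFunLike.congr_fun h2 y
      rw [swap_apply_right] at h5
      rcases h3 with h3 | h3
      · exfalso
        have h4 : f (s m) = swap (q m) (q (m + 1)) := hs' _ (by omega)
        rw [← h3, swap_comm] at h4
        have h6 := eq_of_commute_swap (x := y) (y := q m) (z := z)
          (h3.trans_ne (hqne (by omega) (by omega) (by omega))) hyz (by
          rw [← h4, ← h1]
          exact commute_map f (by omega))
        exact map_s_ne_add_two hs hne hf (i := m) (by omega) (by rw [h4, h1, h6])
      · exact ⟨h3, by rw [h5, h3, swap_apply_right]⟩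
    obtain ⟨rfl, rfl⟩ := hy
    have hz : ∀ j ≤ m + 2, q j ≠ z := by
      intro j hj hjz
      rcases hj.eq_or_lt with rfl | hj
      · exact hyz hjz
      rcases (show j ≤ m + 1 by omega).eq_or_lt with rfl | hj
      · exact hxz hjz
      have h2 := hs' j (by omega)
      rw [← hjz, swap_comm] at h1
      exact hqne (by omega) (by omega) (by omega) (eq_of_commute_swap
        (hqne (i := j) (j := j + 1) (by omega) (by omega) (by omega))
        (hqne (i := j) (j := m + 2) (by omega) (by omega) (by omega)) (by
          rw [← h2, ← h1]
          exact commute_map f (by omega)))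
    refine ⟨fun i => if i ≤ m + 2 then q i else z, fun i hi j hj hij => ?_, fun i hi => ?_⟩
    · rw [Set.mem_Iic] at hi hj
      dsimp only at hij
      split_ifs at hij with h2 h3 h3
      · exact hq (Set.mem_Iic.2 h2) (Set.mem_Iic.2 h3) hij
      · exact absurd hij (hz i h2)
      · exact absurd hij.symm (hz j h3)
      · omega
    · dsimp only
      rcases (show i ≤ m + 2 by omega).eq_or_lt with rfl | hi
      · rw [if_pos le_rfl, if_neg (by omega), h1]
      · rw [if_pos (by omega), if_pos (by omega), hs' i hi]

end Label

/-- Up to inner automorphisms, an automorphism preserving the exponent sum preserves the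
permutation of the strands. -/
lemma exists_π_conj_eq {n : ℕ} (hn : 4 ≤ n) {φ : MulAut (B n)} (hφ : ∀ b, ex (φ b) = ex b) :
    ∃ w : B n, ∀ b, π (w⁻¹ * φ b * w) = π b := by
  obtain ⟨q, hq, hs⟩ := exists_label (fun i hi => strandHom_isSwap hn hφ hi)
    (fun i hi => strandHom_ne φ hi) (strandHom_surjective φ) hn (k := n - 1) (by omega) (by omega)
  have hinj : Function.Injective fun i : Fin n => q i := fun i j hij => by
    refine Fin.ext (hq ?_ ?_ hij) <;> rw [Set.mem_Iic] <;> omega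
  obtain ⟨w, hw⟩ := finPerm_surjective
    (Equiv.ofBijective _ (Finite.injective_iff_bijective.1 hinj))
  have key : (strandHom φ) = (MulAut.conj (finPerm le_rfl w)).toMonoidHom.comp (finPerm le_rfl) := by
    refine hom_ext fun i hi => ?_
    show strandHom φ (s i) = finPerm le_rfl w * finPerm le_rfl (s i) * (finPerm le_rfl w)⁻¹
    rw [hs i (by omega), finPerm_s hi, hw]
    exact swap_apply_apply (Equiv.ofBijective _ (Finite.injective_iff_bijective.1 hinj))
      ⟨i, by omega⟩ ⟨i + 1, hi⟩
  refine ⟨w, fun b => (finPerm_eq_iff le_rfl).1 ?_⟩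
  have h := DFunLike.congr_fun key b
  rw [strandHom_apply] at h
  rw [map_mul, map_mul, map_inv, h]
  show (finPerm le_rfl w)⁻¹ * (finPerm le_rfl w * finPerm le_rfl b * (finPerm le_rfl w)⁻¹) *
    finPerm le_rfl w = _
  group

end BraidAut

namespace BraidAut

open Equiv

variable {n : ℕ}

lemma row_sq {i : ℕ} (hi : i + 1 < n) (q : ℕ) :
    row (s i ^ 2 : B n) q = if q = i ∨ q = i + 1 then 2 else 0 := by
  have h : ∀ t, c (s i ^ 2 : B n) q t = (if t = i + 1 then (if q = i then 2 else 0) else 0) +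
      if t = i then (if q = i + 1 then 2 else 0) else 0 := by
    intro t
    rw [c_sq hi, eps]
    split_ifs <;> omega
  simp only [row, h, Finset.sum_add_distrib, Finset.sum_ite_eq', Finset.mem_range]
  split_ifs <;> omega

lemma row_mul_of_pure {a : B n} (b : B n) (ha : π a = 1) (q : ℕ) :
    row (a * b) q = row a q + row b q := by
  simp only [row, c_mul_of_pure b ha, Finset.sum_add_distrib]

lemma row_conj {p : B n} (b : B n) (hp : π p = 1) (q : ℕ) :
    row (b * p * b⁻¹) q = row p ((π b)⁻¹ q) := by
  simp only [row, c_conj b hp]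
  exact sum_range_perm b fun t => c p ((π b)⁻¹ q) t

lemma row_one (q : ℕ) : row (1 : B n) q = 0 :=
  Finset.sum_eq_zero fun t _ => by rw [c_one]; rfl

/-- A linear form in the crossing numbers of `p`, parametrised by `l`, `m` and `k`. -/
noncomputable def crossForm (l m k : ℤ) (p : B n) (q r : ℕ) : ℤ :=
  l * c p q r + m * (row p q + row p r) + k * ex p

/-- The automorphism `φ` acts on the crossing numbers of pure braids through `l`, `m` and `k`. -/
def HasCrossForm (φ : MulAut (B n)) (l m k : ℤ) : Prop :=
  ∀ p : B n, π p = 1 → ∀ q < n, ∀ r < n, q ≠ r → c (φ p) q r = crossForm l m k p q r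

section

variable {φ : MulAut (B n)} (hπ : ∀ b, π (φ b) = π b)

include hπ in
lemma c_map_sq_swap {b : B n} (hn : 1 < n) (hb : Commute b (s 0)) (q r : ℕ) :
    c (φ (s 0 ^ 2)) (π b q) (π b r) = c (φ (s 0 ^ 2)) q r := by
  have h1 : b * s 0 ^ 2 * b⁻¹ = s 0 ^ 2 := by rw [(hb.pow_right 2).eq, mul_inv_cancel_right]
  have h2 := c_conj (p := φ (s 0 ^ 2)) (φ b) (by rw [hπ, π_sq hn]) (π b q) (π b r)
  rwa [← map_inv, ← map_mul, ← map_mul, h1, hπ, Perm.inv_eq_iff_eq.2 rfl,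
    Perm.inv_eq_iff_eq.2 rfl] at h2

include hπ in
lemma c_map_sq_succ {j : ℕ} (hj : 2 ≤ j) (hjn : j + 1 < n) (q r : ℕ) :
    c (φ (s 0 ^ 2)) (swap j (j + 1) q) (swap j (j + 1) r) = c (φ (s 0 ^ 2)) q r := by
  rw [← π_s hjn]
  exact c_map_sq_swap hπ (by omega) (s_comm (by omega)).symm q r

include hπ in
lemma c_map_sq_left {q r : ℕ} (hq : q < 2) (hr : 2 ≤ r) (hrn : r < n) :
    c (φ (s 0 ^ 2)) q r = c (φ (s 0 ^ 2)) 0 2 := by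
  have h0 : c (φ (s 0 ^ 2)) q r = c (φ (s 0 ^ 2)) 0 r := by
    obtain rfl | rfl : q = 0 ∨ q = 1 := by omega
    · rfl
    · have h := c_map_sq_swap hπ (b := s 0) (by omega) (Commute.refl _) 0 r
      rwa [π_s (by omega), swap_apply_left, swap_apply_of_ne_of_ne (by omega) (by omega)] at h
  rw [h0]
  clear h0 hq
  induction r, hr using Nat.le_induction with
  | base => rfl
  | succ r hr ih =>
    rw [← ih (by omega), ← c_map_sq_succ hπ hr hrn 0 r, swap_apply_left,
      swap_apply_of_ne_of_ne (by omega) (by omega)]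

include hπ in
lemma c_map_sq_lt {q r : ℕ} (hq : 2 ≤ q) (hr : q < r) (hrn : r < n) :
    c (φ (s 0 ^ 2)) q r = c (φ (s 0 ^ 2)) 2 3 := by
  have key : ∀ q r, 2 ≤ q → q < r → r < n →
      c (φ (s 0 ^ 2)) q r = c (φ (s 0 ^ 2)) q (q + 1) := by
    intro q r hq hr hrn
    induction r, hr using Nat.le_induction with
    | base => rfl
    | succ r hr ih =>
      rw [← ih (by omega), ← c_map_sq_succ hπ (by omega : 2 ≤ r) hrn q r, swap_apply_left,
        swap_apply_of_ne_of_ne (by omega) (by omega)]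
  rw [key q r hq hr hrn]
  have hqn : q + 1 < n := by omega
  clear hr hrn
  induction q, hq using Nat.le_induction with
  | base => rfl
  | succ q hq ih =>
    rw [← ih (by omega), ← key q (q + 2) hq (by omega) hqn,
      ← c_map_sq_succ hπ hq (by omega) q (q + 2), swap_apply_left,
      swap_apply_of_ne_of_ne (by omega) (by omega)]

include hπ in
lemma exists_c_map_sq_eq (hn : 4 ≤ n) : ∃ l m k : ℤ, Even k ∧
    ∀ q < n, ∀ r < n, q ≠ r → c (φ (s 0 ^ 2)) q r = crossForm l m k (s 0 ^ 2 : B n) q r := by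
  have he : ∀ q r, Even (c (φ (s 0 ^ 2)) q r) := even_c (by rw [hπ, π_sq (by omega)])
  obtain ⟨u, hu⟩ := he 0 1
  obtain ⟨v, hv⟩ := he 0 2
  have hw : c (φ (s 0 ^ 2)) 2 3 = 2 * c (φ (s 0)) 2 3 := by
    rw [map_pow, pow_two, c_mul, hπ, π_s (by omega), swap_inv,
      swap_apply_of_ne_of_ne (by omega) (by omega), swap_apply_of_ne_of_ne (by omega) (by omega),
      two_mul]
  refine ⟨u - 2 * v + c (φ (s 0)) 2 3, v - c (φ (s 0)) 2 3, c (φ (s 0)) 2 3, ?_, ?_⟩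
  · rw [← Int.not_odd_iff_even, c_parity _ (by omega), hπ, π_s (by omega), swap_inv,
      swap_apply_of_ne_of_ne (by omega) (by omega), swap_apply_of_ne_of_ne (by omega) (by omega),
      not_not]
  · have key : ∀ q r, q < r → r < n →
        c (φ (s 0 ^ 2)) q r = crossForm (u - 2 * v + c (φ (s 0)) 2 3) (v - c (φ (s 0)) 2 3)
          (c (φ (s 0)) 2 3) (s 0 ^ 2 : B n) q r := by
      intro q r hqr hrn
      rw [crossForm, c_sq (by omega), row_sq (by omega), row_sq (by omega), ex_pow,
        ex_s (by omega), eps]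
      rcases Nat.lt_or_ge r 2 with hr | hr
      · obtain ⟨rfl, rfl⟩ : q = 0 ∧ r = 1 := by omega
        rw [hu]
        norm_num
        ring
      rcases Nat.lt_or_ge q 2 with hq | hq
      · rw [c_map_sq_left hπ hq hr hrn, hv, if_neg (by omega), if_pos (by omega),
          if_neg (by omega)]
        push_cast
        ring
      · rw [c_map_sq_lt hπ hq hqr hrn, hw, if_neg (by omega), if_neg (by omega),
          if_neg (by omega)]
        push_cast
        ring
    intro q hq r hr hqr
    rcases hqr.lt_or_gt with h | h
    · exact key q r h hr
    · rw [c_symm _ q r, key r q h hq, crossForm, crossForm, c_symm (s 0 ^ 2) r q, add_comm (row _ _)]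

/-- The pure braids with prescribed crossing numbers form a subgroup. -/
def crossSubgroup (l m k : ℤ) : Subgroup (B n) where
  carrier := {p | π p = 1 ∧ ∀ q < n, ∀ r < n, q ≠ r → c (φ p) q r = crossForm l m k p q r}
  one_mem' := ⟨map_one _, fun q _ r _ _ => by
    simp [crossForm, c_one, row_one, ex_one]⟩
  mul_mem' := by
    rintro a b ⟨ha, ha'⟩ ⟨hb, hb'⟩
    refine ⟨by rw [map_mul, ha, hb, mul_one], fun q hq r hr hqr => ?_⟩
    rw [map_mul, c_mul_of_pure _ (by rw [hπ, ha]), ha' q hq r hr hqr, hb' q hq r hr hqr]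
    simp only [crossForm, c_mul_of_pure _ ha, row_mul_of_pure _ ha, ex_mul]
    ring
  inv_mem' := by
    rintro a ⟨ha, ha'⟩
    refine ⟨by rw [map_inv, ha, inv_one], fun q hq r hr hqr => ?_⟩
    rw [map_inv, c_inv, hπ, ha, Perm.one_apply, Perm.one_apply, ha' q hq r hr hqr]
    simp only [crossForm, row, c_inv, ha, Perm.one_apply, ex_inv, Finset.sum_neg_distrib]
    ring

lemma mem_crossSubgroup {l m k : ℤ} {p : B n} : p ∈ crossSubgroup hπ l m k ↔
    π p = 1 ∧ ∀ q < n, ∀ r < n, q ≠ r → c (φ p) q r = crossForm l m k p q r := Iff.rfl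

lemma crossSubgroup_normal (l m k : ℤ) : (crossSubgroup hπ l m k).Normal where
  conj_mem := by
    rintro p ⟨hp, hp'⟩ b
    refine ⟨by rw [map_mul, map_mul, hp, mul_one, map_inv, mul_inv_cancel],
      fun q hq r hr hqr => ?_⟩
    rw [map_mul, map_mul, map_inv, c_conj _ (by rw [hπ, hp]), hπ, crossForm, c_conj b hp,
      row_conj b hp, row_conj b hp, ex_mul, ex_mul, ex_inv, hp' _ ?_ _ ?_ ?_, crossForm]
    · ring
    · rwa [← map_inv, π_lt_iff]
    · rwa [← map_inv, π_lt_iff]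
    · exact (π b)⁻¹.injective.ne hqr

include hπ in
lemma exists_hasCrossForm (hn : 4 ≤ n) : ∃ l m k : ℤ, Even k ∧ HasCrossForm φ l m k := by
  obtain ⟨l, m, k, hk, h⟩ := exists_c_map_sq_eq hπ hn
  refine ⟨l, m, k, hk, fun p hp => ((mem_crossSubgroup hπ).1 ?_).2⟩
  have hN := crossSubgroup_normal hπ l m k
  refine (Subgroup.normalClosure_le_normal (N := crossSubgroup hπ l m k) ?_) (mem_normalClosure hp)
  rintro _ ⟨i, hi, rfl⟩
  obtain ⟨w, hw⟩ := s_conj hi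
  rw [hw, conj_pow]
  exact hN.conj_mem _ ⟨π_sq (by omega), h⟩ w

end

end BraidAut

namespace BraidAut

open Equiv

variable {n : ℕ} {φ : MulAut (B n)}

lemma HasCrossForm.row_map {l m k : ℤ} (h : HasCrossForm φ l m k) {p : B n} (hp : π p = 1) {q : ℕ}
    (hq : q < n) :
    row (φ p) q = (l + (n - 2) * m) * row p q + (2 * m + (n - 1) * k) * ex p := by
  have hmem : q ∈ Finset.range n := Finset.mem_range.2 hq
  have h1 : ∑ t ∈ Finset.range n, crossForm l m k p q t =
      l * row p q + m * (n * row p q + 2 * ex p) + n * (k * ex p) := by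
    simp only [crossForm, Finset.sum_add_distrib, ← Finset.mul_sum, Finset.sum_const,
      Finset.card_range, nsmul_eq_mul, sum_row]
    rw [← row]
    ring
  have h2 : row (φ p) q = ∑ t ∈ (Finset.range n).erase q, crossForm l m k p q t := by
    rw [row, ← Finset.add_sum_erase _ _ hmem, c_self, zero_add]
    refine Finset.sum_congr rfl fun t ht => ?_
    rw [Finset.mem_erase, Finset.mem_range] at ht
    exact h p hp q hq t ht.2 ht.1.symm
  have h3 := Finset.add_sum_erase (Finset.range n) (crossForm l m k p q) hmem
  rw [h2, eq_sub_of_add_eq' h3, h1, crossForm, c_self]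
  ring

lemma perm_inv (hπ : ∀ b, π (φ b) = π b) (b : B n) : π (φ⁻¹ b) = π b := by
  rw [← hπ, ← MulAut.mul_apply, mul_inv_cancel, MulAut.one_apply]

lemma eq_of_cross_equations {N l m k : ℤ} (hN : 4 ≤ N) (hk : Even k) (hl : l = 1 ∨ l = -1)
    (hν : l + (N - 2) * m = 1 ∨ l + (N - 2) * m = -1)
    (h : 2 = 2 * (l + (N - 2) * m) + N * (2 * m + (N - 1) * k)) : l = 1 ∧ m = 0 ∧ k = 0 := by
  have h4 : ∀ x : ℤ, 2 ≤ N → (N - 2) * x = 2 → N = 4 ∧ x = 1 := by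
    intro x _ hx
    have h1 : 0 < x := by nlinarith
    have h2 : x ≤ 1 := by nlinarith
    obtain rfl : x = 1 := by omega
    exact ⟨by linarith, rfl⟩
  obtain ⟨j, rfl⟩ := hk
  rcases hν with hν | hν <;> rw [hν] at h
  · have hρ : 2 * m + (N - 1) * (j + j) = 0 := by
      have h1 : N * (2 * m + (N - 1) * (j + j)) = 0 := by linarith
      exact (mul_eq_zero.1 h1).resolve_left (by omega)
    rcases hl with rfl | rfl
    · have hm : m = 0 := (mul_eq_zero.1 (show (N - 2) * m = 0 by linarith)).resolve_left (by omega)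
      subst hm
      have hj : j + j = 0 := (mul_eq_zero.1 (show (N - 1) * (j + j) = 0 by linarith)).resolve_left
        (by omega)
      exact ⟨rfl, rfl, hj⟩
    · obtain ⟨rfl, rfl⟩ := h4 m (by omega) (by linarith)
      omega
  · have h1 : N * (2 * m + (N - 1) * (j + j)) = 4 := by linarith
    have h2 : 0 < 2 * m + (N - 1) * (j + j) := by nlinarith
    have h3 : 2 * m + (N - 1) * (j + j) ≤ 1 := by nlinarith
    have h5 : 2 * m + (N - 1) * (j + j) = 1 := by omega
    rw [h5] at h1
    obtain rfl : N = 4 := by linarith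
    omega

/-- Automorphisms preserving permutations and exponent sums preserve all crossing numbers. -/
lemma isIA_of_perm (hn : 4 ≤ n) (hπ : ∀ b, π (φ b) = π b) (hφ : ∀ b, ex (φ b) = ex b) :
    IsIA φ := by
  obtain ⟨l, m, k, hk, h⟩ := exists_hasCrossForm hπ hn
  obtain ⟨l', m', k', -, h'⟩ := exists_hasCrossForm (perm_inv hπ) hn
  have hinv : ∀ b, φ⁻¹ (φ b) = b := fun b => by
    rw [← MulAut.mul_apply, inv_mul_cancel, MulAut.one_apply]
  have hl : l' * l = 1 := by
    have hp : π (s 1 ^ 2 : B n) = 1 := π_sq (by omega)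
    have hp' : π (φ (s 1 ^ 2 : B n)) = 1 := by rw [hπ, hp]
    have hD : ∀ {ψ : MulAut (B n)} {l m k : ℤ}, HasCrossForm ψ l m k → ∀ p : B n, π p = 1 →
        c (ψ p) 0 2 - c (ψ p) 0 3 - c (ψ p) 1 2 + c (ψ p) 1 3 =
          l * (c p 0 2 - c p 0 3 - c p 1 2 + c p 1 3) := by
      intro ψ l m k h p hp
      rw [h p hp 0 (by omega) 2 (by omega) (by omega), h p hp 0 (by omega) 3 (by omega) (by omega),
        h p hp 1 (by omega) 2 (by omega) (by omega), h p hp 1 (by omega) 3 (by omega) (by omega)]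
      simp only [crossForm]
      ring
    have h1 := hD h' _ hp'
    rw [hD h _ hp, hinv] at h1
    simp only [c_sq (n := n) (i := 1) (by omega), eps] at h1
    norm_num at h1
    linarith
  have hp : π (s 0 ^ 2 : B n) = 1 := π_sq (by omega)
  have hp' : π (φ (s 0 ^ 2 : B n)) = 1 := by rw [hπ, hp]
  have r0 : row (s 0 ^ 2 : B n) 0 = 2 := by rw [row_sq (by omega), if_pos (by omega)]
  have r2 : row (s 0 ^ 2 : B n) 2 = 0 := by rw [row_sq (by omega), if_neg (by omega)]
  have hν : (l' + (n - 2) * m') * (l + (n - 2) * m) = 1 := by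
    have h0 := h'.row_map hp' (q := 0) (by omega)
    have h2 := h'.row_map hp' (q := 2) (by omega)
    rw [hinv, h.row_map hp (by omega), r0] at h0
    rw [hinv, h.row_map hp (by omega), r2] at h2
    linarith
  have hsum : 2 = 2 * (l + (n - 2) * m) + n * (2 * m + (n - 1) * k) := by
    have h1 := sum_row (φ (s 0 ^ 2))
    rw [Finset.sum_congr rfl fun q hq => h.row_map hp (Finset.mem_range.1 hq),
      Finset.sum_add_distrib, ← Finset.mul_sum, sum_row, Finset.sum_const, Finset.card_range, hφ,
      ex_pow, ex_s (by omega), nsmul_eq_mul] at h1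
    push_cast at h1
    linarith
  have hl1 := Int.eq_one_or_neg_one_of_mul_eq_one' hl
  have hν1 := Int.eq_one_or_neg_one_of_mul_eq_one' hν
  have hn' : (4 : ℤ) ≤ n := by exact_mod_cast hn
  obtain ⟨rfl, rfl, rfl⟩ := eq_of_cross_equations hn' hk (hl1.imp And.right And.right)
    (hν1.imp And.right And.right) hsum
  refine ⟨hπ, fun p hp q r => ?_⟩
  rcases eq_or_ne q r with rfl | hqr
  · rw [c_self, c_self]
  rcases Nat.lt_or_ge q n with hq | hq
  · rcases Nat.lt_or_ge r n with hr | hr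
    · rw [h p hp q hq r hr hqr, crossForm]
      ring
    · rw [c_eq_zero _ (Or.inr hr), c_eq_zero _ (Or.inr hr)]
  · rw [c_eq_zero _ (Or.inl hq), c_eq_zero _ (Or.inl hq)]

lemma ex_conj (g b : B n) : ex (MulAut.conj g b) = ex b := by
  rw [MulAut.conj_apply, ex_mul, ex_mul, ex_inv]
  ring

/-- Automorphisms preserving the exponent sum are inner. -/
lemma exists_conj_of_ex (hn : 4 ≤ n) (hφ : ∀ b, ex (φ b) = ex b) : ∃ g, φ = MulAut.conj g := by
  obtain ⟨w, hw⟩ := exists_π_conj_eq hn hφ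
  have hIA : IsIA (MulAut.conj w⁻¹ * φ) := by
    refine isIA_of_perm hn (fun b => ?_) fun b => ?_
    · rw [← hw b, MulAut.mul_apply, MulAut.conj_apply, inv_inv]
    · rw [MulAut.mul_apply, ex_conj, hφ]
  obtain ⟨g, hg⟩ := hIA.exists_conj (by omega)
  refine ⟨w * g, ?_⟩
  rw [map_mul, ← hg, ← mul_assoc, ← map_mul, mul_inv_cancel, map_one, one_mul]

end BraidAut

/-- Dyer–Grossman: for `n ≥ 4`, `Aut (B n)` is the internal semidirect product of
`Inn (B n) ≅ B n / Z` by a subgroup of order 2. -/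
theorem aut_braid_semidirect (n : ℕ) (hn : 4 ≤ n) :
    ∃ H : Subgroup (MulAut (B n)), Nat.card H = 2 ∧
      Subgroup.IsComplement' (MulAut.conj (G := B n)).range H := by
  have hex : BraidAut.ex (BraidAut.s 0 : B n) = 1 := BraidAut.ex_s (by omega)
  have hmem : ∀ ψ ∈ Subgroup.zpowers (BraidAut.invAut n), ψ = 1 ∨ ψ = BraidAut.invAut n := by
    rintro _ ⟨j, rfl⟩
    have h1 : BraidAut.invAut n ^ (2 : ℤ) = 1 := by rw [zpow_two, BraidAut.invAut_mul]
    obtain ⟨i, rfl | rfl⟩ := Int.even_or_odd' j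
    · exact Or.inl (by simp only [zpow_mul, h1, one_zpow])
    · exact Or.inr (by simp only [zpow_add, zpow_mul, h1, one_zpow, one_mul, zpow_one])
  refine ⟨Subgroup.zpowers (BraidAut.invAut n), ?_, ?_⟩
  · rw [Nat.card_zpowers]
    refine orderOf_eq_prime (by rw [pow_two, BraidAut.invAut_mul]) fun h => ?_
    have h1 := BraidAut.ex_invAut (BraidAut.s 0 : B n)
    rw [h, MulAut.one_apply, hex] at h1
    omega
  · refine Subgroup.isComplement'_of_disjoint_and_mul_eq_univ ?_ ?_
    · rw [Subgroup.disjoint_def]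
      rintro _ ⟨g, rfl⟩ hg
      refine (hmem _ hg).resolve_right fun h => ?_
      have h1 := BraidAut.ex_invAut (BraidAut.s 0 : B n)
      rw [← h, BraidAut.ex_conj, hex] at h1
      omega
    · refine Set.eq_univ_of_forall fun φ => ?_
      rcases BraidAut.ex_map (by omega) φ with h | h
      · obtain ⟨g, hg⟩ := BraidAut.exists_conj_of_ex hn h
        exact Set.mem_mul.2 ⟨φ, ⟨g, hg.symm⟩, 1, one_mem _, mul_one _⟩
      · obtain ⟨g, hg⟩ := BraidAut.exists_conj_of_ex (φ := φ * BraidAut.invAut n) hn fun b => by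
          rw [MulAut.mul_apply, h, BraidAut.ex_invAut, neg_neg]
        exact Set.mem_mul.2 ⟨_, ⟨g, hg.symm⟩, _, Subgroup.mem_zpowers _, by
          rw [mul_assoc, BraidAut.invAut_mul, mul_one]⟩
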